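/- arXiv:2104.09077 — 4 statements merged into one kernel-verified Lean document; each statement's English description precedes it below -/
import Mathlib

section
/- There is an absolute constant C > 0 such that for every 0 < δ ≤ 1 and every f ∈ H³(Ω_δ), one has ‖f‖_{L^∞(Ω_δ)} ≤ C ( Σ_{|a|≤2} δ^{−1/2} ‖∂_v^a f‖_{L²(Ω_δ)} + Σ_{|a|≤2} δ^{1/2} ‖∂_v^a ∂₃ f‖_{L²(Ω_δ)} ), where a ∈ ℕ² ranges over horizontal multi-indices and ∂_v^a = ∂₁^{a₁}∂₂^{a₂}, provided the right-hand side is finite. The constant C is independent of δ and f. -/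
/-!
STATEMENT 2: Anisotropic Sobolev inequality on the thin domain
Ω_δ = ℝ² × (ℝ/δℤ):
‖f‖_{L∞(Ω_δ)} ≤ C ( Σ_{|a|≤2} δ^{-1/2} ‖∂_v^a f‖_{L²(Ω_δ)}
                  + Σ_{|a|≤2} δ^{1/2} ‖∂_v^a ∂₃ f‖_{L²(Ω_δ)} ),
with C independent of δ and f.
-/

noncomputable section
open MeasureTheory
open scoped ENNReal

namespace Stmt2

/-- Points of ℝ³ (the thin domain is realized as δ-periodic functions in the
third coordinate). -/
abbrev Pt : Type := EuclideanSpace ℝ (Fin 3)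

/-- Unit vector in the vertical (third) direction. -/
def e3 : Pt := EuclideanSpace.single 2 1

/-- The fundamental slab ℝ² × [0,δ) representing Ω_δ. -/
def slab (δ : ℝ) : Set Pt := {x : Pt | x 2 ∈ Set.Ico 0 δ}

/-- Partial derivative ∂_j. -/
def pd (j : Fin 3) (f : Pt → ℝ) : Pt → ℝ :=
  fun x => fderiv ℝ f x (EuclideanSpace.single j 1)

/-- L²(Ω_δ) norm (extended-real valued). -/
def L2 (δ : ℝ) (f : Pt → ℝ) : ℝ≥0∞ := eLpNorm f 2 (volume.restrict (slab δ))

/-- Horizontal derivatives ∂_v^a = ∂₁^{a₁} ∂₂^{a₂} for a ∈ ℕ². -/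
def pdv (a : Fin 2 → ℕ) (f : Pt → ℝ) : Pt → ℝ := (pd 0)^[a 0] ((pd 1)^[a 1] f)

/-- Horizontal multi-indices a ∈ ℕ² with |a| ≤ n. -/
def idx2 (n : ℕ) : Finset (Fin 2 → ℕ) :=
  (Fintype.piFinset fun _ => Finset.range (n+1)).filter fun a => ∑ i, a i ≤ n

/-- A one-dimensional Sobolev inequality: a `C¹` function is bounded on an interval by its
average plus the total variation. -/
lemma enorm_le_average_add_lintegral_deriv {g : ℝ → ℝ} (hg : ContDiff ℝ 1 g) {a b t : ℝ}
    (ht : t ∈ Set.Ico a b) :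
    ‖g t‖ₑ ≤ ENNReal.ofReal (b - a)⁻¹ * (∫⁻ s in Set.Ico a b, ‖g s‖ₑ)
      + ∫⁻ s in Set.Ico a b, ‖deriv g s‖ₑ := by
  have hab : 0 < b - a := by linarith [ht.1, ht.2]
  have hd : Continuous (deriv g) := hg.continuous_deriv le_rfl
  set A := ∫⁻ s in Set.Ico a b, ‖deriv g s‖ₑ with hA
  have hpt : ∀ s ∈ Set.Ico a b, ‖g t‖ₑ ≤ ‖g s‖ₑ + A := by
    intro s hs
    have hftc : g t - g s = ∫ r in s..t, deriv g r :=
      (intervalIntegral.integral_deriv_eq_sub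
        (fun r _ => (hg.differentiable one_ne_zero).differentiableAt)
        (hd.intervalIntegrable _ _)).symm
    have hsub : Set.uIoc s t ⊆ Set.Ico a b := fun r hr => by
      rcases Set.mem_uIoc.1 hr with h | h
      · exact ⟨by linarith [hs.1], by linarith [ht.2]⟩
      · exact ⟨by linarith [ht.1], by linarith [hs.2]⟩
    have hle : ‖g t - g s‖ₑ ≤ A := by
      rw [hftc, ← ofReal_norm, intervalIntegral.norm_integral_eq_norm_integral_uIoc, ofReal_norm]
      exact (enorm_integral_le_lintegral_enorm _).trans (lintegral_mono_set hsub)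
    calc ‖g t‖ₑ = ‖g s + (g t - g s)‖ₑ := by ring_nf
      _ ≤ ‖g s‖ₑ + ‖g t - g s‖ₑ := enorm_add_le _ _
      _ ≤ ‖g s‖ₑ + A := by gcongr
  have hvol : ENNReal.ofReal (b - a)⁻¹ * ENNReal.ofReal (b - a) = 1 := by
    rw [← ENNReal.ofReal_mul (inv_nonneg.2 hab.le), inv_mul_cancel₀ hab.ne', ENNReal.ofReal_one]
  have hint : ENNReal.ofReal (b - a) * ‖g t‖ₑ
      ≤ (∫⁻ s in Set.Ico a b, ‖g s‖ₑ) + ENNReal.ofReal (b - a) * A := by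
    calc ENNReal.ofReal (b - a) * ‖g t‖ₑ = ∫⁻ _ in Set.Ico a b, ‖g t‖ₑ := by
          rw [setLIntegral_const, Real.volume_Ico, mul_comm]
      _ ≤ ∫⁻ s in Set.Ico a b, (‖g s‖ₑ + A) := setLIntegral_mono' measurableSet_Ico hpt
      _ = _ := by
          rw [lintegral_add_right _ measurable_const, setLIntegral_const, Real.volume_Ico,
            mul_comm A]
  calc ‖g t‖ₑ = ENNReal.ofReal (b - a)⁻¹ * (ENNReal.ofReal (b - a) * ‖g t‖ₑ) := by
        rw [← mul_assoc, hvol, one_mul]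
    _ ≤ ENNReal.ofReal (b - a)⁻¹ *
        ((∫⁻ s in Set.Ico a b, ‖g s‖ₑ) + ENNReal.ofReal (b - a) * A) := by gcongr
    _ = _ := by rw [mul_add, ← mul_assoc _ _ A, hvol, one_mul]

lemma contDiff_pd {g : Pt → ℝ} {m n : WithTop ℕ∞} (hg : ContDiff ℝ n g) (hmn : m + 1 ≤ n)
    (j : Fin 3) : ContDiff ℝ m (pd j g) :=
  (hg.fderiv_right hmn).clm_apply contDiff_const

lemma hasDerivAt_toLp_update (y : Fin 3 → ℝ) (j : Fin 3) (s : ℝ) :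
    HasDerivAt (fun r => (WithLp.toLp 2 (Function.update y j r) : Pt))
      (EuclideanSpace.single j 1) s :=
  (PiLp.continuousLinearEquiv 2 ℝ (fun _ : Fin 3 => ℝ)).symm.hasFDerivAt.comp_hasDerivAt s
    (hasDerivAt_update y j s)

/-- The one-dimensional inequality along the `j`-th coordinate line. -/
lemma enorm_le_lmarginal_singleton {g : Pt → ℝ} (hg : ContDiff ℝ 1 g) {a b y : Fin 3 → ℝ}
    {j : Fin 3} (hy : y j ∈ Set.Ico (a j) (b j)) :
    ‖g (WithLp.toLp 2 y)‖ₑ ≤ ENNReal.ofReal (b j - a j)⁻¹ *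
        lmarginal (fun i => volume.restrict (Set.Ico (a i) (b i))) {j}
          (fun z => ‖g (WithLp.toLp 2 z)‖ₑ) y
      + lmarginal (fun i => volume.restrict (Set.Ico (a i) (b i))) {j}
          (fun z => ‖pd j g (WithLp.toLp 2 z)‖ₑ) y := by
  have hderiv : ∀ s, deriv (fun r => g (WithLp.toLp 2 (Function.update y j r))) s
      = pd j g (WithLp.toLp 2 (Function.update y j s)) := fun s =>
    (((hg.differentiable one_ne_zero _).hasFDerivAt).comp_hasDerivAt s
      (hasDerivAt_toLp_update y j s)).deriv
  have hcurve : ContDiff ℝ 1 (fun r => g (WithLp.toLp 2 (Function.update y j r))) :=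
    hg.comp ((PiLp.continuousLinearEquiv 2 ℝ (fun _ : Fin 3 => ℝ)).symm.contDiff.comp
      (contDiff_update 1 y j))
  have h := enorm_le_average_add_lintegral_deriv hcurve hy
  simp only [hderiv, Function.update_eq_self] at h
  simpa only [lmarginal_singleton] using h

lemma lmarginal_enorm_le {g : Pt → ℝ} (hg : ContDiff ℝ 1 g) {a b x : Fin 3 → ℝ}
    (hx : ∀ i, x i ∈ Set.Ico (a i) (b i)) {s : Finset (Fin 3)} {j : Fin 3} (hj : j ∉ s) :
    lmarginal (fun i => volume.restrict (Set.Ico (a i) (b i))) s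
        (fun z => ‖g (WithLp.toLp 2 z)‖ₑ) x ≤
      ENNReal.ofReal (b j - a j)⁻¹ *
        lmarginal (fun i => volume.restrict (Set.Ico (a i) (b i))) (s ∪ {j})
          (fun z => ‖g (WithLp.toLp 2 z)‖ₑ) x
      + lmarginal (fun i => volume.restrict (Set.Ico (a i) (b i))) (s ∪ {j})
          (fun z => ‖pd j g (WithLp.toLp 2 z)‖ₑ) x := by
  have hm : Measurable (fun z : Fin 3 → ℝ => ‖g (WithLp.toLp 2 z)‖ₑ) :=
    (hg.continuous.comp (PiLp.continuous_toLp 2 _)).measurable.enorm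
  have hm' : Measurable (fun z : Fin 3 → ℝ => ‖pd j g (WithLp.toLp 2 z)‖ₑ) :=
    ((contDiff_pd (m := 0) hg (by simp) j).continuous.comp
      (PiLp.continuous_toLp 2 _)).measurable.enorm
  have hdisj : Disjoint s {j} := Finset.disjoint_singleton_right.2 hj
  rw [lmarginal_union _ _ hm hdisj, lmarginal_union _ _ hm' hdisj]
  refine (lintegral_mono fun y => enorm_le_lmarginal_singleton hg (a := a) (b := b) (j := j)
    ?_).trans_eq ?_
  · simpa [Function.updateFinset, hj] using hx j
  · rw [lintegral_add_left, lintegral_const_mul]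
    · rfl
    · exact (hm.lmarginal _).comp measurable_updateFinset
    · exact ((hm.lmarginal _).comp measurable_updateFinset).const_mul _

/-- Pointwise bound by integrals of mixed derivatives of order at most one in each variable. -/
lemma enorm_le_sum_lmarginal_univ {f : Pt → ℝ} (hf : ContDiff ℝ 3 f) {a b x : Fin 3 → ℝ}
    (hx : ∀ i, x i ∈ Set.Ico (a i) (b i)) (h0 : b 0 - a 0 = 1) (h1 : b 1 - a 1 = 1)
    {I : (Pt → ℝ) → ℝ≥0∞}
    (hI : ∀ g, I g = lmarginal (fun i => volume.restrict (Set.Ico (a i) (b i))) Finset.univ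
      (fun z => ‖g (WithLp.toLp 2 z)‖ₑ) x) :
    ‖f (WithLp.toLp 2 x)‖ₑ ≤ ENNReal.ofReal (b 2 - a 2)⁻¹ *
        ((I f + I (pd 0 f)) + (I (pd 1 f) + I (pd 0 (pd 1 f))))
      + ((I (pd 2 f) + I (pd 0 (pd 2 f))) + (I (pd 1 (pd 2 f)) + I (pd 0 (pd 1 (pd 2 f))))) := by
  have huniv : (({2} ∪ {1}) ∪ {0} : Finset (Fin 3)) = Finset.univ := by decide
  have hlast : ∀ g : Pt → ℝ, ContDiff ℝ 1 g →
      lmarginal (fun i => volume.restrict (Set.Ico (a i) (b i))) ({2} ∪ {1})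
        (fun z => ‖g (WithLp.toLp 2 z)‖ₑ) x ≤ I g + I (pd 0 g) := by
    intro g hg
    have h := lmarginal_enorm_le hg hx (s := {2} ∪ {1}) (j := 0) (by decide)
    rwa [huniv, ← hI, ← hI, h0, inv_one, ENNReal.ofReal_one, one_mul] at h
  have hmid : ∀ g : Pt → ℝ, ContDiff ℝ 2 g →
      lmarginal (fun i => volume.restrict (Set.Ico (a i) (b i))) {2}
        (fun z => ‖g (WithLp.toLp 2 z)‖ₑ) x
        ≤ (I g + I (pd 0 g)) + (I (pd 1 g) + I (pd 0 (pd 1 g))) := by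
    intro g hg
    have h := lmarginal_enorm_le (hg.of_le one_le_two) hx (s := {2}) (j := 1) (by decide)
    rw [h1, inv_one, ENNReal.ofReal_one, one_mul] at h
    exact h.trans (add_le_add (hlast _ (hg.of_le one_le_two))
      (hlast _ (contDiff_pd hg (by norm_num) 1)))
  refine (enorm_le_lmarginal_singleton (hf.of_le (by norm_num)) (hx 2)).trans ?_
  gcongr
  · exact hmid _ (hf.of_le (by norm_num))
  · exact hmid _ (contDiff_pd hf (by norm_num) 2)

lemma lmarginal_univ_enorm_le_L2 {g : Pt → ℝ} (hg : Continuous g) {δ : ℝ}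
    {a b : Fin 3 → ℝ} (x : Fin 3 → ℝ) (h0 : b 0 - a 0 = 1) (h1 : b 1 - a 1 = 1)
    (ha : a 2 = 0) (hb : b 2 = δ) :
    lmarginal (fun i => volume.restrict (Set.Ico (a i) (b i))) Finset.univ
      (fun z => ‖g (WithLp.toLp 2 z)‖ₑ) x ≤ ENNReal.ofReal δ ^ ((1:ℝ)/2) * L2 δ g := by
  set μ : Measure (Fin 3 → ℝ) :=
    Measure.pi (fun i => volume.restrict (Set.Ico (a i) (b i))) with hμ
  have hgc : Continuous (fun z : Fin 3 → ℝ => g (WithLp.toLp 2 z)) :=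
    hg.comp (PiLp.continuous_toLp 2 _)
  have hμuniv : μ Set.univ = ENNReal.ofReal δ := by
    rw [hμ, Measure.pi_univ]
    simp [Fin.prod_univ_three, h0, h1, ha, hb]
  have hslab : MeasurableSet (slab δ) :=
    measurableSet_Ico.preimage (by fun_prop : Continuous fun x : Pt => x 2).measurable
  have hle : μ ≤ volume.restrict ((WithLp.toLp 2 : (Fin 3 → ℝ) → Pt) ⁻¹' slab δ) := by
    rw [hμ, ← Measure.restrict_pi_pi, ← volume_pi]
    refine Measure.restrict_mono (fun z hz => ?_) le_rfl
    have h2 : z 2 ∈ Set.Ico (a 2) (b 2) := hz 2 (Set.mem_univ _)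
    rwa [ha, hb] at h2
  have hmp := (PiLp.volume_preserving_toLp (Fin 3)).restrict_preimage hslab
  calc lmarginal (fun i => volume.restrict (Set.Ico (a i) (b i))) Finset.univ
        (fun z => ‖g (WithLp.toLp 2 z)‖ₑ) x
      = eLpNorm (fun z => g (WithLp.toLp 2 z)) 1 μ := by
        rw [lmarginal_univ, eLpNorm_one_eq_lintegral_enorm]
    _ ≤ eLpNorm (fun z => g (WithLp.toLp 2 z)) 2 μ * μ Set.univ ^ ((1:ℝ)/2) := by
        have h := eLpNorm_le_eLpNorm_mul_rpow_measure_univ (p := 1) (q := 2) (μ := μ)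
          (by norm_num) hgc.aestronglyMeasurable
        norm_num at h ⊢
        exact h
    _ ≤ L2 δ g * ENNReal.ofReal δ ^ ((1:ℝ)/2) := by
        rw [hμuniv]
        gcongr
        refine (eLpNorm_mono_measure _ hle).trans_eq ?_
        exact eLpNorm_comp_measurePreserving hg.aestronglyMeasurable hmp
    _ = _ := mul_comm _ _

lemma mul_sum_le_sum_idx2 (c : ℝ≥0∞) (δ : ℝ) (g : Pt → ℝ) :
    c * ((L2 δ g + L2 δ (pd 0 g)) + (L2 δ (pd 1 g) + L2 δ (pd 0 (pd 1 g))))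
      ≤ ∑ a ∈ idx2 2, c * L2 δ (pdv a g) := by
  have hsub : ({![0, 0], ![1, 0], ![0, 1], ![1, 1]} : Finset (Fin 2 → ℕ)) ⊆ idx2 2 := by
    decide
  refine le_trans (le_of_eq ?_) (Finset.sum_le_sum_of_subset hsub)
  rw [Finset.sum_insert (by decide), Finset.sum_insert (by decide),
    Finset.sum_insert (by decide), Finset.sum_singleton]
  simp only [pdv, Matrix.cons_val_zero, Matrix.cons_val_one, Function.iterate_zero,
    Function.iterate_one, id, mul_add, add_assoc]

theorem anisotropic_sobolev_thin_domain :
    ∃ C : ℝ, 0 < C ∧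
      ∀ (δ : ℝ), 0 < δ → δ ≤ 1 →
      ∀ f : Pt → ℝ, ContDiff ℝ 3 f → (∀ x, f (x + δ • e3) = f x) →
      ∀ x : Pt, x ∈ slab δ →
        ENNReal.ofReal |f x| ≤ ENNReal.ofReal C *
          ((∑ a ∈ idx2 2, ENNReal.ofReal (δ ^ (-(1:ℝ)/2)) * L2 δ (pdv a f))
            + ∑ a ∈ idx2 2, ENNReal.ofReal (δ ^ ((1:ℝ)/2)) * L2 δ (pdv a (pd 2 f))) := by
  refine ⟨1, one_pos, fun δ hδ _ f hf _ x hx => ?_⟩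
  set a : Fin 3 → ℝ := ![x 0, x 1, 0] with ha
  set b : Fin 3 → ℝ := ![x 0 + 1, x 1 + 1, δ] with hb
  have h0 : b 0 - a 0 = 1 := by simp [ha, hb]
  have h1 : b 1 - a 1 = 1 := by simp [ha, hb]
  have hbox : ∀ i, x.ofLp i ∈ Set.Ico (a i) (b i) := by
    intro i
    fin_cases i
    · simp [ha, hb]
    · simp [ha, hb]
    · exact hx
  have hL2 : ∀ g : Pt → ℝ, Continuous g →
      lmarginal (fun i => volume.restrict (Set.Ico (a i) (b i))) Finset.univ
        (fun z => ‖g (WithLp.toLp 2 z)‖ₑ) x.ofLp ≤ ENNReal.ofReal δ ^ ((1:ℝ)/2) * L2 δ g :=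
    fun g hg => lmarginal_univ_enorm_le_L2 hg _ h0 h1 rfl rfl
  have hsum : ∀ g : Pt → ℝ, ContDiff ℝ 2 g → _ := fun g hg =>
    add_le_add
      (add_le_add (hL2 g hg.continuous)
        (hL2 (pd 0 g) (contDiff_pd (m := 1) hg (by norm_num) 0).continuous))
      (add_le_add (hL2 (pd 1 g) (contDiff_pd (m := 1) hg (by norm_num) 1).continuous)
        (hL2 (pd 0 (pd 1 g)) (contDiff_pd (m := 0) (contDiff_pd (m := 1) hg (by norm_num) 1)
          (by norm_num) 0).continuous))
  have hpow : ENNReal.ofReal (b 2 - a 2)⁻¹ * ENNReal.ofReal δ ^ ((1:ℝ)/2)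
      = ENNReal.ofReal (δ ^ (-(1:ℝ)/2)) := by
    have hba : b 2 - a 2 = δ := by simp [ha, hb]
    rw [hba, ENNReal.ofReal_rpow_of_pos hδ, ← ENNReal.ofReal_mul (inv_nonneg.2 hδ.le),
      ← Real.rpow_neg_one, ← Real.rpow_add hδ]
    norm_num
  rw [ENNReal.ofReal_one, one_mul, ← Real.enorm_eq_ofReal_abs]
  refine (enorm_le_sum_lmarginal_univ hf hbox h0 h1 (fun _ => rfl)).trans ?_
  refine add_le_add ((mul_le_mul_right (hsum f (hf.of_le (by norm_num))) _).trans ?_)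
    ((hsum (pd 2 f) (contDiff_pd hf (by norm_num) 2)).trans ?_)
  · simp only [← mul_add]
    rw [← mul_assoc, hpow]
    exact mul_sum_le_sum_idx2 _ δ f
  · simp only [← mul_add]
    rw [ENNReal.ofReal_rpow_of_pos hδ]
    exact mul_sum_le_sum_idx2 _ δ (pd 2 f)

end Stmt2
end
end

section
/- There is an absolute constant C > 0 such that for every 0 < δ ≤ 1, every f ∈ H³(Ω_δ) and every x ∈ Ω_δ: r_v^{1/2} |f(x)| ≤ C [ δ^{−1/2} Σ_{a=0,1} ( ‖∂_v Ω₃^a f‖_{L²(Ω_δ)} + ‖Ω₃^a f‖_{L²(Ω_δ)} ) + δ^{1/2} Σ_{a=0,1} ( ‖∂₃ ∂_v Ω₃^a f‖_{L²(Ω_δ)} + ‖∂₃ Ω₃^a f‖_{L²(Ω_δ)} ) ], provided the right-hand side is finite; C is independent of δ, f, x. -/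
/-!
STATEMENT 3: Weighted anisotropic Sobolev inequality (K-S-1):
r_v^{1/2} |f(x)| ≤ C [ δ^{-1/2} Σ_{a=0,1} (‖∂_v Ω₃^a f‖_{L²} + ‖Ω₃^a f‖_{L²})
                     + δ^{1/2} Σ_{a=0,1} (‖∂₃∂_v Ω₃^a f‖_{L²} + ‖∂₃ Ω₃^a f‖_{L²}) ].
-/

noncomputable section
open MeasureTheory
open scoped ENNReal

namespace Stmt3

abbrev Pt : Type := EuclideanSpace ℝ (Fin 3)

def e3 : Pt := EuclideanSpace.single 2 1

def slab (δ : ℝ) : Set Pt := {x : Pt | x 2 ∈ Set.Ico 0 δ}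

def pd (j : Fin 3) (f : Pt → ℝ) : Pt → ℝ :=
  fun x => fderiv ℝ f x (EuclideanSpace.single j 1)

def L2 (δ : ℝ) (f : Pt → ℝ) : ℝ≥0∞ := eLpNorm f 2 (volume.restrict (slab δ))

/-- The horizontal rotation Ω₃ = x₁∂₂ − x₂∂₁. -/
def Om3 (f : Pt → ℝ) : Pt → ℝ := fun x => x 0 * pd 1 f x - x 1 * pd 0 f x

/-- Norm of the horizontal gradient. -/
def gradv (f : Pt → ℝ) : Pt → ℝ := fun x => Real.sqrt ((pd 0 f x)^2 + (pd 1 f x)^2)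

open Set

theorem sq_le_lintegral_Icc {a b : ℝ} (hab : a < b) {h h' : ℝ → ℝ}
    (hd : ∀ s, HasDerivAt h (h' s) s) (hc : Continuous h') {t : ℝ} (ht : t ∈ Icc a b) :
    ENNReal.ofReal (h t ^ 2) ≤
      ∫⁻ s in Icc a b, ENNReal.ofReal (2 * ((b - a)⁻¹ * h s ^ 2 + (b - a) * h' s ^ 2)) := by
  have hL : 0 < b - a := sub_pos.2 hab
  have hcont : Continuous h := continuous_iff_continuousAt.2 fun s => (hd s).continuousAt
  set F : ℝ → ℝ := fun s => (b - a)⁻¹ * h s ^ 2 + (b - a) * h' s ^ 2 with hF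
  have hFc : Continuous F := by fun_prop
  have hF0 : ∀ s, 0 ≤ F s := fun s => by positivity
  have key : ∀ s ∈ Icc a b, h t ^ 2 ≤ h s ^ 2 + ∫ u in a..b, F u := by
    intro s hs
    have h1 : ∫ u in s..t, 2 * h u * h' u = h t ^ 2 - h s ^ 2 := by
      refine intervalIntegral.integral_eq_sub_of_hasDerivAt (f := fun u => h u ^ 2)
        (fun u _ => ?_) (Continuous.intervalIntegrable (by fun_prop) _ _)
      simpa using! (hd u).pow 2
    have h2 : |∫ u in s..t, 2 * h u * h' u| ≤ |∫ u in s..t, F u| := by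
      rw [← Real.norm_eq_abs]
      refine intervalIntegral.norm_integral_le_abs_of_norm_le
        (Filter.Eventually.of_forall fun u => ?_) (hFc.intervalIntegrable _ _)
      have e1 : F u - 2 * h u * h' u = (b - a)⁻¹ * (h u - (b - a) * h' u) ^ 2 := by
        simp only [hF]; field_simp; ring
      have e2 : F u + 2 * h u * h' u = (b - a)⁻¹ * (h u + (b - a) * h' u) ^ 2 := by
        simp only [hF]; field_simp; ring
      rw [Real.norm_eq_abs, abs_le]
      constructor
      · linarith [show 0 ≤ (b - a)⁻¹ * (h u + (b - a) * h' u) ^ 2 by positivity]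
      · linarith [show 0 ≤ (b - a)⁻¹ * (h u - (b - a) * h' u) ^ 2 by positivity]
    have h3 : |∫ u in s..t, F u| ≤ |∫ u in a..b, F u| := by
      refine intervalIntegral.abs_integral_mono_interval ?_
        (Filter.Eventually.of_forall hF0) (hFc.intervalIntegrable _ _)
      rw [uIoc_of_le hab.le, uIoc]
      exact Ioc_subset_Ioc (le_min hs.1 ht.1) (max_le hs.2 ht.2)
    rw [abs_of_nonneg (intervalIntegral.integral_nonneg hab.le fun u _ => hF0 u)] at h3
    linarith [le_abs_self (∫ u in s..t, 2 * h u * h' u)]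
  have avg : (b - a) * h t ^ 2 ≤ ∫ s in a..b, (h s ^ 2 + ∫ u in a..b, F u) := by
    have := intervalIntegral.integral_mono_on (μ := volume) hab.le (f := fun _ => h t ^ 2)
      (Continuous.intervalIntegrable (by fun_prop) _ _)
      (Continuous.intervalIntegrable (by fun_prop) _ _) key
    simpa using this
  rw [intervalIntegral.integral_add
    (f := fun s => h s ^ 2) ((by fun_prop : Continuous fun s => h s ^ 2).intervalIntegrable a b)
    intervalIntegrable_const] at avg
  have h4 : ∫ s in a..b, h s ^ 2 ≤ (b - a) * ∫ s in a..b, F s := by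
    rw [← intervalIntegral.integral_const_mul]
    refine intervalIntegral.integral_mono_on hab.le
      (Continuous.intervalIntegrable (by fun_prop) _ _)
      (Continuous.intervalIntegrable (by fun_prop) _ _) fun s _ => ?_
    have : (b - a) * F s = h s ^ 2 + ((b - a) * h' s) ^ 2 := by
      simp only [hF]; field_simp
    rw [this]; nlinarith [sq_nonneg ((b - a) * h' s)]
  have h5 : h t ^ 2 ≤ ∫ s in a..b, 2 * F s := by
    rw [intervalIntegral.integral_const_mul]
    simp only [intervalIntegral.integral_const, smul_eq_mul] at avg
    refine le_of_mul_le_mul_left ?_ hL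
    linarith
  rw [intervalIntegral.integral_of_le hab.le, ← integral_Icc_eq_integral_Ioc] at h5
  rw [← ofReal_integral_eq_lintegral_ofReal]
  · exact ENNReal.ofReal_le_ofReal h5
  · exact Continuous.integrableOn_Icc (by fun_prop)
  · exact Filter.Eventually.of_forall fun s => mul_nonneg zero_le_two (hF0 s)

def pt (x y z : ℝ) : Pt :=
  x • EuclideanSpace.single 0 1 + y • EuclideanSpace.single 1 1 + z • EuclideanSpace.single 2 1

@[simp] theorem pt_zero (x y z : ℝ) : pt x y z 0 = x := by simp [pt]
@[simp] theorem pt_one (x y z : ℝ) : pt x y z 1 = y := by simp [pt]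
@[simp] theorem pt_two (x y z : ℝ) : pt x y z 2 = z := by simp [pt]

theorem pt_eta (p : Pt) : pt (p 0) (p 1) (p 2) = p := by
  ext i; fin_cases i <;> simp

theorem continuous_pt : Continuous fun q : (ℝ × ℝ) × ℝ => pt q.1.1 q.1.2 q.2 := by
  unfold pt; fun_prop

theorem measurePreserving_pt :
    MeasurePreserving (fun q : (ℝ × ℝ) × ℝ => pt q.1.1 q.1.2 q.2) := by
  have h1 := (volume_preserving_piFinSuccAbove (fun _ : Fin 3 => ℝ) 2).symm
  have h2 := (volume_preserving_finTwoArrow ℝ).symm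
  have h3 : MeasurePreserving (Prod.swap : (ℝ × ℝ) × ℝ → ℝ × (ℝ × ℝ)) :=
    Measure.measurePreserving_swap
  have h4 := (MeasurePreserving.id (volume : Measure ℝ)).prod h2
  have h5 := (PiLp.volume_preserving_toLp (Fin 3)).comp (h1.comp (h4.comp h3))
  convert h5 using 1
  ext q i
  fin_cases i <;> simp <;> rfl

theorem lintegral_slab (δ : ℝ) {G : Pt → ℝ≥0∞} (hG : Measurable G) :
    ∫⁻ p in slab δ, G p = ∫⁻ q : ℝ × ℝ, ∫⁻ z in Ico 0 δ, G (pt q.1 q.2 z) := by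
  have hs : MeasurableSet (slab δ) :=
    measurableSet_Ico.preimage (by fun_prop : Measurable fun x : Pt => x 2)
  rw [← measurePreserving_pt.setLIntegral_comp_preimage hs hG]
  have hpre : (fun q : (ℝ × ℝ) × ℝ => pt q.1.1 q.1.2 q.2) ⁻¹' slab δ = univ ×ˢ Ico 0 δ := by
    ext q; simp [slab]
  rw [hpre, Measure.volume_eq_prod,
    setLIntegral_prod (fun q : (ℝ × ℝ) × ℝ => G (pt q.1.1 q.1.2 q.2))
      (hG.comp continuous_pt.measurable).aemeasurable, setLIntegral_univ]

theorem lintegral_slab_polar (δ : ℝ) {G : Pt → ℝ≥0∞} (hG : Measurable G) :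
    ∫⁻ θ in Icc (-Real.pi) Real.pi, ∫⁻ ρ in Ioi (0 : ℝ), ∫⁻ z in Icc 0 δ,
        ENNReal.ofReal ρ * G (pt (ρ * Real.cos θ) (ρ * Real.sin θ) z) =
      ∫⁻ p in slab δ, G p := by
  have hm : Measurable fun q : (ℝ × ℝ) × ℝ =>
      ENNReal.ofReal q.1.1 * G (pt (q.1.1 * Real.cos q.1.2) (q.1.1 * Real.sin q.1.2) q.2) := by
    refine Measurable.mul (by fun_prop) (hG.comp ?_)
    unfold pt; fun_prop
  rw [lintegral_slab δ hG, ← lintegral_comp_polarCoord_symm, polarCoord_target,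
    Measure.volume_eq_prod, ← setLIntegral_congr (Ioo_ae_eq_Icc (a := -Real.pi)),
    setLIntegral_prod_symm]
  · refine lintegral_congr fun θ => lintegral_congr fun ρ => ?_
    simp only [polarCoord_symm_apply, smul_eq_mul]
    rw [setLIntegral_congr Ico_ae_eq_Icc, lintegral_const_mul' _ _ ENNReal.ofReal_ne_top]
  · refine Measurable.aemeasurable ?_
    simp only [polarCoord_symm_apply, smul_eq_mul]
    simp_rw [← lintegral_const_mul' _ _ ENNReal.ofReal_ne_top]
    exact hm.lintegral_prod_right'

theorem contDiff_pd {n m : WithTop ℕ∞} {u : Pt → ℝ} (hu : ContDiff ℝ n u) (hmn : m + 1 ≤ n)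
    (j : Fin 3) : ContDiff ℝ m (pd j u) :=
  (hu.fderiv_right hmn).clm_apply contDiff_const

theorem hasDerivAt_comp_pt {u : Pt → ℝ} (hu : Differentiable ℝ u) {x y z : ℝ → ℝ} {x' y' z' t : ℝ}
    (hx : HasDerivAt x x' t) (hy : HasDerivAt y y' t) (hz : HasDerivAt z z' t) :
    HasDerivAt (fun s => u (pt (x s) (y s) (z s)))
      (x' * pd 0 u (pt (x t) (y t) (z t)) + y' * pd 1 u (pt (x t) (y t) (z t)) +
        z' * pd 2 u (pt (x t) (y t) (z t))) t := by
  have h := ((hx.smul_const (EuclideanSpace.single 0 1 : Pt)).add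
    (hy.smul_const (EuclideanSpace.single 1 1 : Pt))).add
    (hz.smul_const (EuclideanSpace.single 2 1 : Pt))
  have h2 := (hu (pt (x t) (y t) (z t))).hasFDerivAt.comp_hasDerivAt t h
  convert! h2 using 1
  simp [pd, pt]

/-- The density of the vertical energy `δ⁻¹ u² + δ (∂₃u)²`. -/
def vertE (δ : ℝ) (u : Pt → ℝ) (p : Pt) : ℝ := δ⁻¹ * u p ^ 2 + δ * pd 2 u p ^ 2

theorem vertE_nonneg {δ : ℝ} (hδ : 0 < δ) (u : Pt → ℝ) (p : Pt) : 0 ≤ vertE δ u p := by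
  unfold vertE; positivity

theorem continuous_vertE (δ : ℝ) {u : Pt → ℝ} (hu : ContDiff ℝ 1 u) :
    Continuous (vertE δ u) := by
  have h1 := hu.continuous
  have h2 := (contDiff_pd hu (m := 0) (by norm_num) 2).continuous
  unfold vertE; fun_prop

theorem sq_le_lintegral_vertE {δ : ℝ} (hδ : 0 < δ) {u : Pt → ℝ} (hu : ContDiff ℝ 1 u)
    (x y : ℝ) {z : ℝ} (hz : z ∈ Icc 0 δ) :
    ENNReal.ofReal (u (pt x y z) ^ 2) ≤
      ∫⁻ s in Icc 0 δ, ENNReal.ofReal (2 * vertE δ u (pt x y s)) := by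
  have hc := (contDiff_pd hu (m := 0) (by norm_num) 2).continuous
  have := sq_le_lintegral_Icc hδ (h := fun s => u (pt x y s)) (h' := fun s => pd 2 u (pt x y s))
    (fun s => by
      simpa using hasDerivAt_comp_pt (hu.differentiable (by norm_num)) (hasDerivAt_const s x)
        (hasDerivAt_const s y) (hasDerivAt_id s))
    (hc.comp (by unfold pt; fun_prop)) hz
  simpa [vertE] using this

/-- The energy density controlling `g` in the radial and vertical directions. -/
def radE (δ : ℝ) (g : Pt → ℝ) (p : Pt) : ℝ :=
  vertE δ g p + vertE δ (pd 0 g) p + vertE δ (pd 1 g) p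

theorem sum_sq_le_lintegral_radE {δ : ℝ} (hδ : 0 < δ) {g : Pt → ℝ} (hg : ContDiff ℝ 2 g)
    (x y : ℝ) {z : ℝ} (hz : z ∈ Icc 0 δ) :
    ENNReal.ofReal (g (pt x y z) ^ 2 + pd 0 g (pt x y z) ^ 2 + pd 1 g (pt x y z) ^ 2) ≤
      ∫⁻ s in Icc 0 δ, ENNReal.ofReal (2 * radE δ g (pt x y s)) := by
  have c0 : ContDiff ℝ 1 g := hg.of_le (by norm_num)
  have c1 : ContDiff ℝ 1 (pd 0 g) := contDiff_pd hg (by norm_num) 0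
  have c2 : ContDiff ℝ 1 (pd 1 g) := contDiff_pd hg (by norm_num) 1
  have hm : ∀ {u : Pt → ℝ}, ContDiff ℝ 1 u →
      Measurable fun s => ENNReal.ofReal (2 * vertE δ u (pt x y s)) := fun hu =>
    (ENNReal.continuous_ofReal.comp (continuous_const.mul
      ((continuous_vertE δ hu).comp (by unfold pt; fun_prop)))).measurable
  have hn : ∀ (u : Pt → ℝ) s, 0 ≤ 2 * vertE δ u (pt x y s) := fun u s =>
    mul_nonneg zero_le_two (vertE_nonneg hδ u _)
  simp only [radE, mul_add]
  simp_rw [ENNReal.ofReal_add (add_nonneg (hn g _) (hn (pd 0 g) _)) (hn (pd 1 g) _),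
    ENNReal.ofReal_add (hn g _) (hn (pd 0 g) _)]
  rw [lintegral_add_right _ (hm c2), lintegral_add_left (hm c0),
    ENNReal.ofReal_add (by positivity) (by positivity),
    ENNReal.ofReal_add (by positivity) (by positivity)]
  gcongr
  exacts [sq_le_lintegral_vertE hδ c0 x y hz, sq_le_lintegral_vertE hδ c1 x y hz,
    sq_le_lintegral_vertE hδ c2 x y hz]

theorem mul_sq_le_lintegral_radE {δ : ℝ} (hδ : 0 < δ) {g : Pt → ℝ} (hg : ContDiff ℝ 2 g)
    {r : ℝ} (hr : 0 < r) (θ : ℝ) {z : ℝ} (hz : z ∈ Icc 0 δ) :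
    ENNReal.ofReal r * ENNReal.ofReal (g (pt (r * Real.cos θ) (r * Real.sin θ) z) ^ 2) ≤
      ∫⁻ ρ in Ioi (0 : ℝ), ∫⁻ s in Icc 0 δ, ENNReal.ofReal ρ *
        ENNReal.ofReal (4 * radE δ g (pt (ρ * Real.cos θ) (ρ * Real.sin θ) s)) := by
  have c1 := (contDiff_pd hg (m := 1) (by norm_num) 0).continuous
  have c2 := (contDiff_pd hg (m := 1) (by norm_num) 1).continuous
  have hP : Continuous fun ρ : ℝ => pt (ρ * Real.cos θ) (ρ * Real.sin θ) z := by
    unfold pt; fun_prop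
  have h1 := sq_le_lintegral_Icc (lt_add_one r)
    (h := fun ρ => g (pt (ρ * Real.cos θ) (ρ * Real.sin θ) z))
    (h' := fun ρ => Real.cos θ * pd 0 g (pt (ρ * Real.cos θ) (ρ * Real.sin θ) z) +
      Real.sin θ * pd 1 g (pt (ρ * Real.cos θ) (ρ * Real.sin θ) z))
    (fun s => by
      simpa using hasDerivAt_comp_pt (hg.differentiable (by norm_num))
        ((hasDerivAt_id s).mul_const (Real.cos θ)) ((hasDerivAt_id s).mul_const (Real.sin θ))
        (hasDerivAt_const s z))
    ((continuous_const.mul (c1.comp hP)).add (continuous_const.mul (c2.comp hP)))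
    (left_mem_Icc.2 (lt_add_one r).le)
  refine (mul_le_mul_right h1 _).trans ?_
  rw [← lintegral_const_mul' _ _ ENNReal.ofReal_ne_top]
  refine (setLIntegral_mono' measurableSet_Icc fun ρ hρ => ?_).trans
    (lintegral_mono_set fun ρ hρ => hr.trans_le hρ.1)
  rw [lintegral_const_mul' _ _ ENNReal.ofReal_ne_top]
  refine mul_le_mul' (ENNReal.ofReal_le_ofReal hρ.1) ?_
  have h2 := mul_le_mul_right (sum_sq_le_lintegral_radE hδ hg (ρ * Real.cos θ) (ρ * Real.sin θ) hz)
    (ENNReal.ofReal 2)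
  rw [← lintegral_const_mul' _ _ ENNReal.ofReal_ne_top] at h2
  simp_rw [← ENNReal.ofReal_mul zero_le_two, ← mul_assoc] at h2
  rw [show (2 : ℝ) * 2 = 4 by norm_num] at h2
  refine le_trans (ENNReal.ofReal_le_ofReal ?_) h2
  set p := pt (ρ * Real.cos θ) (ρ * Real.sin θ) z
  have := Real.sin_sq_add_cos_sq θ
  have h3 : (Real.cos θ * pd 0 g p + Real.sin θ * pd 1 g p) ^ 2 +
      (Real.sin θ * pd 0 g p - Real.cos θ * pd 1 g p) ^ 2 = pd 0 g p ^ 2 + pd 1 g p ^ 2 := by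
    linear_combination (pd 0 g p ^ 2 + pd 1 g p ^ 2) * this
  norm_num
  nlinarith [sq_nonneg (Real.sin θ * pd 0 g p - Real.cos θ * pd 1 g p)]

theorem contDiff_Om3 {f : Pt → ℝ} (hf : ContDiff ℝ 3 f) : ContDiff ℝ 2 (Om3 f) := by
  have h0 : ContDiff ℝ 2 (pd 0 f) := contDiff_pd hf (by norm_num) 0
  have h1 : ContDiff ℝ 2 (pd 1 f) := contDiff_pd hf (by norm_num) 1
  unfold Om3; fun_prop

theorem continuous_radE (δ : ℝ) {g : Pt → ℝ} (hg : ContDiff ℝ 2 g) : Continuous (radE δ g) :=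
  ((continuous_vertE δ (hg.of_le (by norm_num))).add
    (continuous_vertE δ (contDiff_pd hg (by norm_num) 0))).add
    (continuous_vertE δ (contDiff_pd hg (by norm_num) 1))

theorem mul_lintegral_angle_le {δ : ℝ} (hδ : 0 < δ) {g : Pt → ℝ} (hg : ContDiff ℝ 2 g)
    {r : ℝ} (hr : 0 < r) {z : ℝ} (hz : z ∈ Icc 0 δ) :
    ENNReal.ofReal r * ∫⁻ θ in Icc (-Real.pi) Real.pi,
        ENNReal.ofReal (g (pt (r * Real.cos θ) (r * Real.sin θ) z) ^ 2) ≤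
      ∫⁻ p in slab δ, ENNReal.ofReal (4 * radE δ g p) := by
  rw [← lintegral_const_mul' _ _ ENNReal.ofReal_ne_top, ← lintegral_slab_polar δ
    (G := fun p => ENNReal.ofReal (4 * radE δ g p)) (ENNReal.continuous_ofReal.comp (continuous_const.mul (continuous_radE δ hg))).measurable]
  exact lintegral_mono fun θ => mul_sq_le_lintegral_radE hδ hg hr θ hz

theorem sq_le_lintegral_angle {f : Pt → ℝ} (hf : ContDiff ℝ 3 f) (r z : ℝ) {θ : ℝ}
    (hθ : θ ∈ Icc (-Real.pi) Real.pi) :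
    ENNReal.ofReal (f (pt (r * Real.cos θ) (r * Real.sin θ) z) ^ 2) ≤
      16 * ((∫⁻ φ in Icc (-Real.pi) Real.pi,
          ENNReal.ofReal (f (pt (r * Real.cos φ) (r * Real.sin φ) z) ^ 2)) +
        ∫⁻ φ in Icc (-Real.pi) Real.pi,
          ENNReal.ofReal (Om3 f (pt (r * Real.cos φ) (r * Real.sin φ) z) ^ 2)) := by
  have hP : Continuous fun φ : ℝ => pt (r * Real.cos φ) (r * Real.sin φ) z := by
    unfold pt; fun_prop
  have hO := (contDiff_Om3 hf).continuous.comp hP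
  have h1 := sq_le_lintegral_Icc (show -Real.pi < Real.pi by linarith [Real.pi_pos])
    (h := fun φ => f (pt (r * Real.cos φ) (r * Real.sin φ) z))
    (h' := fun φ => Om3 f (pt (r * Real.cos φ) (r * Real.sin φ) z))
    (fun s => by
      convert hasDerivAt_comp_pt (hf.differentiable (by norm_num))
        ((Real.hasDerivAt_cos s).const_mul r) ((Real.hasDerivAt_sin s).const_mul r)
        (hasDerivAt_const s z) using 1
      simp [Om3]; ring) hO hθ
  refine h1.trans ?_
  have hm : Measurable fun φ =>
      ENNReal.ofReal (f (pt (r * Real.cos φ) (r * Real.sin φ) z) ^ 2) :=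
    (((hf.continuous.comp hP).measurable.pow_const 2)).ennreal_ofReal
  rw [← lintegral_add_left hm,
    ← lintegral_const_mul' _ _ (by norm_num)]
  refine lintegral_mono fun φ => ?_
  rw [← ENNReal.ofReal_add (by positivity) (by positivity),
    show (16 : ℝ≥0∞) = ENNReal.ofReal 16 by norm_num, ← ENNReal.ofReal_mul (by norm_num)]
  refine ENNReal.ofReal_le_ofReal ?_
  have e1 := Real.pi_le_four
  have e2 := Real.pi_gt_three
  have e3 : (Real.pi - -Real.pi)⁻¹ ≤ 1 := inv_le_one_of_one_le₀ (by linarith)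
  have s1 := sq_nonneg (f (pt (r * Real.cos φ) (r * Real.sin φ) z))
  have s2 := sq_nonneg (Om3 f (pt (r * Real.cos φ) (r * Real.sin φ) z))
  nlinarith [mul_le_mul_of_nonneg_right e3 s1, mul_le_mul_of_nonneg_right e1 s2]

theorem lintegral_ofReal_sq (δ : ℝ) (u : Pt → ℝ) :
    ∫⁻ p in slab δ, ENNReal.ofReal (u p ^ 2) = L2 δ u ^ 2 := by
  rw [L2, eLpNorm_eq_lintegral_rpow_enorm_toReal (by norm_num) (by norm_num), ← ENNReal.rpow_two,
    ← ENNReal.rpow_mul]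
  norm_num
  refine lintegral_congr fun p => ?_
  rw [Real.enorm_eq_ofReal_abs, ← ENNReal.ofReal_pow (abs_nonneg _), sq_abs]

theorem lintegral_vertE {δ : ℝ} (hδ : 0 < δ) {u : Pt → ℝ} (hu : ContDiff ℝ 1 u) :
    ∫⁻ p in slab δ, ENNReal.ofReal (vertE δ u p) =
      ENNReal.ofReal δ⁻¹ * L2 δ u ^ 2 + ENNReal.ofReal δ * L2 δ (pd 2 u) ^ 2 := by
  have h1 := hu.continuous
  simp only [vertE]
  simp_rw [fun p => ENNReal.ofReal_add (p := δ⁻¹ * u p ^ 2) (q := δ * pd 2 u p ^ 2)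
    (by positivity) (by positivity), ENNReal.ofReal_mul (inv_nonneg.2 hδ.le),
    ENNReal.ofReal_mul hδ.le]
  rw [lintegral_add_left (by fun_prop), lintegral_const_mul' _ _ ENNReal.ofReal_ne_top,
    lintegral_const_mul' _ _ ENNReal.ofReal_ne_top, lintegral_ofReal_sq, lintegral_ofReal_sq]

theorem L2_mono (δ : ℝ) {u v : Pt → ℝ} (h : ∀ p, |u p| ≤ v p) : L2 δ u ≤ L2 δ v :=
  eLpNorm_mono_real h

/-- The part of the right-hand side of the weighted Sobolev inequality contributed by `g`. -/
def normKS (δ : ℝ) (g : Pt → ℝ) : ℝ≥0∞ :=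
  ENNReal.ofReal (δ ^ (-(1 : ℝ) / 2)) * (L2 δ (gradv g) + L2 δ g) +
    ENNReal.ofReal (δ ^ ((1 : ℝ) / 2)) *
      (L2 δ (fun y => Real.sqrt (pd 2 (pd 0 g) y ^ 2 + pd 2 (pd 1 g) y ^ 2)) + L2 δ (pd 2 g))

theorem lintegral_radE_le {δ : ℝ} (hδ : 0 < δ) {g : Pt → ℝ} (hg : ContDiff ℝ 2 g) :
    ∫⁻ p in slab δ, ENNReal.ofReal (4 * radE δ g p) ≤ 8 * normKS δ g ^ 2 := by
  have c0 : ContDiff ℝ 1 g := hg.of_le (by norm_num)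
  have c1 : ContDiff ℝ 1 (pd 0 g) := contDiff_pd hg (by norm_num) 0
  have c2 : ContDiff ℝ 1 (pd 1 g) := contDiff_pd hg (by norm_num) 1
  have m0 := continuous_vertE δ c0
  have m1 := continuous_vertE δ c1
  have n0 := vertE_nonneg hδ g
  have n1 := vertE_nonneg hδ (pd 0 g)
  have n2 := vertE_nonneg hδ (pd 1 g)
  simp only [radE]
  simp_rw [ENNReal.ofReal_mul (zero_le_four : (0 : ℝ) ≤ 4),
    ENNReal.ofReal_add (add_nonneg (n0 _) (n1 _)) (n2 _), ENNReal.ofReal_add (n0 _) (n1 _)]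
  rw [lintegral_const_mul' _ _ ENNReal.ofReal_ne_top, lintegral_add_left (by fun_prop),
    lintegral_add_left (by fun_prop), lintegral_vertE hδ c0, lintegral_vertE hδ c1,
    lintegral_vertE hδ c2]
  have i0 : L2 δ (pd 0 g) ≤ L2 δ (gradv g) := L2_mono δ fun p =>
    Real.abs_le_sqrt (by nlinarith [sq_nonneg (pd 1 g p)])
  have i1 : L2 δ (pd 1 g) ≤ L2 δ (gradv g) := L2_mono δ fun p =>
    Real.abs_le_sqrt (by nlinarith [sq_nonneg (pd 0 g p)])
  have j0 : L2 δ (pd 2 (pd 0 g)) ≤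
      L2 δ (fun y => Real.sqrt (pd 2 (pd 0 g) y ^ 2 + pd 2 (pd 1 g) y ^ 2)) :=
    L2_mono δ fun p => Real.abs_le_sqrt (by nlinarith [sq_nonneg (pd 2 (pd 1 g) p)])
  have j1 : L2 δ (pd 2 (pd 1 g)) ≤
      L2 δ (fun y => Real.sqrt (pd 2 (pd 0 g) y ^ 2 + pd 2 (pd 1 g) y ^ 2)) :=
    L2_mono δ fun p => Real.abs_le_sqrt (by nlinarith [sq_nonneg (pd 2 (pd 0 g) p)])
  have d1 : ENNReal.ofReal δ⁻¹ = ENNReal.ofReal (δ ^ (-(1 : ℝ) / 2)) ^ 2 := by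
    rw [← ENNReal.ofReal_pow (by positivity), ← Real.rpow_natCast, ← Real.rpow_mul hδ.le]
    norm_num [Real.rpow_neg_one]
  have d2 : ENNReal.ofReal δ = ENNReal.ofReal (δ ^ ((1 : ℝ) / 2)) ^ 2 := by
    rw [← ENNReal.ofReal_pow (by positivity), ← Real.rpow_natCast, ← Real.rpow_mul hδ.le]
    norm_num
  have four : ENNReal.ofReal 4 = 4 := by norm_num
  rw [d1, d2, normKS, four]
  generalize ENNReal.ofReal (δ ^ (-(1 : ℝ) / 2)) = s
  generalize ENNReal.ofReal (δ ^ ((1 : ℝ) / 2)) = t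
  generalize L2 δ (gradv g) = A at *
  generalize L2 δ (fun y => Real.sqrt (pd 2 (pd 0 g) y ^ 2 + pd 2 (pd 1 g) y ^ 2)) = B at *
  generalize L2 δ g = a
  generalize L2 δ (pd 2 g) = b
  calc _ ≤ 4 * (s ^ 2 * a ^ 2 + t ^ 2 * b ^ 2 + (s ^ 2 * A ^ 2 + t ^ 2 * B ^ 2) +
        (s ^ 2 * A ^ 2 + t ^ 2 * B ^ 2)) := by gcongr
    _ ≤ 4 * (s ^ 2 * a ^ 2 + t ^ 2 * b ^ 2 + (s ^ 2 * A ^ 2 + t ^ 2 * B ^ 2) +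
        (s ^ 2 * A ^ 2 + t ^ 2 * B ^ 2)) + (4 * s ^ 2 * a ^ 2 + 4 * t ^ 2 * b ^ 2 +
        16 * (s * A * (s * a) + s * A * (t * B) + s * A * (t * b) + s * a * (t * B) +
          s * a * (t * b) + t * B * (t * b))) := le_self_add
    _ = _ := by ring

theorem weighted_sobolev_KS1 :
    ∃ C : ℝ, 0 < C ∧
      ∀ (δ : ℝ), 0 < δ → δ ≤ 1 →
      ∀ f : Pt → ℝ, ContDiff ℝ 3 f → (∀ x, f (x + δ • e3) = f x) →
      ∀ x : Pt, x ∈ slab δ →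
        ENNReal.ofReal (Real.sqrt (Real.sqrt ((x 0)^2 + (x 1)^2)) * |f x|) ≤
          ENNReal.ofReal C *
            (ENNReal.ofReal (δ ^ (-(1:ℝ)/2)) *
                (∑ a ∈ Finset.range 2, (L2 δ (gradv (Om3^[a] f)) + L2 δ (Om3^[a] f)))
              + ENNReal.ofReal (δ ^ ((1:ℝ)/2)) *
                (∑ a ∈ Finset.range 2,
                  (L2 δ (fun y => Real.sqrt ((pd 2 (pd 0 (Om3^[a] f)) y)^2
                                             + (pd 2 (pd 1 (Om3^[a] f)) y)^2))
                    + L2 δ (pd 2 (Om3^[a] f))))) := by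
  refine ⟨12, by norm_num, fun δ hδ _ f hf _ x hx => ?_⟩
  have hO := contDiff_Om3 hf
  have hB : ENNReal.ofReal (δ ^ (-(1:ℝ)/2)) *
        (∑ a ∈ Finset.range 2, (L2 δ (gradv (Om3^[a] f)) + L2 δ (Om3^[a] f)))
      + ENNReal.ofReal (δ ^ ((1:ℝ)/2)) *
        (∑ a ∈ Finset.range 2,
          (L2 δ (fun y => Real.sqrt ((pd 2 (pd 0 (Om3^[a] f)) y)^2
                                     + (pd 2 (pd 1 (Om3^[a] f)) y)^2))
            + L2 δ (pd 2 (Om3^[a] f)))) = normKS δ f + normKS δ (Om3 f) := by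
    simp only [Finset.sum_range_succ, Finset.sum_range_zero, zero_add, Function.iterate_zero, id,
      Function.iterate_one, normKS]
    ring
  rw [hB]
  have hr0 : 0 ≤ Real.sqrt ((x 0)^2 + (x 1)^2) := Real.sqrt_nonneg _
  generalize hr : Real.sqrt ((x 0)^2 + (x 1)^2) = r at hr0 ⊢
  rcases hr0.eq_or_lt with h0 | h0
  · rw [← h0]; simp
  refine (ENNReal.pow_le_pow_left_iff (two_ne_zero)).1 ?_
  set w : ℂ := ⟨x 0, x 1⟩ with hw
  have hn : ‖w‖ = r := by rw [Complex.norm_def, Complex.normSq_apply, ← hr]; simp [hw, sq]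
  have hxp : pt (r * Real.cos w.arg) (r * Real.sin w.arg) (x 2) = x := by
    rw [← hn, Complex.norm_mul_cos_arg, Complex.norm_mul_sin_arg]
    exact pt_eta x
  have hθ : w.arg ∈ Icc (-Real.pi) Real.pi := ⟨(Complex.neg_pi_lt_arg w).le, Complex.arg_le_pi w⟩
  have hz : x 2 ∈ Icc 0 δ := ⟨hx.1, hx.2.le⟩
  have h1 := sq_le_lintegral_angle hf r (x 2) hθ
  rw [hxp] at h1
  have hf2 : ContDiff ℝ 2 f := hf.of_le (by norm_num)
  calc ENNReal.ofReal (Real.sqrt r * |f x|) ^ 2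
      = ENNReal.ofReal r * ENNReal.ofReal (f x ^ 2) := by
        rw [← ENNReal.ofReal_pow (by positivity), mul_pow, Real.sq_sqrt h0.le, sq_abs,
          ENNReal.ofReal_mul h0.le]
    _ ≤ ENNReal.ofReal r * _ := mul_le_mul_right h1 _
    _ ≤ 16 * (8 * normKS δ f ^ 2 + 8 * normKS δ (Om3 f) ^ 2) := by
        rw [mul_left_comm, mul_add]
        exact mul_le_mul_right (add_le_add
          ((mul_lintegral_angle_le hδ hf2 h0 hz).trans (lintegral_radE_le hδ hf2))
          ((mul_lintegral_angle_le hδ hO h0 hz).trans (lintegral_radE_le hδ hO))) _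
    _ ≤ 16 * (8 * normKS δ f ^ 2 + 8 * normKS δ (Om3 f) ^ 2) +
        (16 * (normKS δ f ^ 2 + normKS δ (Om3 f) ^ 2) + 288 * (normKS δ f * normKS δ (Om3 f))) :=
        le_self_add
    _ = _ := by
        rw [show ENNReal.ofReal 12 = 12 by norm_num]
        ring

end Stmt3
end
end

section
/- There is an absolute constant C > 0 such that for every 0 < δ ≤ 1, every t ∈ ℝ, every f ∈ H³(Ω_δ) and every x ∈ Ω_δ: r_v^{1/2} |t − r|^{1/2} |f(x)| ≤ C [ δ^{−1/2} Σ_{a=0,1} ( ‖(t−r) ∂_v Ω₃^a f‖_{L²(Ω_δ)} + ‖Ω₃^a f‖_{L²(Ω_δ)} ) + δ^{1/2} Σ_{a=0,1} ( ‖(t−r) ∂₃ ∂_v Ω₃^a f‖_{L²(Ω_δ)} + ‖∂₃ Ω₃^a f‖_{L²(Ω_δ)} ) ], provided the right-hand side is finite; C is independent of δ, t, f, x. -/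
/-!
STATEMENT 5: Weighted anisotropic Sobolev inequality (K-S-4):
r_v^{1/2} |t−r|^{1/2} |f(x)| ≤ C [ δ^{-1/2} Σ_{a=0,1} (‖(t−r)∂_v Ω₃^a f‖ + ‖Ω₃^a f‖)
                                  + δ^{1/2} Σ_{a=0,1} (‖(t−r)∂₃∂_v Ω₃^a f‖ + ‖∂₃Ω₃^a f‖) ].
-/

noncomputable section
open MeasureTheory
open scoped ENNReal

namespace Stmt5

abbrev Pt : Type := EuclideanSpace ℝ (Fin 3)

def e3 : Pt := EuclideanSpace.single 2 1

def slab (δ : ℝ) : Set Pt := {x : Pt | x 2 ∈ Set.Ico 0 δ}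

def pd (j : Fin 3) (f : Pt → ℝ) : Pt → ℝ :=
  fun x => fderiv ℝ f x (EuclideanSpace.single j 1)

def L2 (δ : ℝ) (f : Pt → ℝ) : ℝ≥0∞ := eLpNorm f 2 (volume.restrict (slab δ))

/-- The horizontal rotation Ω₃ = x₁∂₂ − x₂∂₁. -/
def Om3 (f : Pt → ℝ) : Pt → ℝ := fun x => x 0 * pd 1 f x - x 1 * pd 0 f x

/-- Norm of the horizontal gradient. -/
def gradv (f : Pt → ℝ) : Pt → ℝ := fun x => Real.sqrt ((pd 0 f x)^2 + (pd 1 f x)^2)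

/-- Multiplication by the weight y ↦ t − |y|. -/
def wt (t : ℝ) (f : Pt → ℝ) : Pt → ℝ := fun x => (t - ‖x‖) * f x

lemma mul_abs_le_integral_abs_add {F F' : ℝ → ℝ} {a L x₀ : ℝ}
    (hF : ∀ x ∈ Set.Icc a (a + L), HasDerivAt F (F' x) x)
    (hF' : ContinuousOn F' (Set.Icc a (a + L))) (hx : x₀ ∈ Set.Icc a (a + L)) :
    L * |F x₀| ≤ ∫ x in a..(a + L), (|F x| + L * |F' x|) := by
  have hL : a ≤ a + L := hx.1.trans hx.2
  have hFi : IntervalIntegrable (fun x => |F x|) volume a (a + L) := by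
    refine ContinuousOn.intervalIntegrable ?_
    rw [Set.uIcc_of_le hL]
    exact ContinuousOn.abs fun x hx => (hF x hx).continuousAt.continuousWithinAt
  have hFi' : IntervalIntegrable (fun x => |F' x|) volume a (a + L) := by
    refine ContinuousOn.intervalIntegrable ?_
    rw [Set.uIcc_of_le hL]
    exact hF'.abs
  set c := ∫ x in a..(a + L), |F' x| with hc
  have key : ∀ y ∈ Set.Icc a (a + L), |F x₀| ≤ |F y| + c := by
    intro y hy
    have hsub : Set.uIcc y x₀ ⊆ Set.Icc a (a + L) := Set.OrdConnected.uIcc_subset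
      Set.ordConnected_Icc hy hx
    have h1 : ∫ x in y..x₀, F' x = F x₀ - F y :=
      intervalIntegral.integral_eq_sub_of_hasDerivAt (fun x hx => hF x (hsub hx))
        (hF'.mono hsub).intervalIntegrable
    have h2 : |∫ x in y..x₀, F' x| ≤ c := by
      refine (intervalIntegral.norm_integral_le_abs_integral_norm (f := F') (a := y) (b := x₀)).trans ?_
      simp only [Real.norm_eq_abs]
      rw [hc, ← abs_of_nonneg (intervalIntegral.integral_nonneg hL fun x _ => abs_nonneg (F' x))]
      refine intervalIntegral.abs_integral_mono_interval ?_ ?_ hFi'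
      · rw [Set.uIoc_of_le hL]
        exact Set.Ioc_subset_Ioc (le_min hy.1 hx.1) (max_le hy.2 hx.2)
      · exact Filter.Eventually.of_forall fun x => abs_nonneg _
    rw [h1] at h2
    have := abs_sub_abs_le_abs_sub (F x₀) (F y)
    linarith
  have h3 : ∫ _ in a..(a + L), |F x₀| ≤ ∫ x in a..(a + L), (|F x| + c) :=
    intervalIntegral.integral_mono_on hL (continuous_const.intervalIntegrable _ _)
      (hFi.add (continuous_const.intervalIntegrable _ _)) key
  rw [intervalIntegral.integral_add hFi (continuous_const.intervalIntegrable _ _)] at h3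
  rw [intervalIntegral.integral_add hFi (hFi'.const_mul L), intervalIntegral.integral_const_mul]
  simpa using h3

lemma mul_sq_le_integral {g g' : ℝ → ℝ} (hg : ∀ x, HasDerivAt g (g' x) x)
    (hg' : Continuous g') {a L x₀ : ℝ} (hx : x₀ ∈ Set.Icc a (a + L)) :
    L * g x₀ ^ 2 ≤ ∫ x in a..(a + L), (2 * g x ^ 2 + L ^ 2 * g' x ^ 2) := by
  have hL : a ≤ a + L := hx.1.trans hx.2
  have hgc : Continuous g := continuous_iff_continuousAt.2 fun x => (hg x).continuousAt
  have h := mul_abs_le_integral_abs_add (F := fun x => g x ^ 2) (F' := fun x => 2 * g x * g' x)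
    (fun x _ => by simpa [Pi.pow_def] using (hg x).pow 2) (by fun_prop) hx
  rw [abs_of_nonneg (sq_nonneg _)] at h
  refine h.trans (intervalIntegral.integral_mono_on hL
    (Continuous.intervalIntegrable (by fun_prop) _ _)
    (Continuous.intervalIntegrable (by fun_prop) _ _) fun x _ => ?_)
  rw [abs_of_nonneg (sq_nonneg (g x)), abs_mul, abs_mul, abs_two]
  nlinarith [sq_nonneg (|g x| - L * |g' x|), sq_abs (g x), sq_abs (g' x)]

lemma ofReal_intervalIntegral {p : ℝ → ℝ} (hp : Continuous p) {a b : ℝ} (hab : a ≤ b)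
    (hp0 : ∀ x ∈ Set.Ioc a b, 0 ≤ p x) :
    ENNReal.ofReal (∫ x in a..b, p x) = ∫⁻ x in Set.Ioc a b, ENNReal.ofReal (p x) := by
  rw [intervalIntegral.integral_of_le hab]
  exact ofReal_integral_eq_lintegral_ofReal
    ((hp.intervalIntegrable a b).1) ((ae_restrict_iff' measurableSet_Ioc).2 (.of_forall hp0))

/-- Angular Sobolev inequality on the circle. -/
lemma ofReal_sq_le_lintegral_angle {g g' : ℝ → ℝ} (hg : ∀ x, HasDerivAt g (g' x) x)
    (hg' : Continuous g') {θ₀ : ℝ} (h₀ : θ₀ ∈ Set.Icc (-Real.pi) Real.pi) :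
    ENNReal.ofReal (g θ₀ ^ 2) ≤
      ∫⁻ θ in Set.Ioo (-Real.pi) Real.pi, ENNReal.ofReal (8 * (g θ ^ 2 + g' θ ^ 2)) := by
  have hgc : Continuous g := continuous_iff_continuousAt.2 fun x => (hg x).continuousAt
  have hπ := Real.pi_gt_three
  have hπ4 := Real.pi_le_four
  rw [restrict_Ioo_eq_restrict_Ioc,
    ← ofReal_intervalIntegral (by fun_prop) (by linarith) (fun x _ => by positivity)]
  refine ENNReal.ofReal_le_ofReal ?_
  have e : -Real.pi + 2 * Real.pi = Real.pi := by ring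
  have h := mul_sq_le_integral hg hg' (a := -Real.pi) (L := 2 * Real.pi) (x₀ := θ₀) (by rwa [e])
  rw [e] at h
  have h2 : ∫ x in (-Real.pi)..Real.pi, (2 * g x ^ 2 + (2 * Real.pi) ^ 2 * g' x ^ 2) ≤
      ∫ x in (-Real.pi)..Real.pi, (2 * Real.pi) * (8 * (g x ^ 2 + g' x ^ 2)) := by
    refine intervalIntegral.integral_mono_on (by linarith)
      (Continuous.intervalIntegrable (by fun_prop) _ _)
      (Continuous.intervalIntegrable (by fun_prop) _ _) fun x _ => ?_
    have h3 : 2 * g x ^ 2 ≤ (2 * Real.pi) * 8 * g x ^ 2 := by gcongr; linarith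
    have h4 : (2 * Real.pi) ^ 2 * g' x ^ 2 ≤ (2 * Real.pi) * 8 * g' x ^ 2 := by
      gcongr; nlinarith
    linarith
  rw [intervalIntegral.integral_const_mul] at h2
  exact le_of_mul_le_mul_left (h.trans h2) (by linarith)

/-- Radial weighted inequality at a fixed angle and height. -/
lemma ofReal_le_lintegral_radial {g g' : ℝ → ℝ} (hg : ∀ x, HasDerivAt g (g' x) x)
    (hg' : Continuous g') (t z : ℝ) {ρ₀ : ℝ} (h₀ : 0 < ρ₀) :
    ENNReal.ofReal (ρ₀ * (|t - √(ρ₀ ^ 2 + z ^ 2)| * g ρ₀ ^ 2)) ≤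
      ∫⁻ ρ in Set.Ioi 0, ENNReal.ofReal
        (4 * (ρ * (g ρ ^ 2 + (t - √(ρ ^ 2 + z ^ 2)) ^ 2 * g' ρ ^ 2))) := by
  have hgc : Continuous g := continuous_iff_continuousAt.2 fun x => (hg x).continuousAt
  set w : ℝ → ℝ := fun ρ => t - √(ρ ^ 2 + z ^ 2) with hw
  have hwc : Continuous w := by fun_prop
  set N := |w ρ₀| + 1 with hN
  have hN1 : 0 < N := by positivity
  have hpos : ∀ ρ ∈ Set.Icc ρ₀ (ρ₀ + N), 0 < ρ := fun ρ hρ => h₀.trans_le hρ.1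
  have hr : ∀ ρ ∈ Set.Icc ρ₀ (ρ₀ + N), |w ρ| ≤ 2 * N := by
    intro ρ hρ
    have h1 : √(ρ ^ 2 + z ^ 2) ≤ √(ρ₀ ^ 2 + z ^ 2) + (ρ - ρ₀) := by
      rw [Real.sqrt_le_iff]
      refine ⟨by have := Real.sqrt_nonneg (ρ₀ ^ 2 + z ^ 2); linarith [hρ.1], ?_⟩
      have h2 : ρ₀ ≤ √(ρ₀ ^ 2 + z ^ 2) := Real.le_sqrt_of_sq_le (by nlinarith [sq_nonneg z])
      nlinarith [Real.sq_sqrt (show 0 ≤ ρ₀ ^ 2 + z ^ 2 by positivity), hρ.1]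
    have h3 : √(ρ₀ ^ 2 + z ^ 2) ≤ √(ρ ^ 2 + z ^ 2) :=
      Real.sqrt_le_sqrt (by nlinarith [hρ.1])
    have h4 := le_abs_self (w ρ₀)
    have h5 := neg_abs_le (w ρ₀)
    rw [abs_le]
    simp only [hw] at h4 h5 hN ⊢
    constructor <;> linarith [hρ.1, hρ.2]
  have hw0 : ∀ ρ ∈ Set.Icc ρ₀ (ρ₀ + N),
      HasDerivAt (fun ρ => w ρ * g ρ ^ 2)
        (-(ρ / √(ρ ^ 2 + z ^ 2)) * g ρ ^ 2 + w ρ * (2 * g ρ * g' ρ)) ρ := by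
    intro ρ hρ
    have hρ0 := hpos ρ hρ
    have h1 : HasDerivAt (fun ρ : ℝ => ρ ^ 2 + z ^ 2) (2 * ρ) ρ := by
      simpa using ((hasDerivAt_id ρ).pow 2).add_const (z ^ 2)
    have h2 := (h1.sqrt (by positivity)).const_sub t
    have h3 : HasDerivAt (fun ρ => g ρ ^ 2) (2 * g ρ * g' ρ) ρ := by
      simpa [Pi.pow_def] using (hg ρ).pow 2
    refine (h2.mul h3).congr_deriv ?_
    have e : 2 * ρ / (2 * √(ρ ^ 2 + z ^ 2)) = ρ / √(ρ ^ 2 + z ^ 2) :=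
      mul_div_mul_left _ _ two_ne_zero
    rw [e]
  have hcont : ContinuousOn (fun ρ => -(ρ / √(ρ ^ 2 + z ^ 2)) * g ρ ^ 2 + w ρ * (2 * g ρ * g' ρ))
      (Set.Icc ρ₀ (ρ₀ + N)) := by
    have : ContinuousOn (fun ρ : ℝ => ρ / √(ρ ^ 2 + z ^ 2)) (Set.Icc ρ₀ (ρ₀ + N)) :=
      ContinuousOn.div (by fun_prop) (by fun_prop) fun ρ hρ => by
        have := hpos ρ hρ
        positivity
    fun_prop
  have hmem : ρ₀ ∈ Set.Icc ρ₀ (ρ₀ + N) := ⟨le_rfl, by linarith⟩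
  have h := mul_abs_le_integral_abs_add hw0 hcont hmem
  have hle : ρ₀ ≤ ρ₀ + N := by linarith
  have h2 : ∫ ρ in ρ₀..(ρ₀ + N), ρ₀ * (|w ρ * g ρ ^ 2| +
        N * |-(ρ / √(ρ ^ 2 + z ^ 2)) * g ρ ^ 2 + w ρ * (2 * g ρ * g' ρ)|) ≤
      ∫ ρ in ρ₀..(ρ₀ + N), N * (4 * (ρ * (g ρ ^ 2 + w ρ ^ 2 * g' ρ ^ 2))) := by
    refine intervalIntegral.integral_mono_on hle ?_
      (Continuous.intervalIntegrable (by fun_prop) _ _) fun ρ hρ => ?_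
    · refine ContinuousOn.intervalIntegrable ?_
      rw [Set.uIcc_of_le hle]
      fun_prop
    · have hρ0 := hpos ρ hρ
      have hq : |-(ρ / √(ρ ^ 2 + z ^ 2))| ≤ 1 := by
        rw [abs_neg, abs_of_nonneg (by positivity)]
        refine div_le_one_of_le₀ (Real.le_sqrt_of_sq_le (by nlinarith [sq_nonneg z])) (by positivity)
      have a1 : |w ρ * g ρ ^ 2| ≤ 2 * N * g ρ ^ 2 := by
        rw [abs_mul, abs_of_nonneg (sq_nonneg (g ρ))]
        gcongr
        exact hr ρ hρ
      have a2 : |-(ρ / √(ρ ^ 2 + z ^ 2)) * g ρ ^ 2 + w ρ * (2 * g ρ * g' ρ)| ≤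
          2 * g ρ ^ 2 + w ρ ^ 2 * g' ρ ^ 2 := by
        refine (abs_add_le _ _).trans ?_
        have b1 : |-(ρ / √(ρ ^ 2 + z ^ 2)) * g ρ ^ 2| ≤ g ρ ^ 2 := by
          rw [abs_mul, abs_of_nonneg (sq_nonneg (g ρ))]
          exact mul_le_of_le_one_left (sq_nonneg _) hq
        have b2 : |w ρ * (2 * g ρ * g' ρ)| ≤ g ρ ^ 2 + w ρ ^ 2 * g' ρ ^ 2 := by
          rw [abs_le]
          constructor <;> nlinarith [sq_nonneg (g ρ + w ρ * g' ρ), sq_nonneg (g ρ - w ρ * g' ρ)]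
        linarith
      have hA : 0 ≤ w ρ ^ 2 * g' ρ ^ 2 := by positivity
      calc _ ≤ ρ * (2 * N * g ρ ^ 2 + N * (2 * g ρ ^ 2 + w ρ ^ 2 * g' ρ ^ 2)) := by
            gcongr
            exact hρ.1
        _ ≤ _ := by
            have : 0 ≤ N * ρ * (w ρ ^ 2 * g' ρ ^ 2) := by positivity
            nlinarith
  rw [intervalIntegral.integral_const_mul, intervalIntegral.integral_const_mul] at h2
  have h3 : ρ₀ * (|w ρ₀| * g ρ₀ ^ 2) ≤
      ∫ ρ in ρ₀..(ρ₀ + N), 4 * (ρ * (g ρ ^ 2 + w ρ ^ 2 * g' ρ ^ 2)) := by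
    refine le_of_mul_le_mul_left ?_ hN1
    refine le_trans (le_of_eq ?_) ((mul_le_mul_of_nonneg_left h h₀.le).trans h2)
    rw [abs_mul, abs_of_nonneg (sq_nonneg (g ρ₀))]
    ring
  refine (ENNReal.ofReal_le_ofReal h3).trans ?_
  rw [ofReal_intervalIntegral (by fun_prop) hle fun ρ hρ => ?_]
  · exact lintegral_mono_set fun ρ hρ => h₀.trans hρ.1
  · have := h₀.trans hρ.1
    positivity
lemma sqrt_sub_sqrt_lower_bound {ρ δ a b : ℝ} (hρ : 0 < ρ) (ha : 0 ≤ a) (hab : a ≤ b)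
    (hb : b ≤ δ) :
    (√(ρ ^ 2 + δ ^ 2) - √(ρ ^ 2 + 0 ^ 2)) * (b ^ 2 - a ^ 2) ≤
      2 * δ ^ 2 * (√(ρ ^ 2 + b ^ 2) - √(ρ ^ 2 + a ^ 2)) := by
  have h : ∀ u v : ℝ, 0 ≤ u → u ≤ v → √(ρ ^ 2 + u ^ 2) ≤ √(ρ ^ 2 + v ^ 2) := fun u v hu huv =>
    Real.sqrt_le_sqrt (by nlinarith)
  have hs : ∀ u : ℝ, √(ρ ^ 2 + u ^ 2) ^ 2 = ρ ^ 2 + u ^ 2 := fun u => Real.sq_sqrt (by positivity)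
  have h1 := h 0 a le_rfl ha
  have h2 := h a b ha hab
  have h3 := h b δ (ha.trans hab) hb
  have s0 := hs 0
  have s1 := hs a
  have s2 := hs b
  have s3 := hs δ
  have p0 := Real.sqrt_nonneg (ρ ^ 2 + 0 ^ 2)
  generalize √(ρ ^ 2 + 0 ^ 2) = R at *
  generalize √(ρ ^ 2 + a ^ 2) = A at *
  generalize √(ρ ^ 2 + b ^ 2) = B at *
  generalize √(ρ ^ 2 + δ ^ 2) = D at *
  have e1 : b ^ 2 - a ^ 2 = (B - A) * (B + A) := by linarith
  have e2 : δ ^ 2 = (D - R) * (D + R) := by linarith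
  rw [e1, e2]
  have : 0 ≤ (D - R) * (B - A) := mul_nonneg (by linarith) (by linarith)
  nlinarith

/-- From every height one can leave along an arc of the circle `ℝ / δℤ` of length `δ / 8`
on which the weight `|t - r|` stays comparable to its initial value. -/
lemma exists_arc_mul_integral_le {ρ δ : ℝ} (hρ : 0 < ρ) (hδ : 0 < δ) (t : ℝ) {z₀ : ℝ}
    (hz : z₀ ∈ Set.Ico 0 δ) {p : ℝ → ℝ} (hp : Continuous p) (hp0 : ∀ z, 0 ≤ p z)
    (hper : ∀ z, p (z + δ) = p z) :
    ∃ a, z₀ ∈ Set.Icc a (a + δ / 8) ∧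
      |t - √(ρ ^ 2 + z₀ ^ 2)| * ∫ z in a..(a + δ / 8), p z ≤
        12 * ∫ z in 0..δ, |t - √(ρ ^ 2 + z ^ 2)| * p z := by
  obtain ⟨hz0, hz1⟩ := hz
  have hmono : ∀ u v : ℝ, 0 ≤ u → u ≤ v → √(ρ ^ 2 + u ^ 2) ≤ √(ρ ^ 2 + v ^ 2) := fun u v hu huv =>
    Real.sqrt_le_sqrt (by nlinarith)
  have hlow : ∀ u v : ℝ, 0 ≤ u → u ≤ v → v ≤ 1 →
      (√(ρ ^ 2 + δ ^ 2) - √(ρ ^ 2 + 0 ^ 2)) * (v ^ 2 - u ^ 2) ≤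
      2 * (√(ρ ^ 2 + (v * δ) ^ 2) - √(ρ ^ 2 + (u * δ) ^ 2)) := by
    intro u v hu huv hv
    have h := sqrt_sub_sqrt_lower_bound (ρ := ρ) (δ := δ) (a := u * δ) (b := v * δ) hρ
      (by positivity) (by gcongr) (by nlinarith)
    have hd : 0 < δ ^ 2 := by positivity
    refine le_of_mul_le_mul_left ?_ hd
    linarith
  set φ : ℝ → ℝ := fun z => √(ρ ^ 2 + z ^ 2) with hφ
  have hφc : Continuous φ := by fun_prop
  change ∀ u v : ℝ, 0 ≤ u → u ≤ v → φ u ≤ φ v at hmono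
  change ∀ u v : ℝ, 0 ≤ u → u ≤ v → v ≤ 1 →
      (φ δ - φ 0) * (v ^ 2 - u ^ 2) ≤ 2 * (φ (v * δ) - φ (u * δ)) at hlow
  change ∃ a, z₀ ∈ Set.Icc a (a + δ / 8) ∧ |t - φ z₀| * ∫ z in a..(a + δ / 8), p z ≤
        12 * ∫ z in 0..δ, |t - φ z| * p z
  have hi : ∀ a b, IntervalIntegrable (fun z => |t - φ z| * p z) volume a b := fun a b =>
    Continuous.intervalIntegrable (by fun_prop) _ _
  have hpi : ∀ a b, IntervalIntegrable p volume a b := fun a b => hp.intervalIntegrable _ _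
  have hsub : ∀ a b, a ≤ b → (∀ z ∈ Set.Icc a b, |t - φ z₀| ≤ 12 * |t - φ z|) →
      |t - φ z₀| * ∫ z in a..b, p z ≤ 12 * ∫ z in a..b, |t - φ z| * p z := by
    intro a b hab h
    rw [← intervalIntegral.integral_const_mul, ← intervalIntegral.integral_const_mul]
    refine intervalIntegral.integral_mono_on hab ((hpi a b).const_mul _) ((hi a b).const_mul _)
      fun z hz => ?_
    rw [← mul_assoc]
    exact mul_le_mul_of_nonneg_right (h z hz) (hp0 z)
  have hnn : ∀ a b, a ≤ b → 0 ≤ ∫ z in a..b, |t - φ z| * p z := fun a b hab =>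
    intervalIntegral.integral_nonneg hab fun z _ => mul_nonneg (abs_nonneg _) (hp0 z)
  have hadd : ∀ a b, ∫ z in 0..δ, |t - φ z| * p z = (∫ z in 0..a, |t - φ z| * p z) +
      (∫ z in a..b, |t - φ z| * p z) + ∫ z in b..δ, |t - φ z| * p z := fun a b => by
    rw [intervalIntegral.integral_add_adjacent_intervals (hi _ _) (hi _ _),
      intervalIntegral.integral_add_adjacent_intervals (hi _ _) (hi _ _)]
  have direct : ∀ a, 0 ≤ a → a + δ / 8 ≤ δ → z₀ ∈ Set.Icc a (a + δ / 8) →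
      (∀ z ∈ Set.Icc a (a + δ / 8), |t - φ z₀| ≤ 12 * |t - φ z|) →
      ∃ a, z₀ ∈ Set.Icc a (a + δ / 8) ∧ |t - φ z₀| * ∫ z in a..(a + δ / 8), p z ≤
        12 * ∫ z in 0..δ, |t - φ z| * p z := by
    intro a ha hb hz h
    refine ⟨a, hz, (hsub _ _ (by linarith) h).trans ?_⟩
    rw [hadd a (a + δ / 8)]
    linarith [hnn 0 a ha, hnn (a + δ / 8) δ hb]
  have wrap : ∀ b, 0 ≤ b → b ≤ δ / 8 →
      (∀ z ∈ Set.Icc 0 b, |t - φ z₀| ≤ 12 * |t - φ z|) →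
      (∀ z ∈ Set.Icc (b + 7 / 8 * δ) δ, |t - φ z₀| ≤ 12 * |t - φ z|) →
      |t - φ z₀| * ((∫ z in (b + 7 / 8 * δ)..δ, p z) + ∫ z in 0..b, p z) ≤
        12 * ∫ z in 0..δ, |t - φ z| * p z := by
    intro b hb hb' h1 h2
    have h3 := hsub _ _ hb h1
    have h4 := hsub _ _ (by linarith) h2
    rw [hadd b (b + 7 / 8 * δ), mul_add]
    linarith [hnn b (b + 7 / 8 * δ) (by linarith)]
  have hshift : ∀ a b, ∫ z in (a + δ)..(b + δ), p z = ∫ z in a..b, p z := fun a b => by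
    rw [← intervalIntegral.integral_comp_add_right]
    simp only [hper]
  have hK : 0 ≤ φ δ - φ 0 := sub_nonneg.2 (hmono 0 δ le_rfl hδ.le)
  have m0 := hmono 0 z₀ le_rfl hz0
  have m1 := hmono z₀ δ hz0 hz1.le
  rcases lt_or_ge t (φ z₀) with ht | ht
  · have hμ : |t - φ z₀| = φ z₀ - t := by rw [abs_of_neg (by linarith)]; ring
    rw [hμ] at direct wrap ⊢
    rcases le_or_gt z₀ (7 / 8 * δ) with h7 | h7
    · refine direct z₀ hz0 (by linarith) ⟨le_rfl, by linarith⟩ fun z hz => ?_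
      have := hmono z₀ z hz0 hz.1
      linarith [neg_abs_le (t - φ z)]
    · rcases lt_or_ge t (φ (1 / 2 * δ)) with h5 | h5
      · refine direct (z₀ - δ / 8) (by linarith) (by linarith) ⟨by linarith, by linarith⟩
          fun z hz => ?_
        have h1 := hmono (3 / 4 * δ) z (by positivity) (by linarith [hz.1])
        have h2 := hmono 0 (3 / 4 * δ) le_rfl (by positivity)
        have h3 := hlow (1 / 2) (3 / 4) (by norm_num) (by norm_num) (by norm_num)
        linarith [neg_abs_le (t - φ z)]
      · refine ⟨z₀, ⟨le_rfl, by linarith⟩, ?_⟩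
        have h3 := hlow (1 / 8) (1 / 2) (by norm_num) (by norm_num) (by norm_num)
        have h4 := wrap (z₀ - 7 / 8 * δ) (by linarith) (by linarith) (fun z hz => ?_)
          (fun z hz => ?_)
        · have e := hshift 0 (z₀ - 7 / 8 * δ)
          rw [← e, sub_add_cancel, zero_add,
            intervalIntegral.integral_add_adjacent_intervals (hpi _ _) (hpi _ _)] at h4
          convert h4 using 3
          ring
        · have h1 := hmono z (1 / 8 * δ) hz.1 (by linarith [hz.2])
          have h2 := hmono 0 (1 / 2 * δ) le_rfl (by positivity)
          linarith [le_abs_self (t - φ z)]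
        · have := hmono z₀ z hz0 (by linarith [hz.1])
          linarith [neg_abs_le (t - φ z)]
  · have hμ : |t - φ z₀| = t - φ z₀ := abs_of_nonneg (by linarith)
    rw [hμ] at direct wrap ⊢
    rcases le_or_gt (1 / 8 * δ) z₀ with h7 | h7
    · refine direct (z₀ - δ / 8) (by linarith) (by linarith) ⟨by linarith, by linarith⟩
        fun z hz => ?_
      have := hmono z z₀ (by linarith [hz.1]) (by linarith [hz.2])
      linarith [le_abs_self (t - φ z)]
    · rcases lt_or_ge t (φ (1 / 2 * δ)) with h5 | h5
      · refine ⟨z₀ - δ / 8, ⟨by linarith, by linarith⟩, ?_⟩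
        have h3 := hlow (1 / 2) (7 / 8) (by norm_num) (by norm_num) (by norm_num)
        have h4 := wrap z₀ hz0 (by linarith) (fun z hz => ?_) (fun z hz => ?_)
        · have e := hshift (z₀ - δ / 8) 0
          rw [show z₀ - δ / 8 + δ = z₀ + 7 / 8 * δ by ring, zero_add] at e
          rw [e, intervalIntegral.integral_add_adjacent_intervals (hpi _ _) (hpi _ _)] at h4
          rwa [sub_add_cancel]
        · have := hmono z z₀ hz.1 hz.2
          linarith [le_abs_self (t - φ z)]
        · have h1 := hmono (7 / 8 * δ) z (by positivity) (by linarith [hz.1])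
          have h2 := hmono (1 / 2 * δ) δ (by positivity) (by linarith)
          linarith [neg_abs_le (t - φ z)]
      · refine direct z₀ hz0 (by linarith) ⟨le_rfl, by linarith⟩ fun z hz => ?_
        have h1 := hmono z (1 / 4 * δ) (by linarith [hz.1]) (by linarith [hz.2])
        have h2 := hmono (1 / 4 * δ) δ (by positivity) (by linarith)
        have h3 := hlow (1 / 4) (1 / 2) (by norm_num) (by norm_num) (by norm_num)
        linarith [le_abs_self (t - φ z)]

/-- Weighted Sobolev inequality in the periodic vertical variable. -/
lemma ofReal_le_lintegral_vertical {ρ δ : ℝ} (hρ : 0 < ρ) (hδ : 0 < δ) (t : ℝ) {z₀ : ℝ}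
    (hz : z₀ ∈ Set.Ico 0 δ) {g g' : ℝ → ℝ} (hg : ∀ x, HasDerivAt g (g' x) x)
    (hg' : Continuous g') (hper : ∀ z, g (z + δ) = g z) (hper' : ∀ z, g' (z + δ) = g' z) :
    ENNReal.ofReal (ρ * (|t - √(ρ ^ 2 + z₀ ^ 2)| * g z₀ ^ 2)) ≤
      ∫⁻ z in Set.Ico 0 δ, ENNReal.ofReal (192 * (δ⁻¹ * (ρ * (|t - √(ρ ^ 2 + z ^ 2)| * g z ^ 2)) +
        δ * (ρ * (|t - √(ρ ^ 2 + z ^ 2)| * g' z ^ 2)))) := by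
  have hgc : Continuous g := continuous_iff_continuousAt.2 fun x => (hg x).continuousAt
  obtain ⟨a, ha, h⟩ := exists_arc_mul_integral_le hρ hδ t hz
    (p := fun z => 2 * g z ^ 2 + (δ / 8) ^ 2 * g' z ^ 2) (by fun_prop) (fun z => by positivity)
    (fun z => by simp only [hper, hper'])
  have h1 := mul_le_mul_of_nonneg_left (mul_sq_le_integral hg hg' ha)
    (abs_nonneg (t - √(ρ ^ 2 + z₀ ^ 2)))
  rw [← restrict_Ioo_eq_restrict_Ico, restrict_Ioo_eq_restrict_Ioc,
    ← ofReal_intervalIntegral (by fun_prop) hδ.le (fun x _ => by positivity)]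
  refine ENNReal.ofReal_le_ofReal ?_
  have h2 : ρ * (12 * ∫ z in 0..δ, |t - √(ρ ^ 2 + z ^ 2)| *
        (2 * g z ^ 2 + (δ / 8) ^ 2 * g' z ^ 2)) ≤
      (δ / 8) * ∫ z in 0..δ, 192 * (δ⁻¹ * (ρ * (|t - √(ρ ^ 2 + z ^ 2)| * g z ^ 2)) +
        δ * (ρ * (|t - √(ρ ^ 2 + z ^ 2)| * g' z ^ 2))) := by
    rw [← mul_assoc, ← intervalIntegral.integral_const_mul, ← intervalIntegral.integral_const_mul]
    refine intervalIntegral.integral_mono_on hδ.le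
      (Continuous.intervalIntegrable (by fun_prop) _ _)
      (Continuous.intervalIntegrable (by fun_prop) _ _) fun z _ => ?_
    have e : δ / 8 * (192 * (δ⁻¹ * (ρ * (|t - √(ρ ^ 2 + z ^ 2)| * g z ^ 2)) +
        δ * (ρ * (|t - √(ρ ^ 2 + z ^ 2)| * g' z ^ 2)))) =
        24 * (ρ * (|t - √(ρ ^ 2 + z ^ 2)| * g z ^ 2)) +
        24 * δ ^ 2 * (ρ * (|t - √(ρ ^ 2 + z ^ 2)| * g' z ^ 2)) := by
      field_simp
      ring
    have : 0 ≤ δ ^ 2 * (ρ * (|t - √(ρ ^ 2 + z ^ 2)| * g' z ^ 2)) := by positivity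
    rw [e]
    linarith
  refine le_of_mul_le_mul_left (le_trans ?_ h2) (by positivity : 0 < δ / 8)
  have h3 := mul_le_mul_of_nonneg_left (h1.trans h) hρ.le
  linarith

/-- The point with cylindrical coordinates `(ρ, θ, z)`. -/
def cyl (ρ θ z : ℝ) : Pt := !₂[ρ * Real.cos θ, ρ * Real.sin θ, z]

lemma cyl_eq (ρ θ z : ℝ) : cyl ρ θ z = (ρ * Real.cos θ) • EuclideanSpace.single 0 1 +
    (ρ * Real.sin θ) • EuclideanSpace.single 1 1 + z • EuclideanSpace.single 2 1 := by
  ext i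
  fin_cases i <;> simp [cyl]

@[fun_prop]
lemma Continuous.cyl {X : Type*} [TopologicalSpace X] {a b c : X → ℝ} (ha : Continuous a)
    (hb : Continuous b) (hc : Continuous c) : Continuous fun x => cyl (a x) (b x) (c x) := by
  simp only [cyl_eq]
  fun_prop

lemma cyl_add_period (ρ θ z δ : ℝ) : cyl ρ θ (z + δ) = cyl ρ θ z + δ • e3 := by
  rw [cyl_eq, cyl_eq, e3, add_smul, add_assoc]
  simp only [add_assoc]

lemma norm_cyl (ρ θ z : ℝ) : ‖cyl ρ θ z‖ = √(ρ ^ 2 + z ^ 2) := by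
  rw [EuclideanSpace.norm_eq]
  congr 1
  simp only [cyl, Fin.sum_univ_three, Real.norm_eq_abs, sq_abs]
  simp
  linear_combination ρ ^ 2 * Real.cos_sq_add_sin_sq θ

lemma exists_cyl_eq (x : Pt) : ∃ θ ∈ Set.Icc (-Real.pi) Real.pi,
    x = cyl (√((x 0) ^ 2 + (x 1) ^ 2)) θ (x 2) := by
  refine ⟨Complex.arg ⟨x 0, x 1⟩, ⟨(Complex.neg_pi_lt_arg _).le, Complex.arg_le_pi _⟩, ?_⟩
  have h : ‖(⟨x 0, x 1⟩ : ℂ)‖ = √((x 0) ^ 2 + (x 1) ^ 2) := by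
    rw [Complex.norm_def, Complex.normSq_apply]
    simp only [sq]
  have h1 := Complex.norm_mul_cos_arg ⟨x 0, x 1⟩
  have h2 := Complex.norm_mul_sin_arg ⟨x 0, x 1⟩
  rw [h] at h1 h2
  ext i
  fin_cases i <;> simp [cyl, h1, h2]

section Derivatives

variable {g : Pt → ℝ}

lemma hasDerivAt_cyl_radius (hg : Differentiable ℝ g) (ρ θ z : ℝ) :
    HasDerivAt (fun ρ => g (cyl ρ θ z))
      (Real.cos θ * pd 0 g (cyl ρ θ z) + Real.sin θ * pd 1 g (cyl ρ θ z)) ρ := by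
  have h : HasDerivAt (fun ρ => cyl ρ θ z) (Real.cos θ • EuclideanSpace.single 0 1 +
      Real.sin θ • EuclideanSpace.single 1 1) ρ := by
    simp only [cyl_eq]
    have h1 := ((hasDerivAt_id ρ).mul_const (Real.cos θ)).smul_const
      (EuclideanSpace.single (0 : Fin 3) (1 : ℝ))
    have h2 := ((hasDerivAt_id ρ).mul_const (Real.sin θ)).smul_const
      (EuclideanSpace.single (1 : Fin 3) (1 : ℝ))
    simpa using (h1.add h2).add_const (z • EuclideanSpace.single (2 : Fin 3) (1 : ℝ))
  refine ((hg _).hasFDerivAt.comp_hasDerivAt ρ h).congr_deriv ?_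
  simp [pd]

lemma hasDerivAt_cyl_angle (hg : Differentiable ℝ g) (ρ θ z : ℝ) :
    HasDerivAt (fun θ => g (cyl ρ θ z)) (Om3 g (cyl ρ θ z)) θ := by
  have h : HasDerivAt (fun θ => cyl ρ θ z) ((ρ * -Real.sin θ) • EuclideanSpace.single 0 1 +
      (ρ * Real.cos θ) • EuclideanSpace.single 1 1) θ := by
    simp only [cyl_eq]
    exact ((((Real.hasDerivAt_cos θ).const_mul ρ).smul_const _).add
      (((Real.hasDerivAt_sin θ).const_mul ρ).smul_const _)).add_const _
  refine ((hg _).hasFDerivAt.comp_hasDerivAt θ h).congr_deriv ?_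
  simp [pd, Om3, cyl]
  ring

lemma hasDerivAt_cyl_height (hg : Differentiable ℝ g) (ρ θ z : ℝ) :
    HasDerivAt (fun z => g (cyl ρ θ z)) (pd 2 g (cyl ρ θ z)) z := by
  have h : HasDerivAt (fun z => cyl ρ θ z) (EuclideanSpace.single 2 1) z := by
    simp only [cyl_eq]
    simpa using ((hasDerivAt_id z).smul_const
      (EuclideanSpace.single (2 : Fin 3) (1 : ℝ))).const_add
        ((ρ * Real.cos θ) • EuclideanSpace.single (0 : Fin 3) (1 : ℝ) +
          (ρ * Real.sin θ) • EuclideanSpace.single (1 : Fin 3) (1 : ℝ))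
  exact (hg _).hasFDerivAt.comp_hasDerivAt z h

lemma contDiff_pd {n m : ℕ∞} (hg : ContDiff ℝ n g) (h : m + 1 ≤ n) (j : Fin 3) :
    ContDiff ℝ m (pd j g) :=
  (hg.fderiv_right (by exact_mod_cast h)).clm_apply contDiff_const

lemma contDiff_Om3 {n m : ℕ∞} (hg : ContDiff ℝ n g) (h : m + 1 ≤ n) : ContDiff ℝ m (Om3 g) := by
  have h0 := contDiff_pd hg h 0
  have h1 := contDiff_pd hg h 1
  unfold Om3
  fun_prop

lemma pd_comm (hg : ContDiff ℝ 2 g) (i j : Fin 3) : pd i (pd j g) = pd j (pd i g) := by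
  have hd : Differentiable ℝ (fderiv ℝ g) :=
    (hg.fderiv_right (m := 1) (by norm_num)).differentiable (by norm_num)
  have e : ∀ (i j : Fin 3) (x : Pt), pd i (pd j g) x =
      fderiv ℝ (fderiv ℝ g) x (EuclideanSpace.single i 1) (EuclideanSpace.single j 1) := by
    intro i j x
    change fderiv ℝ (fun y => fderiv ℝ g y (EuclideanSpace.single j 1)) x _ = _
    rw [fderiv_clm_apply (hd x) (differentiableAt_const _)]
    simp
  ext x
  rw [e, e]
  exact (hg.contDiffAt.isSymmSndFDerivAt (by simp)).eq _ _

lemma pd_add_period {v : Pt} (hg : ∀ x, g (x + v) = g x) (j : Fin 3) (x : Pt) :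
    pd j g (x + v) = pd j g x := by
  unfold pd
  rw [← fderiv_comp_add_right]
  simp only [hg]

lemma Om3_add_period {δ : ℝ} (hg : ∀ x, g (x + δ • e3) = g x) (x : Pt) :
    Om3 g (x + δ • e3) = Om3 g x := by
  unfold Om3
  rw [pd_add_period hg, pd_add_period hg]
  simp [e3]

lemma sq_radial_le_sq_gradv (ρ θ z : ℝ) :
    (Real.cos θ * pd 0 g (cyl ρ θ z) + Real.sin θ * pd 1 g (cyl ρ θ z)) ^ 2 ≤
      gradv g (cyl ρ θ z) ^ 2 := by
  unfold gradv
  rw [Real.sq_sqrt (by positivity)]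
  have h := Real.cos_sq_add_sin_sq θ
  nlinarith [sq_nonneg (Real.cos θ * pd 1 g (cyl ρ θ z) - Real.sin θ * pd 0 g (cyl ρ θ z))]

end Derivatives

/-- Integration over the slab in cylindrical coordinates. -/
lemma lintegral_slab_eq (δ : ℝ) {Q : Pt → ℝ≥0∞} (hQ : Measurable Q) :
    ∫⁻ y in slab δ, Q y = ∫⁻ θ in Set.Ioo (-Real.pi) Real.pi, ∫⁻ z in Set.Ico 0 δ,
      ∫⁻ ρ in Set.Ioi 0, ENNReal.ofReal ρ * Q (cyl ρ θ z) := by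
  have hE : MeasurePreserving (fun y : Pt => (y 2, (y 0, y 1))) volume volume := by
    have h1 := volume_preserving_piFinSuccAbove (fun _ : Fin 3 => ℝ) 2
    have h2 := (MeasurePreserving.id (volume : Measure ℝ)).prod (volume_preserving_finTwoArrow ℝ)
    exact h2.comp (h1.comp (PiLp.volume_preserving_ofLp (Fin 3)))
  have hc : Continuous fun p : ℝ × ℝ × ℝ => (!₂[p.2.1, p.2.2, p.1] : Pt) := by fun_prop
  have hQc : Measurable fun p : ℝ × ℝ × ℝ => Q !₂[p.2.1, p.2.2, p.1] := hQ.comp hc.measurable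
  have h1 := hE.setLIntegral_comp_preimage
    (measurableSet_Ico.prod MeasurableSet.univ : MeasurableSet (Set.Ico 0 δ ×ˢ Set.univ)) hQc
  have e1 : (fun y : Pt => (y 2, (y 0, y 1))) ⁻¹' (Set.Ico 0 δ ×ˢ Set.univ) = slab δ := by
    ext y
    simp [slab]
  have e2 : ∀ y : Pt, (!₂[y 0, y 1, y 2] : Pt) = y := fun y => by
    ext i
    fin_cases i <;> simp
  rw [e1] at h1
  simp only [e2] at h1
  rw [h1, Measure.volume_eq_prod, ← Measure.prod_restrict, Measure.restrict_univ,
    lintegral_prod _ hQc.aemeasurable]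
  have h2 : ∀ z : ℝ, ∫⁻ q : ℝ × ℝ, Q !₂[q.1, q.2, z] =
      ∫⁻ θ in Set.Ioo (-Real.pi) Real.pi, ∫⁻ ρ in Set.Ioi 0, ENNReal.ofReal ρ * Q (cyl ρ θ z) := by
    intro z
    rw [← lintegral_comp_polarCoord_symm, polarCoord_target, Measure.volume_eq_prod,
      ← Measure.prod_restrict, lintegral_prod_symm]
    · simp only [polarCoord_symm_apply, smul_eq_mul, cyl]
    · refine Measurable.aemeasurable ?_
      have : Continuous fun p : ℝ × ℝ => cyl p.1 p.2 z := by fun_prop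
      exact (measurable_fst.ennreal_ofReal).mul (hQ.comp this.measurable)
  simp only [h2]
  refine lintegral_lintegral_swap (Measurable.aemeasurable ?_)
  have : Continuous fun p : (ℝ × ℝ) × ℝ => cyl p.2 p.1.2 p.1.1 := by fun_prop
  have h3 : Measurable fun p : (ℝ × ℝ) × ℝ => ENNReal.ofReal p.2 * Q (cyl p.2 p.1.2 p.1.1) :=
    (measurable_snd.ennreal_ofReal).mul (hQ.comp this.measurable)
  exact h3.lintegral_prod_right'

lemma lintegral_slab_sq (δ : ℝ) (h : Pt → ℝ) :
    ∫⁻ y in slab δ, ENNReal.ofReal (h y ^ 2) = L2 δ h ^ 2 := by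
  have := eLpNorm_nnreal_pow_eq_lintegral (f := h) (μ := volume.restrict (slab δ)) (p := 2)
    two_ne_zero
  simp only [NNReal.coe_ofNat, ENNReal.rpow_ofNat, ENNReal.coe_ofNat] at this
  rw [L2, this]
  refine lintegral_congr fun y => ?_
  rw [Real.enorm_eq_ofReal_abs, ← ENNReal.ofReal_pow (abs_nonneg _), sq_abs]

/-- Pointwise density of the squared right-hand side of the weighted Sobolev inequality. -/
def density (δ t : ℝ) (g : Pt → ℝ) (y : Pt) : ℝ≥0∞ :=
  ENNReal.ofReal δ⁻¹ * (ENNReal.ofReal (g y ^ 2) + ENNReal.ofReal (wt t (gradv g) y ^ 2)) +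
    ENNReal.ofReal δ * (ENNReal.ofReal (pd 2 g y ^ 2) +
      ENNReal.ofReal (wt t (gradv (pd 2 g)) y ^ 2))

/-- Integral of `density` over the slab. -/
def energy (δ t : ℝ) (g : Pt → ℝ) : ℝ≥0∞ :=
  ENNReal.ofReal δ⁻¹ * (L2 δ g ^ 2 + L2 δ (wt t (gradv g)) ^ 2) +
    ENNReal.ofReal δ * (L2 δ (pd 2 g) ^ 2 + L2 δ (wt t (gradv (pd 2 g))) ^ 2)

lemma measurable_wt_gradv {g : Pt → ℝ} (hg : ContDiff ℝ 1 g) (t : ℝ) :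
    Measurable (wt t (gradv g)) := by
  have h0 := (contDiff_pd (n := 1) (m := 0) hg (by norm_num) 0).continuous
  have h1 := (contDiff_pd (n := 1) (m := 0) hg (by norm_num) 1).continuous
  refine Continuous.measurable ?_
  unfold wt gradv
  fun_prop

lemma measurable_density {g : Pt → ℝ} (hg : ContDiff ℝ 2 g) (δ t : ℝ) : Measurable (density δ t g) := by
  have h1 := measurable_wt_gradv (hg.of_le (by norm_num)) t
  have h2 : ContDiff ℝ 1 (pd 2 g) := contDiff_pd (n := 2) (m := 1) hg (by norm_num) 2
  have h3 := measurable_wt_gradv h2 t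
  have h4 := hg.continuous.measurable
  have h5 := h2.continuous.measurable
  unfold density
  fun_prop

lemma lintegral_density {g : Pt → ℝ} (hg : ContDiff ℝ 2 g) (δ t : ℝ) :
    ∫⁻ y in slab δ, density δ t g y = energy δ t g := by
  have h2 : ContDiff ℝ 1 (pd 2 g) := contDiff_pd (n := 2) (m := 1) hg (by norm_num) 2
  have h3 := measurable_wt_gradv (hg.of_le (by norm_num)) t
  have h4 := hg.continuous.measurable
  have h5 := h2.continuous.measurable
  unfold density energy
  rw [lintegral_add_left (by fun_prop), lintegral_const_mul' _ _ ENNReal.ofReal_ne_top,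
    lintegral_const_mul' _ _ ENNReal.ofReal_ne_top, lintegral_add_left (by fun_prop),
    lintegral_add_left (by fun_prop)]
  simp only [lintegral_slab_sq]

lemma ofReal_le_lintegral_radial_cyl {g : Pt → ℝ} (hg : ContDiff ℝ 1 g) (t θ z : ℝ) {ρ₀ : ℝ}
    (h₀ : 0 < ρ₀) :
    ENNReal.ofReal (ρ₀ * (|t - √(ρ₀ ^ 2 + z ^ 2)| * g (cyl ρ₀ θ z) ^ 2)) ≤
      ∫⁻ ρ in Set.Ioi 0, 4 * (ENNReal.ofReal ρ * (ENNReal.ofReal (g (cyl ρ θ z) ^ 2) +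
        ENNReal.ofReal (wt t (gradv g) (cyl ρ θ z) ^ 2))) := by
  have c0 := (contDiff_pd (n := 1) (m := 0) hg (by norm_num) 0).continuous
  have c1 := (contDiff_pd (n := 1) (m := 0) hg (by norm_num) 1).continuous
  refine (ofReal_le_lintegral_radial
    (fun ρ => hasDerivAt_cyl_radius (hg.differentiable (by norm_num)) ρ θ z)
    (by fun_prop) t z h₀).trans ?_
  refine setLIntegral_mono' measurableSet_Ioi fun ρ hρ => ?_
  have hρ : 0 < ρ := hρ
  rw [← ENNReal.ofReal_add (by positivity) (by positivity), ← ENNReal.ofReal_mul hρ.le,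
    ← ENNReal.ofReal_ofNat, ← ENNReal.ofReal_mul (by norm_num)]
  refine ENNReal.ofReal_le_ofReal ?_
  rw [wt, norm_cyl, mul_pow]
  have := sq_radial_le_sq_gradv (g := g) ρ θ z
  exact mul_le_mul_of_nonneg_left (mul_le_mul_of_nonneg_left (add_le_add le_rfl
    (mul_le_mul_of_nonneg_left this (sq_nonneg _))) hρ.le) (by norm_num)

lemma ofReal_le_lintegral_half_plane {δ : ℝ} (hδ : 0 < δ) (t : ℝ) {g : Pt → ℝ}
    (hg : ContDiff ℝ 2 g) (hper : ∀ x, g (x + δ • e3) = g x) {ρ₀ z₀ : ℝ} (h₀ : 0 < ρ₀)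
    (hz : z₀ ∈ Set.Ico 0 δ) (θ : ℝ) :
    ENNReal.ofReal (ρ₀ * (|t - √(ρ₀ ^ 2 + z₀ ^ 2)| * g (cyl ρ₀ θ z₀) ^ 2)) ≤
      ∫⁻ z in Set.Ico 0 δ, ∫⁻ ρ in Set.Ioi 0,
        768 * (ENNReal.ofReal ρ * density δ t g (cyl ρ θ z)) := by
  have hg1 : ContDiff ℝ 1 g := hg.of_le (by norm_num)
  have hp : ContDiff ℝ 1 (pd 2 g) := contDiff_pd (n := 2) (m := 1) hg (by norm_num) 2
  have cp := hp.continuous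
  have cg := hg.continuous
  refine (ofReal_le_lintegral_vertical h₀ hδ t hz
    (fun z => hasDerivAt_cyl_height (hg.differentiable (by norm_num)) ρ₀ θ z)
    (by fun_prop) (fun z => by rw [cyl_add_period, hper])
    (fun z => by rw [cyl_add_period, pd_add_period hper])).trans ?_
  refine lintegral_mono fun z => ?_
  have r1 := ofReal_le_lintegral_radial_cyl hg1 t θ z h₀
  have r2 := ofReal_le_lintegral_radial_cyl hp t θ z h₀
  have m1 := measurable_wt_gradv hg1 t
  rw [ENNReal.ofReal_mul (by norm_num), ENNReal.ofReal_add (by positivity) (by positivity),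
    ENNReal.ofReal_mul (by positivity), ENNReal.ofReal_mul hδ.le, ENNReal.ofReal_ofNat]
  refine (mul_le_mul' le_rfl (add_le_add (mul_le_mul' le_rfl r1)
    (mul_le_mul' le_rfl r2))).trans (le_of_eq ?_)
  have hc : Measurable fun ρ => cyl ρ θ z :=
    Continuous.measurable (by fun_prop : Continuous fun ρ => cyl ρ θ z)
  have m2 : Measurable fun ρ => wt t (gradv g) (cyl ρ θ z) := m1.comp hc
  have m3 : Measurable fun ρ => g (cyl ρ θ z) := cg.measurable.comp hc
  rw [← lintegral_const_mul' _ _ ENNReal.ofReal_ne_top,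
    ← lintegral_const_mul' _ _ ENNReal.ofReal_ne_top, ← lintegral_add_left (by fun_prop),
    ← lintegral_const_mul' _ _ (by norm_num)]
  refine lintegral_congr fun ρ => ?_
  unfold density
  ring

lemma ofReal_le_energy {δ : ℝ} (hδ : 0 < δ) (t : ℝ) {f : Pt → ℝ}
    (hf : ContDiff ℝ 3 f) (hper : ∀ x, f (x + δ • e3) = f x) {x : Pt} (hx : x ∈ slab δ)
    (h₀ : 0 < √((x 0) ^ 2 + (x 1) ^ 2)) :
    ENNReal.ofReal (√((x 0) ^ 2 + (x 1) ^ 2) * (|t - ‖x‖| * f x ^ 2)) ≤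
      6144 * (energy δ t f + energy δ t (Om3 f)) := by
  obtain ⟨θ₀, hθ₀, hcyl⟩ := exists_cyl_eq x
  generalize √((x 0) ^ 2 + (x 1) ^ 2) = ρ₀ at *
  have hz : x 2 ∈ Set.Ico 0 δ := hx
  generalize x 2 = z₀ at *
  subst hcyl
  rw [norm_cyl]
  have hf2 : ContDiff ℝ 2 f := hf.of_le (by norm_num)
  have hO : ContDiff ℝ 2 (Om3 f) := contDiff_Om3 (n := 3) (m := 2) hf (by norm_num)
  have cO := hO.continuous
  set k := ρ₀ * |t - √(ρ₀ ^ 2 + z₀ ^ 2)| with hk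
  have hk0 : 0 ≤ k := by positivity
  have h1 := ofReal_sq_le_lintegral_angle
    (fun θ => hasDerivAt_cyl_angle (hf.differentiable (by norm_num)) ρ₀ θ z₀)
    (by fun_prop) hθ₀
  have h2 : ∀ θ, ENNReal.ofReal k *
      ENNReal.ofReal (8 * (f (cyl ρ₀ θ z₀) ^ 2 + Om3 f (cyl ρ₀ θ z₀) ^ 2)) ≤
      ∫⁻ z in Set.Ico 0 δ, ∫⁻ ρ in Set.Ioi 0, ENNReal.ofReal ρ *
        (6144 * (density δ t f (cyl ρ θ z) + density δ t (Om3 f) (cyl ρ θ z))) := by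
    intro θ
    have r1 := ofReal_le_lintegral_half_plane hδ t hf2 hper h₀ hz θ
    have r2 := ofReal_le_lintegral_half_plane hδ t hO (Om3_add_period hper) h₀ hz θ
    have hc : Measurable fun p : ℝ × ℝ => cyl p.2 θ p.1 :=
      Continuous.measurable (by fun_prop : Continuous fun p : ℝ × ℝ => cyl p.2 θ p.1)
    have m1 : Measurable fun p : ℝ × ℝ => 768 * (ENNReal.ofReal p.2 *
        density δ t f (cyl p.2 θ p.1)) :=
      ((measurable_snd.ennreal_ofReal).mul ((measurable_density hf2 δ t).comp hc)).const_mul _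
    have m2 : Measurable fun z : ℝ => ∫⁻ ρ in Set.Ioi 0, 768 * (ENNReal.ofReal ρ *
        density δ t f (cyl ρ θ z)) := m1.lintegral_prod_right
    have m3 : ∀ z : ℝ, Measurable fun ρ => 768 * (ENNReal.ofReal ρ *
        density δ t f (cyl ρ θ z)) := fun z => m1.comp measurable_prodMk_left
    have e : k * (8 * (f (cyl ρ₀ θ z₀) ^ 2 + Om3 f (cyl ρ₀ θ z₀) ^ 2)) =
        8 * (ρ₀ * (|t - √(ρ₀ ^ 2 + z₀ ^ 2)| * f (cyl ρ₀ θ z₀) ^ 2) +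
          ρ₀ * (|t - √(ρ₀ ^ 2 + z₀ ^ 2)| * Om3 f (cyl ρ₀ θ z₀) ^ 2)) := by
      rw [hk]
      ring
    rw [← ENNReal.ofReal_mul hk0, e, ENNReal.ofReal_mul (by norm_num),
      ENNReal.ofReal_add (by positivity) (by positivity), ENNReal.ofReal_ofNat]
    refine (mul_le_mul' le_rfl (add_le_add r1 r2)).trans (le_of_eq ?_)
    rw [← lintegral_add_left m2, ← lintegral_const_mul' _ _ (by norm_num)]
    refine lintegral_congr fun z => ?_
    rw [← lintegral_add_left (m3 z), ← lintegral_const_mul' _ _ (by norm_num)]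
    refine lintegral_congr fun ρ => ?_
    ring
  calc ENNReal.ofReal (ρ₀ * (|t - √(ρ₀ ^ 2 + z₀ ^ 2)| * f (cyl ρ₀ θ₀ z₀) ^ 2))
      = ENNReal.ofReal k * ENNReal.ofReal (f (cyl ρ₀ θ₀ z₀) ^ 2) := by
        rw [← ENNReal.ofReal_mul hk0, hk, mul_assoc]
    _ ≤ _ := mul_le_mul_right h1 _
    _ = _ := (lintegral_const_mul' _ _ ENNReal.ofReal_ne_top).symm
    _ ≤ _ := lintegral_mono h2
    _ = ∫⁻ y in slab δ, 6144 * (density δ t f y + density δ t (Om3 f) y) :=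
        (lintegral_slab_eq δ (((measurable_density hf2 δ t).add
          (measurable_density hO δ t)).const_mul _)).symm
    _ = _ := by
        rw [lintegral_const_mul' _ _ (by norm_num), lintegral_add_left (measurable_density hf2 δ t),
          lintegral_density hf2, lintegral_density hO]

theorem weighted_sobolev_KS4 :
    ∃ C : ℝ, 0 < C ∧
      ∀ (δ : ℝ), 0 < δ → δ ≤ 1 →
      ∀ (t : ℝ),
      ∀ f : Pt → ℝ, ContDiff ℝ 3 f → (∀ x, f (x + δ • e3) = f x) →
      ∀ x : Pt, x ∈ slab δ →
        ENNReal.ofReal (Real.sqrt (Real.sqrt ((x 0)^2 + (x 1)^2))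
            * Real.sqrt |t - ‖x‖| * |f x|) ≤
          ENNReal.ofReal C *
            (ENNReal.ofReal (δ ^ (-(1:ℝ)/2)) *
                (∑ a ∈ Finset.range 2,
                  (L2 δ (wt t (gradv (Om3^[a] f))) + L2 δ (Om3^[a] f)))
              + ENNReal.ofReal (δ ^ ((1:ℝ)/2)) *
                (∑ a ∈ Finset.range 2,
                  (L2 δ (wt t (fun y => Real.sqrt ((pd 2 (pd 0 (Om3^[a] f)) y)^2
                                                   + (pd 2 (pd 1 (Om3^[a] f)) y)^2)))
                    + L2 δ (pd 2 (Om3^[a] f))))) := by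
  refine ⟨80, by norm_num, fun δ hδ _ t f hf hper x hx => ?_⟩
  have hρ := Real.sqrt_nonneg ((x 0) ^ 2 + (x 1) ^ 2)
  rcases hρ.eq_or_lt with h₀ | h₀
  · simp [← h₀]
  have hO : ContDiff ℝ 2 (Om3 f) := contDiff_Om3 (n := 3) (m := 2) hf (by norm_num)
  have hsymm : ∀ g : Pt → ℝ, ContDiff ℝ 2 g →
      (fun y => √((pd 2 (pd 0 g) y) ^ 2 + (pd 2 (pd 1 g) y) ^ 2)) = gradv (pd 2 g) := by
    intro g hg
    unfold gradv
    rw [pd_comm hg 2 0, pd_comm hg 2 1]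
  have hmain := ofReal_le_energy hδ t hf hper hx h₀
  have hδ₁ : ENNReal.ofReal δ⁻¹ = ENNReal.ofReal (δ ^ (-(1 : ℝ) / 2)) ^ 2 := by
    rw [← ENNReal.ofReal_pow (by positivity), ← Real.rpow_natCast, ← Real.rpow_mul hδ.le]
    norm_num [Real.rpow_neg_one]
  have hδ₂ : ENNReal.ofReal δ = ENNReal.ofReal (δ ^ ((1 : ℝ) / 2)) ^ 2 := by
    rw [← ENNReal.ofReal_pow (by positivity), ← Real.rpow_natCast, ← Real.rpow_mul hδ.le]
    norm_num
  have hsq : ENNReal.ofReal (√√((x 0) ^ 2 + (x 1) ^ 2) * √|t - ‖x‖| * |f x|) ^ 2 =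
      ENNReal.ofReal (√((x 0) ^ 2 + (x 1) ^ 2) * (|t - ‖x‖| * f x ^ 2)) := by
    rw [← ENNReal.ofReal_pow (by positivity), mul_pow, mul_pow, Real.sq_sqrt hρ,
      Real.sq_sqrt (abs_nonneg _), sq_abs, mul_assoc]
  simp only [Finset.sum_range_succ, Finset.sum_range_zero, zero_add, Function.iterate_zero, id_eq,
    Function.iterate_one, hsymm f (hf.of_le (by norm_num)), hsymm _ hO, ENNReal.ofReal_ofNat]
  rw [← ENNReal.pow_le_pow_left_iff two_ne_zero, hsq]
  refine hmain.trans ?_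
  unfold energy
  rw [hδ₁, hδ₂]
  generalize ENNReal.ofReal (δ ^ (-(1 : ℝ) / 2)) = p
  generalize ENNReal.ofReal (δ ^ ((1 : ℝ) / 2)) = q
  generalize L2 δ f = a₁
  generalize L2 δ (wt t (gradv f)) = a₂
  generalize L2 δ (pd 2 f) = a₃
  generalize L2 δ (wt t (gradv (pd 2 f))) = a₄
  generalize L2 δ (Om3 f) = b₁
  generalize L2 δ (wt t (gradv (Om3 f))) = b₂
  generalize L2 δ (pd 2 (Om3 f)) = b₃
  generalize L2 δ (wt t (gradv (pd 2 (Om3 f)))) = b₄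
  have hadd : ∀ u v : ℝ≥0∞, u ^ 2 + v ^ 2 ≤ (u + v) ^ 2 := fun u v => by
    rw [add_sq, add_right_comm]
    exact le_self_add
  calc _ = 6144 * (p ^ 2 * ((a₂ ^ 2 + a₁ ^ 2) + (b₂ ^ 2 + b₁ ^ 2)) +
        q ^ 2 * ((a₄ ^ 2 + a₃ ^ 2) + (b₄ ^ 2 + b₃ ^ 2))) := by ring
    _ ≤ 80 ^ 2 * (p ^ 2 * ((a₂ + a₁) + (b₂ + b₁)) ^ 2 +
        q ^ 2 * ((a₄ + a₃) + (b₄ + b₃)) ^ 2) := by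
      refine mul_le_mul' (by norm_num) (add_le_add (mul_le_mul' le_rfl ?_)
        (mul_le_mul' le_rfl ?_))
      · exact (add_le_add (hadd _ _) (hadd _ _)).trans (hadd _ _)
      · exact (add_le_add (hadd _ _) (hadd _ _)).trans (hadd _ _)
    _ ≤ _ := by
      rw [mul_pow, ← mul_pow p, ← mul_pow q]
      exact mul_le_mul' le_rfl (hadd _ _)

end Stmt5
end
end

section
/- There is an absolute constant C > 0 such that for every 0 < δ ≤ 1, every t > 0 and every f ∈ H³(Ω_δ): t ‖f‖_{L^∞({y ∈ Ω_δ : r ≤ t/2})} ≤ C [ δ^{−1/2} Σ_{|a|≤2} ‖(t−r) ∂_v^a f‖_{L²(Ω_δ)} + δ^{1/2} Σ_{|a|≤2} ‖(t−r) ∂₃ ∂_v^a f‖_{L²(Ω_δ)} ], where a ∈ ℕ² ranges over horizontal multi-indices, provided the right-hand side is finite; C is independent of δ, t, f. -/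
/-!
STATEMENT 6: Interior decay estimate (K-S-3):
t ‖f‖_{L∞({r ≤ t/2})} ≤ C [ δ^{-1/2} Σ_{|a|≤2} ‖(t−r)∂_v^a f‖_{L²(Ω_δ)}
                          + δ^{1/2} Σ_{|a|≤2} ‖(t−r)∂₃∂_v^a f‖_{L²(Ω_δ)} ].
-/

noncomputable section
open MeasureTheory
open scoped ENNReal

namespace Stmt6

abbrev Pt : Type := EuclideanSpace ℝ (Fin 3)

def e3 : Pt := EuclideanSpace.single 2 1

def slab (δ : ℝ) : Set Pt := {x : Pt | x 2 ∈ Set.Ico 0 δ}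

def pd (j : Fin 3) (f : Pt → ℝ) : Pt → ℝ :=
  fun x => fderiv ℝ f x (EuclideanSpace.single j 1)

def L2 (δ : ℝ) (f : Pt → ℝ) : ℝ≥0∞ := eLpNorm f 2 (volume.restrict (slab δ))

/-- Horizontal derivatives ∂_v^a = ∂₁^{a₁} ∂₂^{a₂} for a ∈ ℕ². -/
def pdv (a : Fin 2 → ℕ) (f : Pt → ℝ) : Pt → ℝ := (pd 0)^[a 0] ((pd 1)^[a 1] f)

/-- Horizontal multi-indices a ∈ ℕ² with |a| ≤ n. -/
def idx2 (n : ℕ) : Finset (Fin 2 → ℕ) :=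
  (Fintype.piFinset fun _ => Finset.range (n+1)).filter fun a => ∑ i, a i ≤ n

/-- Multiplication by the weight y ↦ t − |y|. -/
def wt (t : ℝ) (f : Pt → ℝ) : Pt → ℝ := fun x => (t - ‖x‖) * f x

theorem ennreal_add_sq_le (a b : ℝ≥0∞) : (a + b) ^ 2 ≤ 2 * (a ^ 2 + b ^ 2) := by
  have h := ENNReal.rpow_add_le_mul_rpow_add_rpow a b (p := 2) (by norm_num)
  norm_num at h
  simpa using h

theorem sq_lintegral_le {α : Type*} [MeasurableSpace α] (μ : Measure α) {g : α → ℝ≥0∞}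
    (hg : AEMeasurable g μ) : (∫⁻ a, g a ∂μ) ^ 2 ≤ μ Set.univ * ∫⁻ a, g a ^ 2 ∂μ := by
  have h := ENNReal.lintegral_mul_le_Lp_mul_Lq μ Real.HolderConjugate.two_two
    (aemeasurable_const (b := (1 : ℝ≥0∞))) hg
  simp only [Pi.mul_apply, one_mul, lintegral_const, ENNReal.rpow_two] at h
  calc _ ≤ _ := pow_le_pow_left' h 2
    _ = _ := by
      have hsqrt (x : ℝ≥0∞) : (x ^ (1 / 2 : ℝ)) ^ 2 = x := by
        rw [← ENNReal.rpow_natCast, ← ENNReal.rpow_mul]; norm_num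
      rw [mul_pow, hsqrt, hsqrt, one_pow, one_mul]

theorem enorm_intervalIntegral_le (g : ℝ → ℝ) {p q x y : ℝ} (hx : x ∈ Set.Icc p q)
    (hy : y ∈ Set.Icc p q) : ‖∫ σ in x..y, g σ‖ₑ ≤ ∫⁻ σ in Set.Icc p q, ‖g σ‖ₑ := by
  have h : ‖∫ σ in x..y, g σ‖ₑ = ‖∫ σ in Set.uIoc x y, g σ‖ₑ := by
    rw [← ofReal_norm, ← ofReal_norm,
      intervalIntegral.norm_intervalIntegral_eq]
  rw [h]
  refine (enorm_integral_le_lintegral_enorm _).trans (lintegral_mono_set ?_)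
  exact Set.uIoc_subset_uIcc.trans (Set.uIcc_subset_Icc hx hy)

theorem enorm_le_add_lintegral_deriv {u u' : ℝ → ℝ} (hu : ∀ s, HasDerivAt u (u' s) s)
    (hc : Continuous u') {p q x y : ℝ} (hx : x ∈ Set.Icc p q) (hy : y ∈ Set.Icc p q) :
    ‖u x‖ₑ ≤ ‖u y‖ₑ + ∫⁻ σ in Set.Icc p q, ‖u' σ‖ₑ := by
  have h := intervalIntegral.integral_eq_sub_of_hasDerivAt (a := y) (b := x)
    (fun s _ => hu s) (hc.intervalIntegrable _ _)
  have h2 : u x = u y + ∫ σ in y..x, u' σ := by rw [h]; ring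
  rw [h2]
  exact (enorm_add_le _ _).trans (add_le_add le_rfl (enorm_intervalIntegral_le u' hy hx))

theorem mul_sq_enorm_le {u u' : ℝ → ℝ} (hu : ∀ s, HasDerivAt u (u' s) s)
    (hc : Continuous u') {p l s : ℝ} (hs : s ∈ Set.Icc p (p + l)) :
    ENNReal.ofReal l * ‖u s‖ₑ ^ 2 ≤ 2 * ((∫⁻ σ in Set.Icc p (p + l), ‖u σ‖ₑ ^ 2)
      + ENNReal.ofReal l ^ 2 * ∫⁻ σ in Set.Icc p (p + l), ‖u' σ‖ₑ ^ 2) := by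
  have hcu : Continuous u := continuous_iff_continuousAt.2 fun s => (hu s).continuousAt
  have hvol : (volume.restrict (Set.Icc p (p + l))) Set.univ = ENNReal.ofReal l := by simp
  have key : ∀ y ∈ Set.Icc p (p + l), ‖u s‖ₑ ^ 2 ≤ 2 * (‖u y‖ₑ ^ 2
      + ENNReal.ofReal l * ∫⁻ σ in Set.Icc p (p + l), ‖u' σ‖ₑ ^ 2) := by
    intro y hy
    refine (pow_le_pow_left' (enorm_le_add_lintegral_deriv hu hc hs hy) 2).trans ?_
    refine (ennreal_add_sq_le _ _).trans ?_
    gcongr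
    refine (sq_lintegral_le _ (by fun_prop)).trans ?_
    rw [hvol]
  calc ENNReal.ofReal l * ‖u s‖ₑ ^ 2 = ∫⁻ y in Set.Icc p (p + l), ‖u s‖ₑ ^ 2 := by
        rw [lintegral_const, hvol, mul_comm]
    _ ≤ ∫⁻ y in Set.Icc p (p + l), 2 * (‖u y‖ₑ ^ 2
      + ENNReal.ofReal l * ∫⁻ σ in Set.Icc p (p + l), ‖u' σ‖ₑ ^ 2) :=
        setLIntegral_mono' measurableSet_Icc key
    _ = _ := by
        rw [lintegral_const_mul _ (by fun_prop), lintegral_add_left (by fun_prop),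
          lintegral_const, hvol]
        ring

theorem lintegral_sq_deriv_le {u u' u'' : ℝ → ℝ} (hu : ∀ s, HasDerivAt u (u' s) s)
    (hu' : ∀ s, HasDerivAt u' (u'' s) s) (hc : Continuous u'') {p l : ℝ} (hl : 0 < l) :
    ENNReal.ofReal l ^ 2 * (∫⁻ σ in Set.Icc p (p + 2 * l), ‖u' σ‖ₑ ^ 2) ≤
      32 * ((∫⁻ σ in Set.Icc p (p + 2 * l), ‖u σ‖ₑ ^ 2)
      + ENNReal.ofReal l ^ 4 * ∫⁻ σ in Set.Icc p (p + 2 * l), ‖u'' σ‖ₑ ^ 2) := by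
  have hcu : Continuous u := continuous_iff_continuousAt.2 fun s => (hu s).continuousAt
  have hcu' : Continuous u' := continuous_iff_continuousAt.2 fun s => (hu' s).continuousAt
  set I := Set.Icc p (p + 2 * l) with hI
  set e := ENNReal.ofReal l with he
  have he0 : e ≠ 0 := by simpa [he] using hl
  have heT : e ≠ ∞ := ENNReal.ofReal_ne_top
  have hvol : (volume.restrict I) Set.univ = 2 * e := by
    simp only [hI, Measure.restrict_apply_univ, Real.volume_Icc, he]
    rw [← ENNReal.ofReal_ofNat, ← ENNReal.ofReal_mul (by norm_num)]
    congr 1; ring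
  have hvol1 : (volume.restrict (Set.Icc p (p + l))) Set.univ = e := by simp [he]
  have pt : ∀ s ∈ I, ∀ y ∈ Set.Icc p (p + l), e * ‖u' s‖ₑ ≤
      ‖u y‖ₑ + ‖u (y + l)‖ₑ + e * ∫⁻ σ in I, ‖u'' σ‖ₑ := by
    intro s hs y hy
    obtain ⟨τ, hτ, hτ'⟩ := exists_hasDerivAt_eq_slope u u' (show y < y + l by linarith)
      hcu.continuousOn (fun x _ => hu x)
    have hτI : τ ∈ I := ⟨by linarith [hτ.1, hy.1], by linarith [hτ.2, hy.2]⟩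
    have h1 : e * ‖u' τ‖ₑ ≤ ‖u y‖ₑ + ‖u (y + l)‖ₑ := by
      have h2 : l * u' τ = u (y + l) - u y := by rw [hτ', add_sub_cancel_left, mul_div_cancel₀ _ hl.ne']
      have h3 : e = ‖l‖ₑ := by rw [he, Real.enorm_eq_ofReal hl.le]
      rw [h3, ← enorm_mul, h2, add_comm ‖u y‖ₑ]
      exact enorm_sub_le
    calc e * ‖u' s‖ₑ ≤ e * (‖u' τ‖ₑ + ∫⁻ σ in I, ‖u'' σ‖ₑ) := by
          gcongr; exact enorm_le_add_lintegral_deriv hu' hc hs hτI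
      _ ≤ _ := by rw [mul_add]; gcongr
  have pt2 : ∀ s ∈ I, e ^ 2 * ‖u' s‖ₑ ≤ 2 * (∫⁻ σ in I, ‖u σ‖ₑ) + e ^ 2 * ∫⁻ σ in I, ‖u'' σ‖ₑ := by
    intro s hs
    have h1 : ∫⁻ y in Set.Icc p (p + l), ‖u y‖ₑ ≤ ∫⁻ σ in I, ‖u σ‖ₑ :=
      lintegral_mono_set (Set.Icc_subset_Icc le_rfl (by linarith))
    have h2 : ∫⁻ y in Set.Icc p (p + l), ‖u (y + l)‖ₑ ≤ ∫⁻ σ in I, ‖u σ‖ₑ := by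
      have := (measurePreserving_add_right (volume : Measure ℝ) l).setLIntegral_comp_preimage_emb
        (measurableEmbedding_addRight l) (fun σ => ‖u σ‖ₑ) (Set.Icc (p + l) (p + l + l))
      rw [Set.preimage_add_const_Icc, add_sub_cancel_right, add_sub_cancel_right] at this
      rw [this]
      exact lintegral_mono_set (Set.Icc_subset_Icc (by linarith) (by linarith))
    calc e ^ 2 * ‖u' s‖ₑ = ∫⁻ y in Set.Icc p (p + l), e * ‖u' s‖ₑ := by
          rw [lintegral_const, hvol1]; ring
      _ ≤ ∫⁻ y in Set.Icc p (p + l), (‖u y‖ₑ + ‖u (y + l)‖ₑ + e * ∫⁻ σ in I, ‖u'' σ‖ₑ) :=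
          setLIntegral_mono' measurableSet_Icc (pt s hs)
      _ = (∫⁻ y in Set.Icc p (p + l), ‖u y‖ₑ) + (∫⁻ y in Set.Icc p (p + l), ‖u (y + l)‖ₑ)
            + e ^ 2 * ∫⁻ σ in I, ‖u'' σ‖ₑ := by
          rw [lintegral_add_left (by fun_prop), lintegral_add_left (by fun_prop),
            lintegral_const, hvol1]
          ring
      _ ≤ _ := by rw [two_mul]; gcongr
  have pt3 : ∀ s ∈ I, e ^ 4 * ‖u' s‖ₑ ^ 2 ≤
      2 * (4 * (2 * e * ∫⁻ σ in I, ‖u σ‖ₑ ^ 2) + e ^ 4 * (2 * e * ∫⁻ σ in I, ‖u'' σ‖ₑ ^ 2)) := by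
    intro s hs
    have h1 := sq_lintegral_le (volume.restrict I) (g := fun σ => ‖u σ‖ₑ) (by fun_prop)
    have h2 := sq_lintegral_le (volume.restrict I) (g := fun σ => ‖u'' σ‖ₑ) (by fun_prop)
    rw [hvol] at h1 h2
    calc e ^ 4 * ‖u' s‖ₑ ^ 2 = (e ^ 2 * ‖u' s‖ₑ) ^ 2 := by ring
      _ ≤ _ := pow_le_pow_left' (pt2 s hs) 2
      _ ≤ _ := ennreal_add_sq_le _ _
      _ = 2 * (4 * (∫⁻ σ in I, ‖u σ‖ₑ) ^ 2 + e ^ 4 * (∫⁻ σ in I, ‖u'' σ‖ₑ) ^ 2) := by ring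
      _ ≤ _ := by gcongr
  have h4 : e ^ 2 * (e ^ 2 * (∫⁻ σ in I, ‖u' σ‖ₑ ^ 2)) ≤ e ^ 2 * (8 * (4 * (∫⁻ σ in I, ‖u σ‖ₑ ^ 2)
      + e ^ 4 * ∫⁻ σ in I, ‖u'' σ‖ₑ ^ 2)) := by
    calc e ^ 2 * (e ^ 2 * (∫⁻ σ in I, ‖u' σ‖ₑ ^ 2)) = ∫⁻ σ in I, e ^ 4 * ‖u' σ‖ₑ ^ 2 := by
          rw [lintegral_const_mul _ (by fun_prop)]; ring
      _ ≤ _ := setLIntegral_mono' measurableSet_Icc pt3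
      _ = _ := by rw [lintegral_const, hvol]; ring
  have h5 := (ENNReal.mul_le_mul_iff_right (pow_ne_zero 2 he0) (ENNReal.pow_ne_top heT)).1 h4
  refine h5.trans ?_
  calc _ = 32 * (∫⁻ σ in I, ‖u σ‖ₑ ^ 2) + 8 * (e ^ 4 * ∫⁻ σ in I, ‖u'' σ‖ₑ ^ 2) := by ring
    _ ≤ 32 * (∫⁻ σ in I, ‖u σ‖ₑ ^ 2) + 32 * (e ^ 4 * ∫⁻ σ in I, ‖u'' σ‖ₑ ^ 2) := by
        gcongr; norm_num
    _ = _ := by ring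

theorem enorm_le_lintegral_right {u u' u'' : ℝ → ℝ} (hu : ∀ s, HasDerivAt u (u' s) s)
    (hu' : ∀ s, HasDerivAt u' (u'' s) s) (hc : Continuous u'') (b : ℝ) :
    ‖u b‖ₑ ≤ ∫⁻ σ in Set.Icc b (b + 2),
      (‖(σ - b) * u σ‖ₑ + ‖(σ - b) * u' σ‖ₑ + ‖(σ - b) * u'' σ‖ₑ) := by
  have hcu : Continuous u := continuous_iff_continuousAt.2 fun s => (hu s).continuousAt
  have hcu' : Continuous u' := continuous_iff_continuousAt.2 fun s => (hu' s).continuousAt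
  have pt : ∀ q ∈ Set.Icc (b + 1) (b + 2), ‖u b‖ₑ ≤ (‖(q - b) * u q‖ₑ + ‖(q - b) * u' q‖ₑ)
      + ∫⁻ σ in Set.Icc b (b + 2), ‖(σ - b) * u'' σ‖ₑ := by
    intro q hq
    have hd : ∀ s, HasDerivAt (fun s => (s - b) * u' s - u s) ((s - b) * u'' s) s := by
      intro s
      have := ((((hasDerivAt_id s).sub_const b).mul (hu' s)).sub (hu s))
      refine this.congr_deriv ?_
      simp
    have h := intervalIntegral.integral_eq_sub_of_hasDerivAt (a := b) (b := q)
      (fun s _ => hd s) (Continuous.intervalIntegrable (by fun_prop) _ _)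
    have h2 : u b = u q - (q - b) * u' q + ∫ σ in b..q, (σ - b) * u'' σ := by
      rw [h]; ring
    rw [h2]
    refine (enorm_add_le _ _).trans (add_le_add (enorm_sub_le.trans (add_le_add ?_ le_rfl)) ?_)
    · rw [enorm_mul]
      refine le_mul_of_one_le_left' ?_
      rw [Real.enorm_eq_ofReal (by linarith [hq.1])]
      exact ENNReal.one_le_ofReal.2 (by linarith [hq.1])
    · exact enorm_intervalIntegral_le _ ⟨le_rfl, by linarith⟩ ⟨by linarith [hq.1], hq.2⟩
  have hvol : (volume.restrict (Set.Icc (b + 1) (b + 2))) Set.univ = 1 := by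
    simp; norm_num
  calc ‖u b‖ₑ = ∫⁻ q in Set.Icc (b + 1) (b + 2), ‖u b‖ₑ := by
        rw [lintegral_const, hvol, mul_one]
    _ ≤ ∫⁻ q in Set.Icc (b + 1) (b + 2), ((‖(q - b) * u q‖ₑ + ‖(q - b) * u' q‖ₑ)
      + ∫⁻ σ in Set.Icc b (b + 2), ‖(σ - b) * u'' σ‖ₑ) :=
        setLIntegral_mono' measurableSet_Icc pt
    _ = (∫⁻ q in Set.Icc (b + 1) (b + 2), (‖(q - b) * u q‖ₑ + ‖(q - b) * u' q‖ₑ))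
      + ∫⁻ σ in Set.Icc b (b + 2), ‖(σ - b) * u'' σ‖ₑ := by
        rw [lintegral_add_left (by fun_prop), lintegral_const, hvol, mul_one]
    _ ≤ _ := by
        refine (add_le_add_left (lintegral_mono_set
          (Set.Icc_subset_Icc (show b ≤ b + 1 by linarith) le_rfl)) _).trans ?_
        exact (lintegral_add_left (by fun_prop) _).ge

theorem enorm_le_of_abs_le {u u' u'' : ℝ → ℝ} (hu : ∀ s, HasDerivAt u (u' s) s)
    (hu' : ∀ s, HasDerivAt u' (u'' s) s) (hc : Continuous u'') {b s : ℝ} (hb : 0 < b)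
    (hs : s ∈ Set.Icc (-b) b) :
    ‖u s‖ₑ ≤ ‖u b‖ₑ + ‖u (-b)‖ₑ + 2 * ∫⁻ σ in Set.Icc (-b) b, ‖(|σ| - b) * u'' σ‖ₑ := by
  have hcu : Continuous u := continuous_iff_continuousAt.2 fun s => (hu s).continuousAt
  have hcu' : Continuous u' := continuous_iff_continuousAt.2 fun s => (hu' s).continuousAt
  obtain ⟨hs1, hs2⟩ := hs
  have hd : ∀ c s, HasDerivAt (fun s => (s - c) * u' s - u s) ((s - c) * u'' s) s := by
    intro c s
    have := ((((hasDerivAt_id s).sub_const c).mul (hu' s)).sub (hu s))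
    refine this.congr_deriv ?_
    simp
  set θ := (s + b) / (2 * b) with hθ
  have h1 := intervalIntegral.integral_eq_sub_of_hasDerivAt (a := s) (b := b)
      (fun s _ => hd b s) (Continuous.intervalIntegrable (by fun_prop) _ _)
  have h2 := intervalIntegral.integral_eq_sub_of_hasDerivAt (a := -b) (b := s)
      (fun s _ => hd (-b) s) (Continuous.intervalIntegrable (by fun_prop) _ _)
  have hθ0 : 0 ≤ θ := by rw [hθ]; apply div_nonneg <;> linarith
  have hθ1 : θ ≤ 1 := by rw [hθ, div_le_one (by linarith)]; linarith
  have hθb : θ * (2 * b) = s + b := by rw [hθ]; field_simp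
  have h3 : u s = θ * u b + (1 - θ) * u (-b) + (∫ σ in s..b, θ * ((σ - b) * u'' σ))
      - ∫ σ in (-b)..s, (1 - θ) * ((σ - -b) * u'' σ) := by
    rw [intervalIntegral.integral_const_mul, intervalIntegral.integral_const_mul, h1, h2]
    clear_value θ
    linear_combination -(u' s) * hθb
  have hsub : ∀ {x y : ℝ} {g : ℝ → ℝ}, x ∈ Set.Icc (-b) b → y ∈ Set.Icc (-b) b → x ≤ y →
      (∀ σ ∈ Set.Icc x y, |g σ| ≤ |(|σ| - b) * u'' σ|) →
      ‖∫ σ in x..y, g σ‖ₑ ≤ ∫⁻ σ in Set.Icc (-b) b, ‖(|σ| - b) * u'' σ‖ₑ := by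
    intro x y g hx hy hxy hg
    refine (enorm_intervalIntegral_le g ⟨le_rfl, hxy⟩ ⟨hxy, le_rfl⟩).trans ?_
    refine (setLIntegral_mono' measurableSet_Icc fun σ hσ => ?_).trans
        (lintegral_mono_set (Set.Icc_subset_Icc hx.1 hy.2))
    exact enorm_le_iff_norm_le.2 (hg σ hσ)
  have hw : ∀ σ : ℝ, |σ| ≤ b → abs (|σ| - b) = b - |σ| := fun σ hσ => by
    rw [abs_of_nonpos (by linarith)]; ring
  rw [h3, two_mul, ← add_assoc]
  refine enorm_sub_le.trans (add_le_add ((enorm_add_le _ _).trans (add_le_add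
    ((enorm_add_le _ _).trans (add_le_add ?_ ?_)) ?_)) ?_)
  · rw [enorm_mul]
    refine mul_le_of_le_one_left' ?_
    rw [Real.enorm_eq_ofReal hθ0]
    exact ENNReal.ofReal_le_one.2 hθ1
  · rw [enorm_mul]
    refine mul_le_of_le_one_left' ?_
    rw [Real.enorm_eq_ofReal (by linarith)]
    exact ENNReal.ofReal_le_one.2 (by linarith)
  · refine hsub ⟨hs1, hs2⟩ ⟨by linarith, le_rfl⟩ hs2 fun σ hσ => ?_
    rw [← mul_assoc, abs_mul, abs_mul (|σ| - b)]
    refine mul_le_mul_of_nonneg_right ?_ (abs_nonneg _)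
    rw [hw σ (abs_le.2 ⟨by linarith [hσ.1], hσ.2⟩), abs_mul, abs_of_nonneg hθ0,
      abs_of_nonpos (by linarith [hσ.2])]
    rcases abs_cases σ with ⟨h, _⟩ | ⟨h, _⟩ <;> rw [h]
    · nlinarith [hσ.2]
    · have : θ * (b - σ) ≤ θ * (2 * b) := by gcongr; linarith [hσ.1]
      linarith [hσ.1]
  · refine hsub ⟨le_rfl, by linarith⟩ ⟨hs1, hs2⟩ hs1 fun σ hσ => ?_
    rw [← mul_assoc, abs_mul, abs_mul (|σ| - b)]
    refine mul_le_mul_of_nonneg_right ?_ (abs_nonneg _)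
    rw [hw σ (abs_le.2 ⟨by linarith [hσ.1], by linarith [hσ.2]⟩), abs_mul,
      abs_of_nonneg (by linarith), abs_of_nonneg (by linarith [hσ.1])]
    rcases abs_cases σ with ⟨h, _⟩ | ⟨h, _⟩ <;> rw [h]
    · have : (1 - θ) * (σ - -b) ≤ (1 - θ) * (2 * b) := by
        gcongr; linarith [hσ.2]
      linarith [hσ.2]
    · nlinarith [hσ.1]

theorem sq_enorm_le_weighted {u u' u'' : ℝ → ℝ} (hu : ∀ s, HasDerivAt u (u' s) s)
    (hu' : ∀ s, HasDerivAt u' (u'' s) s) (hc : Continuous u'') {b s : ℝ} (hb : 0 < b)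
    (hb1 : b ≤ 1) (hs : s ∈ Set.Icc (-b) b) :
    ‖u s‖ₑ ^ 2 ≤ 384 * ∫⁻ σ, (‖(|σ| - b) * u σ‖ₑ ^ 2 + ‖(|σ| - b) * u' σ‖ₑ ^ 2
      + ‖(|σ| - b) * u'' σ‖ₑ ^ 2) := by
  have hcu : Continuous u := continuous_iff_continuousAt.2 fun s => (hu s).continuousAt
  have hcu' : Continuous u' := continuous_iff_continuousAt.2 fun s => (hu' s).continuousAt
  set F : ℝ → ℝ≥0∞ := fun σ => ‖(|σ| - b) * u σ‖ₑ + ‖(|σ| - b) * u' σ‖ₑ + ‖(|σ| - b) * u'' σ‖ₑ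
    with hF
  have hFm : Measurable F := by fun_prop
  set J := ∫⁻ σ in Set.Icc (-3) 3, F σ with hJ
  have h1 : ‖u b‖ₑ ≤ J := by
    refine (enorm_le_lintegral_right hu hu' hc b).trans ?_
    refine (setLIntegral_mono' measurableSet_Icc fun σ hσ => ?_).trans
      (lintegral_mono_set (Set.Icc_subset_Icc (by linarith) (by linarith)))
    have hσb : |σ| = σ := abs_of_nonneg (by linarith [hσ.1])
    simp only [hF, hσb, le_refl]
  have h2 : ‖u (-b)‖ₑ ≤ J := by
    have hv : ∀ s, HasDerivAt (fun σ => u (-σ)) (-u' (-s)) s := fun s => by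
      simpa [Function.comp_def] using (hu (-s)).comp s (hasDerivAt_neg s)
    have hv' : ∀ s, HasDerivAt (fun σ => -u' (-σ)) (u'' (-s)) s := fun s => by
      simpa [Function.comp_def] using ((hu' (-s)).comp s (hasDerivAt_neg s)).fun_neg
    refine (enorm_le_lintegral_right hv hv' (by fun_prop) b).trans ?_
    have h3 := (Measure.measurePreserving_neg (volume : Measure ℝ)).setLIntegral_comp_preimage_emb
        (MeasurableEquiv.neg ℝ).measurableEmbedding F (Set.Icc (-3) 3)
    rw [hJ, ← h3]
    have h4 : (Neg.neg ⁻¹' Set.Icc (-3 : ℝ) 3) = Set.Icc (-3) 3 := by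
      ext x; simp only [Set.mem_preimage, Set.mem_Icc]; constructor <;> rintro ⟨h, h'⟩ <;>
        constructor <;> linarith
    rw [h4]
    refine (setLIntegral_mono' measurableSet_Icc fun σ hσ => ?_).trans
      (lintegral_mono_set (Set.Icc_subset_Icc (by linarith) (by linarith)))
    have hσb : |σ| = σ := abs_of_nonneg (by linarith [hσ.1])
    simp only [hF, abs_neg, hσb, mul_neg, enorm_neg, le_refl]
  have h3 : ∫⁻ σ in Set.Icc (-b) b, ‖(|σ| - b) * u'' σ‖ₑ ≤ J :=
    (lintegral_mono fun σ => le_add_self).trans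
      (lintegral_mono_set (Set.Icc_subset_Icc (by linarith) (by linarith)))
  have h4 : ‖u s‖ₑ ≤ 4 * J := by
    calc _ ≤ _ := enorm_le_of_abs_le hu hu' hc hb hs
      _ ≤ J + J + 2 * J := by gcongr
      _ = _ := by ring
  have h5 : J ^ 2 ≤ 6 * ∫⁻ σ in Set.Icc (-3) 3, F σ ^ 2 := by
    refine (sq_lintegral_le _ hFm.aemeasurable).trans ?_
    gcongr
    simp only [Measure.restrict_apply_univ, Real.volume_Icc]
    norm_num
  have h6 : ∀ σ, F σ ^ 2 ≤ 4 * (‖(|σ| - b) * u σ‖ₑ ^ 2 + ‖(|σ| - b) * u' σ‖ₑ ^ 2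
      + ‖(|σ| - b) * u'' σ‖ₑ ^ 2) := by
    intro σ
    generalize hx : ‖(|σ| - b) * u σ‖ₑ = x
    generalize hy : ‖(|σ| - b) * u' σ‖ₑ = y
    generalize hz : ‖(|σ| - b) * u'' σ‖ₑ = z
    have : F σ = x + y + z := by rw [hF, ← hx, ← hy, ← hz]
    rw [this]
    calc _ ≤ _ := ennreal_add_sq_le _ _
      _ ≤ 2 * (2 * (x ^ 2 + y ^ 2) + z ^ 2) := by gcongr; exact ennreal_add_sq_le _ _
      _ ≤ 2 * (2 * (x ^ 2 + y ^ 2) + 2 * z ^ 2) := by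
          gcongr; exact le_mul_of_one_le_left' (by norm_num)
      _ = _ := by ring
  calc ‖u s‖ₑ ^ 2 ≤ (4 * J) ^ 2 := pow_le_pow_left' h4 2
    _ = 16 * J ^ 2 := by ring
    _ ≤ 16 * (6 * ∫⁻ σ, F σ ^ 2) := by
        gcongr; exact h5.trans (mul_le_mul_right (setLIntegral_le_lintegral _ _) _)
    _ ≤ 16 * (6 * ∫⁻ σ, 4 * (‖(|σ| - b) * u σ‖ₑ ^ 2 + ‖(|σ| - b) * u' σ‖ₑ ^ 2
      + ‖(|σ| - b) * u'' σ‖ₑ ^ 2)) := by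
        gcongr with σ; exact h6 σ
    _ = _ := by
        rw [lintegral_const_mul _ (by fun_prop)]; ring

/-- The partial derivatives of order at most two of a planar function `v`, with `v₁₂ = ∂₁∂₂ v`. -/
structure PlanarJet (v v₁ v₂ v₁₁ v₁₂ v₂₂ : ℝ → ℝ → ℝ) : Prop where
  cont : Continuous fun p : ℝ × ℝ => v p.1 p.2
  cont₁ : Continuous fun p : ℝ × ℝ => v₁ p.1 p.2
  cont₂ : Continuous fun p : ℝ × ℝ => v₂ p.1 p.2
  cont₁₁ : Continuous fun p : ℝ × ℝ => v₁₁ p.1 p.2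
  cont₁₂ : Continuous fun p : ℝ × ℝ => v₁₂ p.1 p.2
  cont₂₂ : Continuous fun p : ℝ × ℝ => v₂₂ p.1 p.2
  deriv₁ : ∀ a b, HasDerivAt (fun s => v s b) (v₁ a b) a
  deriv₂ : ∀ a b, HasDerivAt (fun s => v a s) (v₂ a b) b
  deriv₁₁ : ∀ a b, HasDerivAt (fun s => v₁ s b) (v₁₁ a b) a
  deriv₁₂ : ∀ a b, HasDerivAt (fun s => v₂ s b) (v₁₂ a b) a
  deriv₂₂ : ∀ a b, HasDerivAt (fun s => v₂ a s) (v₂₂ a b) b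

/-- The squared `L²` norm of `u` on the square `[p, p + 2l] × [q, q + 2l]`. -/
def boxSq (p q l : ℝ) (u : ℝ → ℝ → ℝ) : ℝ≥0∞ :=
  ∫⁻ b in Set.Icc q (q + 2 * l), ∫⁻ a in Set.Icc p (p + 2 * l), ‖u a b‖ₑ ^ 2

/-- The squared `L²` norm of `W u` on the plane. -/
def planeSq (W u : ℝ → ℝ → ℝ) : ℝ≥0∞ := ∫⁻ b, ∫⁻ a, ‖W a b * u a b‖ₑ ^ 2

/-- The squared weighted second order norm on the plane. -/
def jetSq (W v v₁ v₂ v₁₁ v₁₂ v₂₂ : ℝ → ℝ → ℝ) : ℝ≥0∞ :=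
  planeSq W v + planeSq W v₁ + planeSq W v₂ + planeSq W v₁₁ + planeSq W v₁₂ + planeSq W v₂₂

theorem PlanarJet.mul_sq_enorm_le {v v₁ v₂ v₁₁ v₁₂ v₂₂ : ℝ → ℝ → ℝ}
    (h : PlanarJet v v₁ v₂ v₁₁ v₁₂ v₂₂) {p q l x y : ℝ}
    (hx : x ∈ Set.Icc p (p + 2 * l)) (hy : y ∈ Set.Icc q (q + 2 * l)) :
    ENNReal.ofReal (2 * l) ^ 2 * ‖v x y‖ₑ ^ 2 ≤ 4 * (boxSq p q l v
      + ENNReal.ofReal (2 * l) ^ 2 * boxSq p q l v₁ + ENNReal.ofReal (2 * l) ^ 2 * boxSq p q l v₂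
      + ENNReal.ofReal (2 * l) ^ 4 * boxSq p q l v₁₂) := by
  have hc := h.cont
  have hm := hc.measurable
  have hc₁ := h.cont₁
  have hm₁ := hc₁.measurable
  have hc₂ := h.cont₂
  have hm₂ := hc₂.measurable
  have hc₁₂ := h.cont₁₂
  have hm₁₂ := hc₁₂.measurable
  set E := ENNReal.ofReal (2 * l)
  have h1 := Stmt6.mul_sq_enorm_le (fun s => h.deriv₂ x s) (by fun_prop) hy
  have h2 : E * ∫⁻ b in Set.Icc q (q + 2 * l), ‖v x b‖ₑ ^ 2 ≤
      2 * (boxSq p q l v + E ^ 2 * boxSq p q l v₁) := by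
    rw [← lintegral_const_mul _ (by fun_prop)]
    refine (lintegral_mono fun b => Stmt6.mul_sq_enorm_le (fun s => h.deriv₁ s b)
      (by fun_prop) hx).trans_eq ?_
    rw [lintegral_const_mul _ (by fun_prop), lintegral_add_left (by fun_prop),
      lintegral_const_mul _ (by fun_prop)]
    rfl
  have h3 : E * ∫⁻ b in Set.Icc q (q + 2 * l), ‖v₂ x b‖ₑ ^ 2 ≤
      2 * (boxSq p q l v₂ + E ^ 2 * boxSq p q l v₁₂) := by
    rw [← lintegral_const_mul _ (by fun_prop)]
    refine (lintegral_mono fun b => Stmt6.mul_sq_enorm_le (fun s => h.deriv₁₂ s b)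
      (by fun_prop) hx).trans_eq ?_
    rw [lintegral_const_mul _ (by fun_prop), lintegral_add_left (by fun_prop),
      lintegral_const_mul _ (by fun_prop)]
    rfl
  calc E ^ 2 * ‖v x y‖ₑ ^ 2 = E * (E * ‖v x y‖ₑ ^ 2) := by ring
    _ ≤ E * _ := mul_le_mul_right h1 _
    _ = 2 * (E * (∫⁻ b in Set.Icc q (q + 2 * l), ‖v x b‖ₑ ^ 2)
        + E ^ 2 * (E * ∫⁻ b in Set.Icc q (q + 2 * l), ‖v₂ x b‖ₑ ^ 2)) := by ring
    _ ≤ 2 * (2 * (boxSq p q l v + E ^ 2 * boxSq p q l v₁)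
        + E ^ 2 * (2 * (boxSq p q l v₂ + E ^ 2 * boxSq p q l v₁₂))) := by gcongr
    _ = _ := by ring

theorem PlanarJet.boxSq_deriv₁_le {v v₁ v₂ v₁₁ v₁₂ v₂₂ : ℝ → ℝ → ℝ}
    (h : PlanarJet v v₁ v₂ v₁₁ v₁₂ v₂₂) {p q l : ℝ} (hl : 0 < l) :
    ENNReal.ofReal l ^ 2 * boxSq p q l v₁ ≤
      32 * (boxSq p q l v + ENNReal.ofReal l ^ 4 * boxSq p q l v₁₁) := by
  have hc := h.cont
  have hm := hc.measurable
  have hc₁ := h.cont₁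
  have hm₁ := hc₁.measurable
  have hc₁₁ := h.cont₁₁
  have hm₁₁ := hc₁₁.measurable
  unfold boxSq
  rw [← lintegral_const_mul _ (by fun_prop)]
  refine (lintegral_mono fun b => lintegral_sq_deriv_le (fun s => h.deriv₁ s b)
    (fun s => h.deriv₁₁ s b) (by fun_prop) hl).trans_eq ?_
  rw [lintegral_const_mul _ (by fun_prop), lintegral_add_left (by fun_prop),
    lintegral_const_mul _ (by fun_prop)]

theorem PlanarJet.boxSq_deriv₂_le {v v₁ v₂ v₁₁ v₁₂ v₂₂ : ℝ → ℝ → ℝ}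
    (h : PlanarJet v v₁ v₂ v₁₁ v₁₂ v₂₂) {p q l : ℝ} (hl : 0 < l) :
    ENNReal.ofReal l ^ 2 * boxSq p q l v₂ ≤
      32 * (boxSq p q l v + ENNReal.ofReal l ^ 4 * boxSq p q l v₂₂) := by
  have hc := h.cont
  have hm := hc.measurable
  have hc₂ := h.cont₂
  have hm₂ := hc₂.measurable
  have hc₂₂ := h.cont₂₂
  have hm₂₂ := hc₂₂.measurable
  have swap : ∀ u : ℝ → ℝ → ℝ, (Continuous fun p : ℝ × ℝ => u p.1 p.2) → boxSq p q l u =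
      ∫⁻ a in Set.Icc p (p + 2 * l), ∫⁻ b in Set.Icc q (q + 2 * l), ‖u a b‖ₑ ^ 2 := by
    intro u hu
    exact lintegral_lintegral_swap (by unfold Function.uncurry; fun_prop)
  rw [swap _ hc, swap _ hc₂, swap _ hc₂₂]
  rw [← lintegral_const_mul _ (by fun_prop)]
  refine (lintegral_mono fun a => lintegral_sq_deriv_le (fun s => h.deriv₂ a s)
    (fun s => h.deriv₂₂ a s) (by fun_prop) hl).trans_eq ?_
  rw [lintegral_const_mul _ (by fun_prop), lintegral_add_left (by fun_prop),
    lintegral_const_mul _ (by fun_prop)]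

theorem boxSq_le_planeSq {W : ℝ → ℝ → ℝ} (u : ℝ → ℝ → ℝ) {p q l t : ℝ}
    (hu : Continuous fun p : ℝ × ℝ => u p.1 p.2)
    (hW : ∀ a ∈ Set.Icc p (p + 2 * l), ∀ b ∈ Set.Icc q (q + 2 * l), t ≤ 4 * |W a b|) :
    ENNReal.ofReal t ^ 2 * boxSq p q l u ≤ 16 * planeSq W u := by
  have hm := hu.measurable
  unfold boxSq planeSq
  rw [← lintegral_const_mul _ (by fun_prop), ← lintegral_const_mul' _ _ (by norm_num)]
  refine (setLIntegral_mono' measurableSet_Icc fun b hb => ?_).trans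
    (setLIntegral_le_lintegral _ _)
  rw [← lintegral_const_mul _ (by fun_prop), ← lintegral_const_mul' _ _ (by norm_num)]
  refine (setLIntegral_mono' measurableSet_Icc fun a ha => ?_).trans
    (setLIntegral_le_lintegral _ _)
  have h1 : ENNReal.ofReal t ≤ 4 * ‖W a b‖ₑ := by
    rw [Real.enorm_eq_ofReal_abs, ← ENNReal.ofReal_ofNat, ← ENNReal.ofReal_mul (by norm_num)]
    exact ENNReal.ofReal_le_ofReal (hW a ha b hb)
  calc _ ≤ (4 * ‖W a b‖ₑ) ^ 2 * ‖u a b‖ₑ ^ 2 := by gcongr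
    _ = _ := by rw [enorm_mul]; ring

theorem PlanarJet.boxSq_le {v v₁ v₂ v₁₁ v₁₂ v₂₂ : ℝ → ℝ → ℝ}
    (h : PlanarJet v v₁ v₂ v₁₁ v₁₂ v₂₂) {W : ℝ → ℝ → ℝ}
    (hWc : Continuous fun p : ℝ × ℝ => W p.1 p.2) {p q l : ℝ}
    (hW : ∀ b ∈ Set.Icc q (q + 2 * l), ∃ B : ℝ, 0 < B ∧ B ≤ 1 ∧
      Set.Icc p (p + 2 * l) ⊆ Set.Icc (-B) B ∧ ∀ σ : ℝ, abs (|σ| - B) ≤ 4 * |W σ b|) :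
    boxSq p q l v ≤ 6144 * ENNReal.ofReal (2 * l) *
      (planeSq W v + planeSq W v₁ + planeSq W v₁₁) := by
  have hc := h.cont
  have hm := hc.measurable
  have hc₁ := h.cont₁
  have hm₁ := hc₁.measurable
  have hc₁₁ := h.cont₁₁
  have hm₁₁ := hc₁₁.measurable
  have hWm := hWc.measurable
  set H : ℝ → ℝ≥0∞ := fun b => ∫⁻ σ, (‖W σ b * v σ b‖ₑ ^ 2 + ‖W σ b * v₁ σ b‖ₑ ^ 2
      + ‖W σ b * v₁₁ σ b‖ₑ ^ 2) with hH
  have hvol : (volume.restrict (Set.Icc p (p + 2 * l))) Set.univ = ENNReal.ofReal (2 * l) := by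
    simp
  have key : ∀ b ∈ Set.Icc q (q + 2 * l), ∫⁻ a in Set.Icc p (p + 2 * l), ‖v a b‖ₑ ^ 2 ≤
      6144 * ENNReal.ofReal (2 * l) * H b := by
    intro b hb
    obtain ⟨B, hB0, hB1, hI, hB⟩ := hW b hb
    have hB' : ∀ σ x : ℝ, ‖(|σ| - B) * x‖ₑ ^ 2 ≤ 16 * ‖W σ b * x‖ₑ ^ 2 := by
      intro σ x
      have h1 : ‖|σ| - B‖ₑ ≤ 4 * ‖W σ b‖ₑ := by
        rw [Real.enorm_eq_ofReal_abs, Real.enorm_eq_ofReal_abs, ← ENNReal.ofReal_ofNat,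
          ← ENNReal.ofReal_mul (by norm_num)]
        exact ENNReal.ofReal_le_ofReal (hB σ)
      rw [enorm_mul, enorm_mul]
      calc _ ≤ (4 * ‖W σ b‖ₑ * ‖x‖ₑ) ^ 2 := by gcongr
        _ = _ := by ring
    have h2 : ∀ a ∈ Set.Icc p (p + 2 * l), ‖v a b‖ₑ ^ 2 ≤ 6144 * H b := by
      intro a ha
      refine (sq_enorm_le_weighted (fun s => h.deriv₁ s b) (fun s => h.deriv₁₁ s b)
        (by fun_prop) hB0 hB1 (hI ha)).trans ?_
      calc _ ≤ 384 * ∫⁻ σ, 16 * (‖W σ b * v σ b‖ₑ ^ 2 + ‖W σ b * v₁ σ b‖ₑ ^ 2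
              + ‖W σ b * v₁₁ σ b‖ₑ ^ 2) := by
            gcongr with σ
            rw [mul_add, mul_add]
            exact add_le_add (add_le_add (hB' _ _) (hB' _ _)) (hB' _ _)
        _ = _ := by rw [lintegral_const_mul _ (by fun_prop)]; ring
    refine (setLIntegral_mono' measurableSet_Icc h2).trans_eq ?_
    rw [lintegral_const, hvol]; ring
  calc boxSq p q l v ≤ ∫⁻ b in Set.Icc q (q + 2 * l), 6144 * ENNReal.ofReal (2 * l) * H b :=
        setLIntegral_mono' measurableSet_Icc key
    _ ≤ ∫⁻ b, 6144 * ENNReal.ofReal (2 * l) * H b := setLIntegral_le_lintegral _ _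
    _ = 6144 * ENNReal.ofReal (2 * l) * ∫⁻ b, H b := lintegral_const_mul _ (by fun_prop)
    _ = _ := by
      have : ∀ b, H b = (∫⁻ σ, ‖W σ b * v σ b‖ₑ ^ 2) + (∫⁻ σ, ‖W σ b * v₁ σ b‖ₑ ^ 2)
          + ∫⁻ σ, ‖W σ b * v₁₁ σ b‖ₑ ^ 2 := fun b => by
        simp only [hH]
        rw [lintegral_add_left (by fun_prop), lintegral_add_left (by fun_prop)]
      simp only [this]
      rw [lintegral_add_left (by fun_prop), lintegral_add_left (by fun_prop)]
      rfl

theorem PlanarJet.sq_enorm_le_of_one_le {v v₁ v₂ v₁₁ v₁₂ v₂₂ : ℝ → ℝ → ℝ}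
    (h : PlanarJet v v₁ v₂ v₁₁ v₁₂ v₂₂) {W : ℝ → ℝ → ℝ} {x y t : ℝ}
    (hW : ∀ a ∈ Set.Icc x (x + 2 * (1 / 16)), ∀ b ∈ Set.Icc y (y + 2 * (1 / 16)),
      t ≤ 4 * |W a b|) :
    ENNReal.ofReal t ^ 2 * ‖v x y‖ₑ ^ 2 ≤ 4096 * jetSq W v v₁ v₂ v₁₁ v₁₂ v₂₂ := by
  have h1 := h.mul_sq_enorm_le (p := x) (q := y) (l := 1 / 16) (x := x) (y := y)
    ⟨le_rfl, by norm_num⟩ ⟨le_rfl, by norm_num⟩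
  set E := ENNReal.ofReal (2 * (1 / 16))
  set T := ENNReal.ofReal t
  have hE1 : E ≤ 1 := ENNReal.ofReal_le_one.2 (by norm_num)
  have hE8 : 64 * E ^ 2 = 1 := by
    rw [← ENNReal.ofReal_ofNat, ← ENNReal.ofReal_pow (by norm_num),
      ← ENNReal.ofReal_mul (by norm_num)]
    norm_num
  have h0 := boxSq_le_planeSq v h.cont hW
  have h01 := boxSq_le_planeSq v₁ h.cont₁ hW
  have h02 := boxSq_le_planeSq v₂ h.cont₂ hW
  have h12 := boxSq_le_planeSq v₁₂ h.cont₁₂ hW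
  have hE2 : E ^ 2 ≤ 1 := pow_le_one' hE1 2
  have hE4 : E ^ 4 ≤ 1 := pow_le_one' hE1 4
  calc T ^ 2 * ‖v x y‖ₑ ^ 2 = 64 * T ^ 2 * (E ^ 2 * ‖v x y‖ₑ ^ 2) := by
        rw [← one_mul (T ^ 2 * ‖v x y‖ₑ ^ 2), ← hE8]; ring
    _ ≤ 64 * T ^ 2 * _ := mul_le_mul_right h1 _
    _ ≤ 64 * T ^ 2 * (4 * (boxSq x y (1 / 16) v + 1 * boxSq x y (1 / 16) v₁
          + 1 * boxSq x y (1 / 16) v₂ + 1 * boxSq x y (1 / 16) v₁₂)) := by gcongr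
    _ = 256 * (T ^ 2 * boxSq x y (1 / 16) v + T ^ 2 * boxSq x y (1 / 16) v₁
          + T ^ 2 * boxSq x y (1 / 16) v₂ + T ^ 2 * boxSq x y (1 / 16) v₁₂) := by ring
    _ ≤ 256 * (16 * planeSq W v + 16 * planeSq W v₁ + 16 * planeSq W v₂ + 16 * planeSq W v₁₂) := by
        gcongr
    _ ≤ 256 * (16 * planeSq W v + 16 * planeSq W v₁ + 16 * planeSq W v₂ + 16 * planeSq W v₁₂)
          + 4096 * (planeSq W v₁₁ + planeSq W v₂₂) := le_self_add
    _ = _ := by unfold jetSq; ring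

theorem PlanarJet.sq_enorm_le_of_le_one {v v₁ v₂ v₁₁ v₁₂ v₂₂ : ℝ → ℝ → ℝ}
    (h : PlanarJet v v₁ v₂ v₁₁ v₁₂ v₂₂) {W : ℝ → ℝ → ℝ}
    (hWc : Continuous fun p : ℝ × ℝ => W p.1 p.2) {x y l : ℝ} (hl : 0 < l) (hl1 : l ≤ 1)
    (hW : ∀ a ∈ Set.Icc x (x + 2 * l), ∀ b ∈ Set.Icc y (y + 2 * l), 16 * l ≤ 4 * |W a b|)
    (hWB : ∀ b ∈ Set.Icc y (y + 2 * l), ∃ B : ℝ, 0 < B ∧ B ≤ 1 ∧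
      Set.Icc x (x + 2 * l) ⊆ Set.Icc (-B) B ∧ ∀ σ : ℝ, abs (|σ| - B) ≤ 4 * |W σ b|) :
    ENNReal.ofReal l * ‖v x y‖ₑ ^ 2 ≤ 3200000 * jetSq W v v₁ v₂ v₁₁ v₁₂ v₂₂ := by
  have h1 := h.mul_sq_enorm_le (p := x) (q := y) (l := l) (x := x) (y := y)
    ⟨le_rfl, by linarith⟩ ⟨le_rfl, by linarith⟩
  have h2 := h.boxSq_deriv₁_le (p := x) (q := y) hl
  have h3 := h.boxSq_deriv₂_le (p := x) (q := y) hl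
  have h4 := h.boxSq_le hWc hWB
  set N := jetSq W v v₁ v₂ v₁₁ v₁₂ v₂₂ with hN
  set e := ENNReal.ofReal l with he
  have hE : ENNReal.ofReal (2 * l) = 2 * e := by
    rw [ENNReal.ofReal_mul (by norm_num), ENNReal.ofReal_ofNat]
  have hT : ENNReal.ofReal (16 * l) = 16 * e := by
    rw [ENNReal.ofReal_mul (by norm_num), ENNReal.ofReal_ofNat]
  rw [hE] at h1 h4
  have he1 : e ≤ 1 := ENNReal.ofReal_le_one.2 hl1
  have he0 : e ≠ 0 := by simpa [he] using hl
  have heT : e ≠ ∞ := ENNReal.ofReal_ne_top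
  have hbox : ∀ u : ℝ → ℝ → ℝ, (Continuous fun p : ℝ × ℝ => u p.1 p.2) → planeSq W u ≤ N →
      e ^ 2 * boxSq x y l u ≤ N := by
    intro u hu huN
    have h5 := boxSq_le_planeSq u hu hW
    rw [hT] at h5
    have h6 : 16 * (16 * (e ^ 2 * boxSq x y l u)) ≤ 16 * N := by
      calc _ = (16 * e) ^ 2 * boxSq x y l u := by ring
        _ ≤ _ := h5.trans (by gcongr)
    have h7 := (ENNReal.mul_le_mul_iff_right (by norm_num) (by norm_num)).1 h6
    exact (le_mul_of_one_le_left' (by norm_num)).trans h7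
  have n0 : planeSq W v + planeSq W v₁ + planeSq W v₁₁ ≤ N := by
    have : N = (planeSq W v + planeSq W v₁ + planeSq W v₁₁)
        + (planeSq W v₂ + planeSq W v₁₂ + planeSq W v₂₂) := by rw [hN]; unfold jetSq; ring
    rw [this]; exact le_self_add
  have n11 : e ^ 2 * boxSq x y l v₁₁ ≤ N := hbox _ h.cont₁₁ (le_add_self.trans n0)
  have n22 : e ^ 2 * boxSq x y l v₂₂ ≤ N := hbox _ h.cont₂₂ le_add_self
  have n12 : e ^ 2 * boxSq x y l v₁₂ ≤ N :=
    hbox _ h.cont₁₂ (le_add_self.trans (le_self_add (b := planeSq W v₂₂)))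
  have he2 : e ^ 2 ≤ e := by rw [sq]; exact mul_le_of_le_one_left' he1
  have b0 : boxSq x y l v ≤ 12288 * (e * N) := by
    calc _ ≤ _ := h4
      _ ≤ 6144 * (2 * e) * N := by gcongr
      _ = _ := by ring
  have bj : ∀ u u' : ℝ → ℝ → ℝ,
      e ^ 2 * boxSq x y l u ≤ 32 * (boxSq x y l v + e ^ 4 * boxSq x y l u') →
      e ^ 2 * boxSq x y l u' ≤ N → e ^ 2 * boxSq x y l u ≤ 393248 * (e * N) := by
    intro u u' h5 h6
    calc _ ≤ _ := h5
      _ = 32 * (boxSq x y l v + e ^ 2 * (e ^ 2 * boxSq x y l u')) := by ring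
      _ ≤ 32 * (12288 * (e * N) + e * N) := by gcongr
      _ = _ := by ring
  have b1 := bj _ _ h2 n11
  have b2 := bj _ _ h3 n22
  have h8 : 4 * e * (e * ‖v x y‖ₑ ^ 2) ≤ 4 * e * (3200000 * N) := by
    calc _ = (2 * e) ^ 2 * ‖v x y‖ₑ ^ 2 := by ring
      _ ≤ _ := h1
      _ = 4 * (boxSq x y l v + 4 * (e ^ 2 * boxSq x y l v₁) + 4 * (e ^ 2 * boxSq x y l v₂)
            + 16 * e ^ 2 * (e ^ 2 * boxSq x y l v₁₂)) := by ring
      _ ≤ 4 * (12288 * (e * N) + 4 * (393248 * (e * N)) + 4 * (393248 * (e * N))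
            + 16 * e * N) := by gcongr
      _ = 12633152 * (e * N) := by ring
      _ ≤ 12800000 * (e * N) := by gcongr; norm_num
      _ = _ := by ring
  exact (ENNReal.mul_le_mul_iff_right (mul_ne_zero (by norm_num) he0)
    (ENNReal.mul_ne_top (by norm_num) heT)).1 h8

/-- The point with the given Cartesian coordinates. -/
def pt (a b c : ℝ) : Pt := !₂[a, b, c]

theorem pt_coords (x : Pt) : pt (x 0) (x 1) (x 2) = x := by
  ext i; fin_cases i <;> simp [pt]

theorem norm_sq_pt (a b c : ℝ) : ‖pt a b c‖ ^ 2 = a ^ 2 + b ^ 2 + c ^ 2 := by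
  simp [EuclideanSpace.norm_sq_eq, Fin.sum_univ_three, pt]

theorem continuous_pt : Continuous fun p : ℝ × ℝ × ℝ => pt p.1 p.2.1 p.2.2 := by
  unfold pt
  refine (PiLp.continuous_toLp 2 _).comp (continuous_pi fun i => ?_)
  fin_cases i <;> simp <;> fun_prop

theorem hasDerivAt_pt₁ (a b c : ℝ) :
    HasDerivAt (fun s => pt s b c) (EuclideanSpace.single 0 1) a := by
  have h : (fun s => pt s b c) = fun s => pt 0 b c + s • EuclideanSpace.single 0 1 := by
    funext s; ext i; fin_cases i <;> simp [pt]
  rw [h]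
  simpa using ((hasDerivAt_id a).smul_const (EuclideanSpace.single 0 1 : Pt)).const_add (pt 0 b c)

theorem hasDerivAt_pt₂ (a b c : ℝ) :
    HasDerivAt (fun s => pt a s c) (EuclideanSpace.single 1 1) b := by
  have h : (fun s => pt a s c) = fun s => pt a 0 c + s • EuclideanSpace.single 1 1 := by
    funext s; ext i; fin_cases i <;> simp [pt]
  rw [h]
  simpa using ((hasDerivAt_id b).smul_const (EuclideanSpace.single 1 1 : Pt)).const_add (pt a 0 c)

theorem hasDerivAt_pt₃ (a b c : ℝ) :
    HasDerivAt (fun s => pt a b s) (EuclideanSpace.single 2 1) c := by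
  have h : (fun s => pt a b s) = fun s => pt a b 0 + s • EuclideanSpace.single 2 1 := by
    funext s; ext i; fin_cases i <;> simp [pt]
  rw [h]
  simpa using ((hasDerivAt_id c).smul_const (EuclideanSpace.single 2 1 : Pt)).const_add (pt a b 0)

theorem contDiff_pd {n m : WithTop ℕ∞} {f : Pt → ℝ} (hf : ContDiff ℝ n f) (hmn : m + 1 ≤ n)
    (j : Fin 3) : ContDiff ℝ m (pd j f) :=
  (hf.fderiv_right hmn).clm_apply contDiff_const

theorem pd_comm {f : Pt → ℝ} (hf : ContDiff ℝ 2 f) (i j : Fin 3) :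
    pd i (pd j f) = pd j (pd i f) := by
  have key : ∀ i j x, pd i (pd j f) x =
      fderiv ℝ (fderiv ℝ f) x (EuclideanSpace.single i 1) (EuclideanSpace.single j 1) := by
    intro i j x
    have hd : DifferentiableAt ℝ (fderiv ℝ f) x :=
      ((hf.fderiv_right (m := 1) (by norm_num)).differentiable (by norm_num)) x
    unfold pd
    rw [fderiv_clm_apply hd (differentiableAt_const _)]
    simp
  funext x
  rw [key, key]
  exact (hf.contDiffAt.isSymmSndFDerivAt (by simp)).eq _ _

theorem lintegral_slab (δ : ℝ) {F : Pt → ℝ≥0∞} (hF : Measurable F) :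
    ∫⁻ x in slab δ, F x = ∫⁻ c in Set.Ico 0 δ, ∫⁻ b, ∫⁻ a, F (pt a b c) := by
  have hs : MeasurableSet (Set.Ico 0 δ ×ˢ (Set.univ : Set (ℝ × ℝ))) :=
    measurableSet_Ico.prod MeasurableSet.univ
  have hp : Measurable fun q : ℝ × ℝ × ℝ => pt q.2.2 q.2.1 q.1 :=
    (continuous_pt.comp (f := fun q : ℝ × ℝ × ℝ => (q.2.2, q.2.1, q.1)) (by fun_prop)).measurable
  let e : Pt ≃ᵐ ℝ × ℝ × ℝ := ((MeasurableEquiv.toLp 2 (Fin 3 → ℝ)).symm.trans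
    (MeasurableEquiv.piFinSuccAbove (fun _ => ℝ) 2)).trans
      ((MeasurableEquiv.refl ℝ).prodCongr (MeasurableEquiv.finTwoArrow.trans MeasurableEquiv.prodComm))
  have he : MeasurePreserving e volume volume := by
    refine MeasurePreserving.trans (MeasurePreserving.trans
      (EuclideanSpace.volume_preserving_symm_measurableEquiv_toLp (Fin 3))
      (volume_preserving_piFinSuccAbove (fun _ => ℝ) 2)) ?_
    exact (MeasurePreserving.id volume).prod
      ((volume_preserving_finTwoArrow ℝ).trans Measure.measurePreserving_swap)
  have hsymm : ∀ x, pt (e x).2.2 (e x).2.1 (e x).1 = x := by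
    intro x
    ext i; fin_cases i <;> rfl
  have h1 := he.setLIntegral_comp_preimage_emb e.measurableEmbedding
    (fun q => F (pt q.2.2 q.2.1 q.1)) (Set.Ico 0 δ ×ˢ Set.univ)
  have hpre : e ⁻¹' (Set.Ico 0 δ ×ˢ Set.univ) = slab δ := by
    ext x
    simp only [Set.mem_preimage, Set.mem_prod, Set.mem_univ, and_true]
    rfl
  simp only [hpre, hsymm] at h1
  rw [h1, Measure.volume_eq_prod, ← Measure.prod_restrict, Measure.restrict_univ,
    lintegral_prod _ (show AEMeasurable (fun q : ℝ × ℝ × ℝ => F (pt q.2.2 q.2.1 q.1)) _ from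
      (hF.comp hp).aemeasurable)]
  refine lintegral_congr fun c => ?_
  rw [Measure.volume_eq_prod,
    lintegral_prod _ (show AEMeasurable (fun q : ℝ × ℝ => F (pt q.2 q.1 c)) _ from
      (hF.comp (hp.comp (measurable_prodMk_left (x := c)))).aemeasurable)]

theorem abs_sub_le_four_mul {t b c σ R : ℝ} (ht : 0 < t) (hR : 0 ≤ R)
    (hR2 : R ^ 2 = σ ^ 2 + b ^ 2 + c ^ 2) (hbc : b ^ 2 + c ^ 2 ≤ (3 / 4 * t) ^ 2) :
    abs (|σ| - √(t ^ 2 - (b ^ 2 + c ^ 2))) ≤ 4 * |t - R| := by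
  set B := √(t ^ 2 - (b ^ 2 + c ^ 2)) with hB
  have hB2 : B ^ 2 = t ^ 2 - (b ^ 2 + c ^ 2) := Real.sq_sqrt (by nlinarith)
  have hB0 : 0 ≤ B := Real.sqrt_nonneg _
  have hBt : t / 2 ≤ B := Real.le_sqrt_of_sq_le (by nlinarith)
  have hσ := abs_nonneg σ
  have hRσ : R ≤ |σ| + t := by
    refine abs_le_of_sq_le_sq' ?_ (by positivity) |>.2
    rw [hR2, ← sq_abs σ]; nlinarith
  have h1 : abs (|σ| - B) * (|σ| + B) = |t - R| * (R + t) := by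
    rw [← abs_of_nonneg (show 0 ≤ |σ| + B by positivity), ← abs_mul,
      ← abs_of_nonneg (show 0 ≤ R + t by positivity), ← abs_mul, ← abs_neg]
    congr 1
    linear_combination sq_abs σ * (-1) + hB2 + hR2
  have h2 : abs (|σ| - B) * (|σ| + B) ≤ 4 * |t - R| * (|σ| + B) := by
    rw [h1]
    nlinarith [abs_nonneg (t - R)]
  exact le_of_mul_le_mul_right h2 (by linarith)

theorem hasDerivAt_comp_pt₁ {f : Pt → ℝ} (hf : ContDiff ℝ 1 f) (a b c : ℝ) :
    HasDerivAt (fun s => f (pt s b c)) (pd 0 f (pt a b c)) a :=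
  ((hf.differentiable (by norm_num)) (pt a b c)).hasFDerivAt.comp_hasDerivAt a (hasDerivAt_pt₁ a b c)

theorem hasDerivAt_comp_pt₂ {f : Pt → ℝ} (hf : ContDiff ℝ 1 f) (a b c : ℝ) :
    HasDerivAt (fun s => f (pt a s c)) (pd 1 f (pt a b c)) b :=
  ((hf.differentiable (by norm_num)) (pt a b c)).hasFDerivAt.comp_hasDerivAt b (hasDerivAt_pt₂ a b c)

theorem hasDerivAt_comp_pt₃ {f : Pt → ℝ} (hf : ContDiff ℝ 1 f) (a b c : ℝ) :
    HasDerivAt (fun s => f (pt a b s)) (pd 2 f (pt a b c)) c :=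
  ((hf.differentiable (by norm_num)) (pt a b c)).hasFDerivAt.comp_hasDerivAt c (hasDerivAt_pt₃ a b c)

theorem planarJet_comp_pt {f : Pt → ℝ} (hf : ContDiff ℝ 2 f) (c : ℝ) :
    PlanarJet (fun a b => f (pt a b c)) (fun a b => pd 0 f (pt a b c))
      (fun a b => pd 1 f (pt a b c)) (fun a b => pd 0 (pd 0 f) (pt a b c))
      (fun a b => pd 0 (pd 1 f) (pt a b c)) (fun a b => pd 1 (pd 1 f) (pt a b c)) := by
  have hpt : Continuous fun p : ℝ × ℝ => pt p.1 p.2 c :=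
    continuous_pt.comp (f := fun p : ℝ × ℝ => (p.1, p.2, c)) (by fun_prop)
  have h1 : ∀ i, ContDiff ℝ 1 (pd i f) := fun i => contDiff_pd hf (by norm_num) i
  have h2 : ∀ i j, Continuous (pd i (pd j f)) := fun i j =>
    (contDiff_pd (m := 0) (h1 j) (by norm_num) i).continuous
  exact
    { cont := hf.continuous.comp hpt
      cont₁ := (h1 0).continuous.comp hpt
      cont₂ := (h1 1).continuous.comp hpt
      cont₁₁ := (h2 0 0).comp hpt
      cont₁₂ := (h2 0 1).comp hpt
      cont₂₂ := (h2 1 1).comp hpt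
      deriv₁ := fun a b => hasDerivAt_comp_pt₁ (hf.of_le (by norm_num)) a b c
      deriv₂ := fun a b => hasDerivAt_comp_pt₂ (hf.of_le (by norm_num)) a b c
      deriv₁₁ := fun a b => hasDerivAt_comp_pt₁ (h1 0) a b c
      deriv₁₂ := fun a b => hasDerivAt_comp_pt₁ (h1 1) a b c
      deriv₂₂ := fun a b => hasDerivAt_comp_pt₂ (h1 1) a b c }

/-- The squared weighted second order norm of `f` on the horizontal plane at height `c`. -/
def levelSq (t : ℝ) (f : Pt → ℝ) (c : ℝ) : ℝ≥0∞ :=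
  jetSq (fun a b => t - ‖pt a b c‖) (fun a b => f (pt a b c)) (fun a b => pd 0 f (pt a b c))
      (fun a b => pd 1 f (pt a b c)) (fun a b => pd 0 (pd 0 f) (pt a b c))
      (fun a b => pd 0 (pd 1 f) (pt a b c)) (fun a b => pd 1 (pd 1 f) (pt a b c))

theorem norm_pt_le {t a b c : ℝ} {x : Pt} (ht : 0 < t) (hx : ‖x‖ ≤ t / 2)
    (ha : |a - x 0| ≤ t / 8) (hb : |b - x 1| ≤ t / 8) (hc : |c - x 2| ≤ t / 8) :
    ‖pt a b c‖ ≤ 3 / 4 * t := by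
  have h1 : pt a b c - x = pt (a - x 0) (b - x 1) (c - x 2) := by
    ext i; fin_cases i <;> simp [pt]
  have h2 : ‖pt a b c - x‖ ≤ t / 4 := by
    refine abs_le_of_sq_le_sq' ?_ (by positivity) |>.2
    rw [h1, norm_sq_pt]
    have h8 : 0 ≤ t / 8 := by positivity
    have := sq_le_sq' (abs_le.1 ha).1 (abs_le.1 ha).2
    have := sq_le_sq' (abs_le.1 hb).1 (abs_le.1 hb).2
    have := sq_le_sq' (abs_le.1 hc).1 (abs_le.1 hc).2
    nlinarith
  have h3 := norm_le_norm_add_norm_sub' (pt a b c) x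
  linarith

theorem sq_enorm_le_levelSq {f : Pt → ℝ} (hf : ContDiff ℝ 2 f) {t c : ℝ} {x : Pt}
    (ht : 0 < t) (hx : ‖x‖ ≤ t / 2) (hc : |c - x 2| ≤ t / 8) :
    ENNReal.ofReal (t * max t 1 / 16) * ‖f (pt (x 0) (x 1) c)‖ₑ ^ 2
      ≤ 3200000 * levelSq t f c := by
  have hJ := planarJet_comp_pt hf c
  have key : ∀ m, m ≤ t / 8 → ∀ a ∈ Set.Icc (x 0) (x 0 + m), ∀ b ∈ Set.Icc (x 1) (x 1 + m),
      ‖pt a b c‖ ≤ 3 / 4 * t := by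
    intro m hm a ha b hb
    refine norm_pt_le ht hx ?_ ?_ hc
    · rw [abs_of_nonneg (by linarith [ha.1])]; linarith [ha.2]
    · rw [abs_of_nonneg (by linarith [hb.1])]; linarith [hb.2]
  have hW : ∀ m, m ≤ t / 8 → ∀ a ∈ Set.Icc (x 0) (x 0 + m), ∀ b ∈ Set.Icc (x 1) (x 1 + m),
      t ≤ 4 * |t - ‖pt a b c‖| := by
    intro m hm a ha b hb
    have := key m hm a ha b hb
    linarith [le_abs_self (t - ‖pt a b c‖)]
  rcases le_total 1 t with h1 | h1
  · have h := hJ.sq_enorm_le_of_one_le (W := fun a b => t - ‖pt a b c‖) (x := x 0) (y := x 1)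
      (hW _ (by linarith))
    rw [max_eq_left h1]
    have hT : ENNReal.ofReal (t * t / 16) ≤ ENNReal.ofReal t ^ 2 := by
      rw [← ENNReal.ofReal_pow ht.le]
      exact ENNReal.ofReal_le_ofReal (by nlinarith)
    calc _ ≤ ENNReal.ofReal t ^ 2 * ‖f (pt (x 0) (x 1) c)‖ₑ ^ 2 := by gcongr
      _ ≤ _ := h
      _ ≤ _ := by unfold levelSq; gcongr; norm_num
  · rw [max_eq_right h1, mul_one]
    refine hJ.sq_enorm_le_of_le_one (W := fun a b => t - ‖pt a b c‖) ?_ (by positivity)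
      (by linarith) ?_ ?_
    · exact continuous_const.sub (continuous_norm.comp (continuous_pt.comp
        (f := fun p : ℝ × ℝ => (p.1, p.2, c)) (by fun_prop)))
    · intro a ha b hb
      have := hW (2 * (t / 16)) (by linarith) a ha b hb
      linarith
    · intro b hb
      have hsq : ∀ a ∈ Set.Icc (x 0) (x 0 + 2 * (t / 16)),
          a ^ 2 + b ^ 2 + c ^ 2 ≤ (3 / 4 * t) ^ 2 := by
        intro a ha
        rw [← norm_sq_pt]
        exact pow_le_pow_left₀ (norm_nonneg _) (key _ (by linarith) a ha b hb) 2
      have hbc : b ^ 2 + c ^ 2 ≤ (3 / 4 * t) ^ 2 := by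
        nlinarith [hsq (x 0) ⟨le_rfl, by linarith⟩, sq_nonneg (x 0)]
      refine ⟨√(t ^ 2 - (b ^ 2 + c ^ 2)), Real.sqrt_pos.2 (by nlinarith), ?_, ?_, ?_⟩
      · exact Real.sqrt_le_one.2 (by nlinarith [sq_nonneg b, sq_nonneg c])
      · intro a ha
        rw [Set.mem_Icc, ← abs_le]
        exact Real.abs_le_sqrt (by nlinarith [hsq a ha])
      · intro σ
        exact abs_sub_le_four_mul ht (norm_nonneg _) (norm_sq_pt σ b c) hbc

theorem measurable_lintegral_pt {F : Pt → ℝ≥0∞} (hF : Measurable F) :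
    Measurable fun c => ∫⁻ b, ∫⁻ a, F (pt a b c) := by
  have h : Measurable fun q : (ℝ × ℝ) × ℝ => F (pt q.2 q.1.2 q.1.1) :=
    hF.comp (continuous_pt.comp (f := fun q : (ℝ × ℝ) × ℝ => (q.2, q.1.2, q.1.1))
      (by fun_prop)).measurable
  exact h.lintegral_prod_right'.lintegral_prod_right'

theorem sq_L2_wt (δ t : ℝ) {g : Pt → ℝ} (hg : Continuous g) :
    L2 δ (wt t g) ^ 2 = ∫⁻ c in Set.Ico 0 δ,
      planeSq (fun a b => t - ‖pt a b c‖) (fun a b => g (pt a b c)) := by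
  have h : L2 δ (wt t g) ^ 2 = ∫⁻ x in slab δ, ‖wt t g x‖ₑ ^ 2 := by
    have := eLpNorm_nnreal_pow_eq_lintegral (f := wt t g) (μ := volume.restrict (slab δ))
      (p := 2) (by norm_num)
    simpa [L2] using this
  rw [h, lintegral_slab]
  · rfl
  · unfold wt
    fun_prop

theorem lintegral_levelSq (δ t : ℝ) {f : Pt → ℝ} (hf : ContDiff ℝ 2 f) :
    ∫⁻ c in Set.Ico 0 δ, levelSq t f c = ∑ a ∈ idx2 2, L2 δ (wt t (pdv a f)) ^ 2 := by
  have hidx : idx2 2 = {![0, 0], ![1, 0], ![0, 1], ![2, 0], ![1, 1], ![0, 2]} := by decide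
  have h1 : ∀ i, ContDiff ℝ 1 (pd i f) := fun i => contDiff_pd hf (by norm_num) i
  have h2 : ∀ i j, Continuous (pd i (pd j f)) := fun i j =>
    (contDiff_pd (m := 0) (h1 j) (by norm_num) i).continuous
  have hm : ∀ {g : Pt → ℝ}, Continuous g → Measurable fun c =>
      planeSq (fun a b => t - ‖pt a b c‖) (fun a b => g (pt a b c)) := by
    intro g hg
    exact measurable_lintegral_pt (F := fun x => ‖(t - ‖x‖) * g x‖ₑ ^ 2) (by fun_prop)
  have m0 := hm hf.continuous
  have m1 := fun i => hm (h1 i).continuous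
  have m2 := fun i j => hm (h2 i j)
  rw [hidx]
  unfold pdv
  simp only [levelSq, jetSq]
  rw [lintegral_add_right _ (m2 1 1), lintegral_add_right _ (m2 0 1), lintegral_add_right _ (m2 0 0),
    lintegral_add_right _ (m1 1), lintegral_add_right _ (m1 0), ← sq_L2_wt δ t hf.continuous,
    ← sq_L2_wt δ t (h1 0).continuous, ← sq_L2_wt δ t (h1 1).continuous, ← sq_L2_wt δ t (h2 0 0),
    ← sq_L2_wt δ t (h2 0 1), ← sq_L2_wt δ t (h2 1 1)]
  simp [Finset.sum_insert, add_assoc]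

theorem pdv_pd_comm {f : Pt → ℝ} (hf : ContDiff ℝ 3 f) {a : Fin 2 → ℕ} (ha : a ∈ idx2 2) :
    pdv a (pd 2 f) = pd 2 (pdv a f) := by
  have hidx : idx2 2 = {![0, 0], ![1, 0], ![0, 1], ![2, 0], ![1, 1], ![0, 2]} := by decide
  have h1 : ∀ i, pd i (pd 2 f) = pd 2 (pd i f) := fun i => pd_comm (hf.of_le (by norm_num)) i 2
  have h2 : ∀ i j, pd i (pd 2 (pd j f)) = pd 2 (pd i (pd j f)) := fun i j => by
    rw [pd_comm (contDiff_pd hf (by norm_num) j) i 2]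
  rw [hidx] at ha
  simp only [Finset.mem_insert, Finset.mem_singleton] at ha
  rcases ha with rfl | rfl | rfl | rfl | rfl | rfl <;> simp [pdv, h1, h2]

theorem lintegral_sq_enorm_le {f : Pt → ℝ} (hf : ContDiff ℝ 2 f) {δ t p h : ℝ} {x : Pt}
    (ht : 0 < t) (hx : ‖x‖ ≤ t / 2) (hsub : Set.Icc p (p + h) ⊆ Set.Ico 0 δ)
    (hnear : ∀ c ∈ Set.Icc p (p + h), |c - x 2| ≤ t / 8) :
    ENNReal.ofReal (t * max t 1 / 16) *
        ∫⁻ c in Set.Icc p (p + h), ‖f (pt (x 0) (x 1) c)‖ₑ ^ 2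
      ≤ 3200000 * (∑ a ∈ idx2 2, L2 δ (wt t (pdv a f))) ^ 2 := by
  calc _ = ∫⁻ c in Set.Icc p (p + h),
          ENNReal.ofReal (t * max t 1 / 16) * ‖f (pt (x 0) (x 1) c)‖ₑ ^ 2 :=
        (lintegral_const_mul' _ _ ENNReal.ofReal_ne_top).symm
    _ ≤ ∫⁻ c in Set.Icc p (p + h), 3200000 * levelSq t f c :=
        setLIntegral_mono' measurableSet_Icc fun c hc => sq_enorm_le_levelSq hf ht hx (hnear c hc)
    _ ≤ ∫⁻ c in Set.Ico 0 δ, 3200000 * levelSq t f c := lintegral_mono_set hsub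
    _ = 3200000 * ∑ a ∈ idx2 2, L2 δ (wt t (pdv a f)) ^ 2 := by
        rw [lintegral_const_mul' _ _ (by norm_num), lintegral_levelSq δ t hf]
    _ ≤ _ := by
        gcongr
        exact Finset.sum_sq_le_sq_sum_of_nonneg fun _ _ => zero_le

theorem exists_Icc_subset_Ico {δ h s : ℝ} (hh : 0 ≤ h) (hδ : h ≤ δ / 8)
    (hs : s ∈ Set.Ico 0 δ) :
    ∃ p, s ∈ Set.Icc p (p + h) ∧ Set.Icc p (p + h) ⊆ Set.Ico 0 δ := by
  obtain ⟨h0, h1⟩ := hs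
  rcases le_total (δ / 2) s with hs | hs
  · refine ⟨s - h, ⟨by linarith, by linarith⟩, fun c hc => ⟨?_, ?_⟩⟩ <;> linarith [hc.1, hc.2]
  · refine ⟨s, ⟨le_rfl, by linarith⟩, fun c hc => ⟨?_, ?_⟩⟩ <;> linarith [hc.1, hc.2]

theorem mul_sq_le_mul_max_mul_min {δ t : ℝ} (hδ : 0 < δ) (hδ1 : δ ≤ 1) (ht : 0 < t) :
    δ * t ^ 2 ≤ 128 * (t * max t 1 / 16 * (min t δ / 8)) := by
  have h : δ * t ≤ max t 1 * min t δ := by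
    rcases le_total t δ with h | h
    · rw [min_eq_left h]
      gcongr
      exact hδ1.trans (le_max_right _ _)
    · rw [min_eq_right h, mul_comm]
      gcongr
      exact le_max_left _ _
  nlinarith

theorem mul_sq_enorm_le_sobolev {f : Pt → ℝ} (hf : ContDiff ℝ 3 f) {δ t : ℝ} {x : Pt}
    (hδ : 0 < δ) (hδ1 : δ ≤ 1) (ht : 0 < t) (hxs : x ∈ slab δ) (hx : ‖x‖ ≤ t / 2) :
    ENNReal.ofReal δ * ENNReal.ofReal t ^ 2 * ‖f x‖ₑ ^ 2 ≤
      819200000 * ((∑ a ∈ idx2 2, L2 δ (wt t (pdv a f))) ^ 2 + ENNReal.ofReal δ ^ 2 *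
        (∑ a ∈ idx2 2, L2 δ (wt t (pd 2 (pdv a f)))) ^ 2) := by
  set h := min t δ / 8 with hh
  have hpos : 0 < h := by positivity
  have hhδ : h ≤ δ / 8 := by rw [hh]; gcongr; exact min_le_right _ _
  have hht : h ≤ t / 8 := by rw [hh]; gcongr; exact min_le_left _ _
  obtain ⟨p, hp, hsub⟩ := exists_Icc_subset_Ico hpos.le hhδ hxs
  have hnear : ∀ c ∈ Set.Icc p (p + h), |c - x 2| ≤ t / 8 := fun c hc =>
    abs_le.2 ⟨by linarith [hc.1, hp.2], by linarith [hc.2, hp.1]⟩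
  have hf2 : ContDiff ℝ 2 (pd 2 f) := contDiff_pd hf (by norm_num) 2
  have h0 := lintegral_sq_enorm_le (hf.of_le (by norm_num)) ht hx hsub hnear
  have h1 := lintegral_sq_enorm_le hf2 ht hx hsub hnear
  rw [Finset.sum_congr rfl fun a ha => by rw [pdv_pd_comm hf ha]] at h1
  have hv := mul_sq_enorm_le (u := fun s => f (pt (x 0) (x 1) s))
    (fun s => hasDerivAt_comp_pt₃ (hf.of_le (by norm_num)) (x 0) (x 1) s)
    (hf2.continuous.comp (continuous_pt.comp (f := fun s : ℝ => (x 0, x 1, s)) (by fun_prop))) hp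
  rw [pt_coords] at hv
  have hK : ENNReal.ofReal δ * ENNReal.ofReal t ^ 2 ≤
      128 * (ENNReal.ofReal (t * max t 1 / 16) * ENNReal.ofReal h) := by
    rw [← ENNReal.ofReal_pow ht.le, ← ENNReal.ofReal_mul hδ.le,
      ← ENNReal.ofReal_mul (by positivity), ← ENNReal.ofReal_ofNat,
      ← ENNReal.ofReal_mul (by norm_num)]
    exact ENNReal.ofReal_le_ofReal (mul_sq_le_mul_max_mul_min hδ hδ1 ht)
  have hHD : ENNReal.ofReal h ≤ ENNReal.ofReal δ := ENNReal.ofReal_le_ofReal (by linarith)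
  set K := ENNReal.ofReal (t * max t 1 / 16)
  set H := ENNReal.ofReal h
  set I0 := ∫⁻ c in Set.Icc p (p + h), ‖f (pt (x 0) (x 1) c)‖ₑ ^ 2
  set I1 := ∫⁻ c in Set.Icc p (p + h), ‖pd 2 f (pt (x 0) (x 1) c)‖ₑ ^ 2
  calc _ ≤ 128 * (K * H) * ‖f x‖ₑ ^ 2 := by gcongr
    _ = 128 * K * (H * ‖f x‖ₑ ^ 2) := by ring
    _ ≤ 128 * K * (2 * (I0 + H ^ 2 * I1)) := by gcongr
    _ = 256 * (K * I0 + H ^ 2 * (K * I1)) := by ring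
    _ ≤ 256 * (3200000 * (∑ a ∈ idx2 2, L2 δ (wt t (pdv a f))) ^ 2 + ENNReal.ofReal δ ^ 2 *
        (3200000 * (∑ a ∈ idx2 2, L2 δ (wt t (pd 2 (pdv a f)))) ^ 2)) := by gcongr
    _ = _ := by ring

theorem weighted_sobolev_KS3 :
    ∃ C : ℝ, 0 < C ∧
      ∀ (δ : ℝ), 0 < δ → δ ≤ 1 →
      ∀ (t : ℝ), 0 < t →
      ∀ f : Pt → ℝ, ContDiff ℝ 3 f → (∀ x, f (x + δ • e3) = f x) →
      ∀ x : Pt, x ∈ slab δ → ‖x‖ ≤ t / 2 →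
        ENNReal.ofReal (t * |f x|) ≤
          ENNReal.ofReal C *
            (ENNReal.ofReal (δ ^ (-(1:ℝ)/2)) *
                (∑ a ∈ idx2 2, L2 δ (wt t (pdv a f)))
              + ENNReal.ofReal (δ ^ ((1:ℝ)/2)) *
                (∑ a ∈ idx2 2, L2 δ (wt t (pd 2 (pdv a f))))) := by
  refine ⟨30000, by norm_num, fun δ hδ hδ1 t ht f hf _ x hxs hx => ?_⟩
  have key := mul_sq_enorm_le_sobolev hf hδ hδ1 ht hxs hx
  set S0 := ∑ a ∈ idx2 2, L2 δ (wt t (pdv a f))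
  set S1 := ∑ a ∈ idx2 2, L2 δ (wt t (pd 2 (pdv a f)))
  have hr2 : ENNReal.ofReal (δ ^ ((1:ℝ)/2)) ^ 2 = ENNReal.ofReal δ := by
    rw [← ENNReal.ofReal_pow (by positivity), ← Real.sqrt_eq_rpow, Real.sq_sqrt hδ.le]
  have hrr : ENNReal.ofReal (δ ^ (-(1:ℝ)/2)) * ENNReal.ofReal (δ ^ ((1:ℝ)/2)) = 1 := by
    rw [← ENNReal.ofReal_mul (by positivity), ← Real.rpow_add hδ]
    norm_num
  set r := ENNReal.ofReal (δ ^ ((1:ℝ)/2))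
  set r' := ENNReal.ofReal (δ ^ (-(1:ℝ)/2))
  have hfx : ENNReal.ofReal (t * |f x|) = ENNReal.ofReal t * ‖f x‖ₑ := by
    rw [ENNReal.ofReal_mul ht.le, Real.enorm_eq_ofReal_abs]
  have hC : ENNReal.ofReal 30000 = 30000 := ENNReal.ofReal_ofNat _
  rw [hfx, hC]
  have hsq : (r * (ENNReal.ofReal t * ‖f x‖ₑ)) ^ 2 ≤ (30000 * (S0 + r ^ 2 * S1)) ^ 2 := by
    calc _ = r ^ 2 * ENNReal.ofReal t ^ 2 * ‖f x‖ₑ ^ 2 := by ring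
      _ ≤ 819200000 * (S0 ^ 2 + (r ^ 2) ^ 2 * S1 ^ 2) := by rw [hr2]; exact key
      _ ≤ 900000000 * (S0 ^ 2 + (r ^ 2) ^ 2 * S1 ^ 2 + 2 * S0 * (r ^ 2 * S1)) := by
          exact mul_le_mul' (by norm_num) le_self_add
      _ = _ := by ring
  calc ENNReal.ofReal t * ‖f x‖ₑ = r' * (r * (ENNReal.ofReal t * ‖f x‖ₑ)) := by
        rw [← mul_assoc, hrr, one_mul]
    _ ≤ r' * (30000 * (S0 + r ^ 2 * S1)) := by
        exact mul_le_mul_right ((ENNReal.pow_le_pow_left_iff two_ne_zero).1 hsq) _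
    _ = 30000 * (r' * S0 + (r' * r) * (r * S1)) := by ring
    _ = _ := by rw [hrr, one_mul]

end Stmt6
end
end
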